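/- Fix α > 0 with α ≠ 1, and let n ≥ 1. For every 1 < p < ∞ there is a constant C such that for every Schwartz function f on ℝ^n and every λ > 0, ‖λ √(N_λ{ℋ^{(2^{kα})}f : k ∈ ℤ})‖_{L^p(ℝ^n)} ≤ C ‖f‖_{L^p(ℝ^n)}, uniformly in λ. -/

import Mathlib

open MeasureTheory Filter Set Metric
open scoped ENNReal NNReal RealInnerProductSpace Topology

noncomputable section

/-- The `r`-variation norm of a family of complex numbers indexed by `J ⊆ ι`. -/
def vNorm {ι : Type*} [LinearOrder ι] (r : ℝ) (J : Set ι) (a : ι → ℂ) : ℝ≥0∞ :=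
  ⨆ (k : ℕ) (u : Fin (k + 1) → ι) (_ : StrictMono u) (_ : ∀ i, u i ∈ J),
    (∑ i : Fin k, (‖a (u i.succ) - a (u i.castSucc)‖₊ : ℝ≥0∞) ^ r) ^ (1 / r)

/-- Euclidean space ℝ^n. -/
abbrev En (n : ℕ) := EuclideanSpace ℝ (Fin n)

/-- The kernel K(x) = Ω(x)/|x|^n. -/
def czKernel (n : ℕ) (Ω : En n → ℝ) (x : En n) : ℝ := Ω x / ‖x‖ ^ n

/-- The modulated singular integral ℋ^{(u)}f(x) = p.v.∫ f(x−t) e^{iu|t|^α} K(t) dt. -/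
def pvH (n : ℕ) (α : ℝ) (Ω : En n → ℝ) (f : En n → ℂ) (u : ℝ) (x : En n) : ℂ :=
  limUnder (𝓝[>] (0 : ℝ)) fun ε =>
    ∫ t in {t : En n | ε < ‖t‖},
      f (x - t) * Complex.exp (Complex.I * (u : ℂ) * ((‖t‖ ^ α : ℝ) : ℂ)) *
        (czKernel n Ω t : ℂ)

def jumpCount {ι : Type*} [LinearOrder ι] (lam : ℝ) (J : Set ι) (a : ι → ℂ) : ℝ≥0∞ :=
  ⨆ (N : ℕ) (s : Fin N → ι) (t : Fin N → ι) (_ : ∀ i, s i ∈ J) (_ : ∀ i, t i ∈ J)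
    (_ : ∀ i, s i < t i) (_ : ∀ i j, i < j → t i < s j)
    (_ : ∀ i, lam < ‖a (t i) - a (s i)‖), (N : ℝ≥0∞)

section Dyadic

variable {n : ℕ}

/-- The label of the dyadic cube of side `2 ^ (-k)` containing `x`. -/
def dyGen (k : ℤ) (x : En n) : Fin n → ℤ := fun i => ⌊(2 : ℝ) ^ k * x i⌋

/-- The dyadic cube of side `2 ^ (-k)` containing `x`. -/
def dyCube (k : ℤ) (x : En n) : Set (En n) := {y | dyGen k y = dyGen k x}

/-- The union of the dyadic cube of side `2 ^ (-k)` containing `x` and its neighbours. -/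
def dyStar (k : ℤ) (x : En n) : Set (En n) := {y | ∀ i, |dyGen k y i - dyGen k x i| ≤ 1}

lemma measurable_dyGen (k : ℤ) : Measurable (dyGen k : En n → Fin n → ℤ) := by
  refine measurable_pi_lambda _ fun i => ?_
  exact Int.measurable_floor.comp (by fun_prop)

lemma measurableSet_dyCube (k : ℤ) (x : En n) : MeasurableSet (dyCube k x) :=
  measurable_dyGen k (measurableSet_singleton (dyGen k x))

lemma measurableSet_dyStar (k : ℤ) (x : En n) : MeasurableSet (dyStar k x) :=
  measurable_dyGen k
    (Set.to_countable {c : Fin n → ℤ | ∀ i, |c i - dyGen k x i| ≤ 1}).measurableSet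

lemma mem_dyCube_self (k : ℤ) (x : En n) : x ∈ dyCube k x := rfl

lemma dyCube_eq {k : ℤ} {x y : En n} (h : dyGen k x = dyGen k y) : dyCube k x = dyCube k y := by
  simp [dyCube, h]

lemma dyStar_eq {k : ℤ} {x y : En n} (h : dyGen k x = dyGen k y) : dyStar k x = dyStar k y := by
  simp [dyStar, h]

lemma dyCube_subset_dyStar (k : ℤ) (x : En n) : dyCube k x ⊆ dyStar k x := by
  intro y hy i
  have : dyGen k y = dyGen k x := hy
  simp [this]

lemma dyGen_mono {k k' : ℤ} (hk : k' ≤ k) {x y : En n} (h : dyGen k x = dyGen k y) :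
    dyGen k' x = dyGen k' y := by
  funext i
  obtain ⟨d, rfl⟩ : ∃ d : ℕ, k = k' + d := ⟨(k - k').toNat, by omega⟩
  have key : ∀ z : En n, ∀ m : ℤ, m ≤ dyGen k' z i ↔ m * 2 ^ d ≤ dyGen (k' + d) z i := by
    intro z m
    simp only [dyGen, Int.le_floor]
    rw [zpow_add₀ (by norm_num)]
    push_cast
    rw [zpow_natCast, mul_right_comm]
    exact (mul_le_mul_iff_of_pos_right (by positivity)).symm
  refine le_antisymm ?_ ?_
  · rw [key y, ← h, ← key x]
  · rw [key x, h, ← key y]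

lemma dyCube_mono {k k' : ℤ} (hk : k' ≤ k) (x : En n) : dyCube k x ⊆ dyCube k' x :=
  fun _ hy => dyGen_mono hk hy

lemma preimage_Ico_volume (a b : Fin n → ℝ) :
    volume {y : En n | ∀ i, y i ∈ Set.Ico (a i) (b i)} = ∏ i, ENNReal.ofReal (b i - a i) := by
  have h := EuclideanSpace.volume_preserving_symm_measurableEquiv_toLp (Fin n)
  rw [← Real.volume_pi_Ico,
    ← h.measure_preimage (MeasurableSet.univ_pi fun i => measurableSet_Ico).nullMeasurableSet]
  congr 1
  ext y
  simp only [Set.mem_ofPred_eq, Set.mem_preimage, Set.mem_pi, Set.mem_univ, true_imp_iff]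
  rfl

lemma preimage_Icc_volume (a b : Fin n → ℝ) :
    volume {y : En n | ∀ i, y i ∈ Set.Icc (a i) (b i)} = ∏ i, ENNReal.ofReal (b i - a i) := by
  have h := EuclideanSpace.volume_preserving_symm_measurableEquiv_toLp (Fin n)
  rw [← Real.volume_Icc_pi, ← Set.pi_univ_Icc,
    ← h.measure_preimage (MeasurableSet.univ_pi fun i => measurableSet_Icc).nullMeasurableSet]
  congr 1
  ext y
  simp only [Set.mem_ofPred_eq, Set.mem_preimage, Set.mem_pi, Set.mem_univ, true_imp_iff]
  rfl

lemma dyCube_eq_Ico (k : ℤ) (x : En n) : dyCube k x = {y : En n | ∀ i, y i ∈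
    Set.Ico ((dyGen k x i : ℝ) * ((2 : ℝ) ^ k)⁻¹) (((dyGen k x i : ℝ) + 1) * ((2 : ℝ) ^ k)⁻¹)} := by
  have h2 : (0 : ℝ) < 2 ^ k := by positivity
  ext y
  simp only [dyCube, Set.mem_ofPred_eq, funext_iff, Set.mem_Ico]
  refine forall_congr' fun i => ?_
  rw [show dyGen k y i = ⌊(2 : ℝ) ^ k * y i⌋ from rfl, Int.floor_eq_iff, ← div_eq_mul_inv,
    ← div_eq_mul_inv, div_le_iff₀' h2, lt_div_iff₀' h2]

lemma dyStar_eq_Ico (k : ℤ) (x : En n) : dyStar k x = {y : En n | ∀ i, y i ∈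
    Set.Ico (((dyGen k x i : ℝ) - 1) * ((2 : ℝ) ^ k)⁻¹)
      (((dyGen k x i : ℝ) + 2) * ((2 : ℝ) ^ k)⁻¹)} := by
  have h2 : (0 : ℝ) < 2 ^ k := by positivity
  ext y
  simp only [dyStar, Set.mem_ofPred_eq, Set.mem_Ico]
  refine forall_congr' fun i => ?_
  rw [show dyGen k y i = ⌊(2 : ℝ) ^ k * y i⌋ from rfl, ← div_eq_mul_inv,
    ← div_eq_mul_inv, div_le_iff₀' h2, lt_div_iff₀' h2, abs_le]
  have e1 : ((dyGen k x i : ℝ) - 1) ≤ 2 ^ k * y i ↔ dyGen k x i - 1 ≤ ⌊(2 : ℝ) ^ k * y i⌋ := by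
    rw [Int.le_floor]; push_cast; rfl
  have e2 : 2 ^ k * y i < ((dyGen k x i : ℝ) + 2) ↔ ⌊(2 : ℝ) ^ k * y i⌋ < dyGen k x i + 2 := by
    rw [Int.floor_lt]; push_cast; rfl
  rw [e1, e2]
  omega

lemma volume_dyCube (k : ℤ) (x : En n) :
    volume (dyCube k x) = ENNReal.ofReal ((((2 : ℝ) ^ k)⁻¹) ^ n) := by
  rw [dyCube_eq_Ico, preimage_Ico_volume]
  have : ∀ i, ((dyGen k x i : ℝ) + 1) * ((2 : ℝ) ^ k)⁻¹ - (dyGen k x i : ℝ) * ((2 : ℝ) ^ k)⁻¹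
      = ((2 : ℝ) ^ k)⁻¹ := fun i => by ring
  simp only [this, Finset.prod_const, Finset.card_univ, Fintype.card_fin]
  rw [ENNReal.ofReal_pow (by positivity)]

lemma volume_dyStar (k : ℤ) (x : En n) :
    volume (dyStar k x) = 3 ^ n * volume (dyCube k x) := by
  rw [dyStar_eq_Ico, preimage_Ico_volume, volume_dyCube]
  have : ∀ i, ((dyGen k x i : ℝ) + 2) * ((2 : ℝ) ^ k)⁻¹ -
      ((dyGen k x i : ℝ) - 1) * ((2 : ℝ) ^ k)⁻¹ = 3 * ((2 : ℝ) ^ k)⁻¹ := fun i => by ring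
  simp only [this, Finset.prod_const, Finset.card_univ, Fintype.card_fin]
  rw [ENNReal.ofReal_mul (by norm_num), mul_pow, ENNReal.ofReal_pow (by positivity)]
  norm_num

lemma volume_real_dyCube (k : ℤ) (x : En n) :
    volume.real (dyCube k x) = (((2 : ℝ) ^ k)⁻¹) ^ n := by
  rw [Measure.real, volume_dyCube, ENNReal.toReal_ofReal (by positivity)]

lemma volume_dyCube_ne_top (k : ℤ) (x : En n) : volume (dyCube k x) ≠ ∞ := by
  rw [volume_dyCube]; exact ENNReal.ofReal_ne_top

lemma volume_dyCube_ne_zero (k : ℤ) (x : En n) : volume (dyCube k x) ≠ 0 := by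
  rw [volume_dyCube]
  exact (ENNReal.ofReal_pos.2 (by positivity)).ne'

lemma norm_le_of_coord_le (x : En n) {r : ℝ} (h : ∀ i, |x i| ≤ r) : ‖x‖ ≤ n * r := by
  have h1 : ‖x‖ ≤ ∑ i, ‖x i‖ := by
    rw [EuclideanSpace.norm_eq]
    refine Real.sqrt_le_iff.2 ⟨Finset.sum_nonneg fun i _ => norm_nonneg _, ?_⟩
    exact Finset.sum_sq_le_sq_sum_of_nonneg fun i _ => norm_nonneg _
  refine h1.trans ((Finset.sum_le_sum fun i _ => h i).trans ?_)
  simp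

lemma norm_sub_le_of_dyGen {k : ℤ} {x y : En n} (h : dyGen k x = dyGen k y) :
    ‖x - y‖ ≤ n * ((2 : ℝ) ^ k)⁻¹ := by
  refine norm_le_of_coord_le _ fun i => ?_
  have hx : x ∈ dyCube k y := h
  have hy : y ∈ dyCube k y := rfl
  rw [dyCube_eq_Ico] at hx hy
  have h1 := hx i
  have h2 := hy i
  simp only [Set.mem_Ico, add_mul, one_mul] at h1 h2
  rw [PiLp.sub_apply, abs_le]
  constructor <;> linarith

lemma abs_coord_le_norm (x : En n) (i : Fin n) : |x i| ≤ ‖x‖ := by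
  simpa using PiLp.norm_apply_le x i

lemma mem_dyStar_of_norm_sub_le {k : ℤ} {x y z : En n} (h : dyGen k y = dyGen k z)
    (hxy : ‖x - y‖ ≤ ((2 : ℝ) ^ k)⁻¹) : x ∈ dyStar k z := by
  rw [← dyStar_eq h, dyStar_eq_Ico]
  intro i
  have hy : y ∈ dyCube k y := rfl
  rw [dyCube_eq_Ico] at hy
  have h2 := hy i
  have h3 := (abs_coord_le_norm (x - y) i).trans hxy
  rw [PiLp.sub_apply, abs_le] at h3
  simp only [Set.mem_Ico, add_mul, sub_mul, one_mul] at h2 ⊢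
  constructor <;> linarith

lemma dyStar_of_dyGen_eq {k q : ℤ} (hq : q ≤ k) {x z y : En n} (h : dyGen k x = dyGen k z)
    (hz : z ∈ dyStar q y) : x ∈ dyStar q y := by
  have := dyGen_mono hq h
  intro i
  rw [this]
  exact hz i

/-- Dyadic Lebesgue differentiation, in the form needed for stopping-time arguments. -/
lemma ae_norm_le_of_average_le {f : En n → ℂ} (hf : LocallyIntegrable f volume) :
    ∀ᵐ x : En n, ∀ s : ℝ, (∀ k : ℤ, ∫ y in dyCube k x, ‖f y‖ ≤ s * volume.real (dyCube k x)) →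
      ‖f x‖ ≤ s := by
  have key := IsUnifLocDoublingMeasure.ae_tendsto_average_norm_sub (μ := (volume : Measure (En n)))
    hf 1
  filter_upwards [key] with x hx s hs
  set δ : ℕ → ℝ := fun k => (n + 1) * ((2 : ℝ) ^ (k : ℤ))⁻¹ with hδ
  have hδpos : ∀ k, 0 < δ k := fun k => by positivity
  have hδ0 : Tendsto δ atTop (𝓝[>] 0) := by
    refine tendsto_nhdsWithin_iff.2 ⟨?_, Eventually.of_forall fun k => hδpos k⟩
    have : Tendsto (fun k : ℕ => ((n : ℝ) + 1) * (2⁻¹ : ℝ) ^ k) atTop (𝓝 ((n + 1) * 0)) :=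
      (tendsto_pow_atTop_nhds_zero_of_lt_one (by norm_num) (by norm_num)).const_mul _
    simpa [hδ] using this
  have h0 := hx (fun _ : ℕ => x) δ hδ0
    (Eventually.of_forall fun k => mem_closedBall_self (by simpa using (hδpos k).le))
  set V : ℝ := (n + 1) ^ n * volume.real (ball (0 : En n) 1) with hV
  have hball : ∀ k, volume.real (closedBall x (δ k)) = V * volume.real (dyCube (k : ℤ) x) := by
    intro k
    rw [Measure.real, Measure.addHaar_closedBall _ _ (hδpos k).le, ENNReal.toReal_mul,
      ENNReal.toReal_ofReal (by positivity), volume_real_dyCube, finrank_euclideanSpace,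
      Fintype.card_fin, hV, hδ, mul_pow, Measure.real]
    ring
  have hVpos : 0 < V := by
    have : 0 < volume.real (ball (0 : En n) 1) :=
      ENNReal.toReal_pos (measure_ball_pos _ _ one_pos).ne' measure_ball_lt_top.ne
    positivity
  have hsub : ∀ k : ℕ, dyCube (k : ℤ) x ⊆ closedBall x (δ k) := by
    intro k y hy
    rw [mem_closedBall, dist_eq_norm]
    refine (norm_sub_le_of_dyGen hy).trans ?_
    simp only [hδ]
    gcongr
    linarith
  have hintg : ∀ k, IntegrableOn (fun y => ‖f y - f x‖) (closedBall x (δ k)) volume := by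
    intro k
    have h1 : IntegrableOn f (closedBall x (δ k)) volume :=
      hf.integrableOn_isCompact (isCompact_closedBall _ _)
    exact (h1.sub (integrableOn_const (by exact measure_closedBall_lt_top.ne))).norm
  have hmain : ∀ k : ℕ, ‖f x‖ ≤ s + V * ⨍ y in closedBall x (δ k), ‖f y - f x‖ := by
    intro k
    have hc : 0 < volume.real (dyCube (k : ℤ) x) := by
      rw [volume_real_dyCube]; positivity
    have e1 : ∫ y in dyCube (k : ℤ) x, ‖f x‖ ≤
        ∫ y in dyCube (k : ℤ) x, (‖f y‖ + ‖f y - f x‖) := by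
      have hi1 : IntegrableOn f (dyCube (k : ℤ) x) volume :=
        (hf.integrableOn_isCompact (isCompact_closedBall x (δ k))).mono_set (hsub k)
      refine setIntegral_mono (integrableOn_const (by exact volume_dyCube_ne_top _ _))
        (hi1.norm.add ((hintg k).mono_set (hsub k))) fun y => ?_
      have : f x = f y - (f y - f x) := by ring
      calc ‖f x‖ = ‖f y - (f y - f x)‖ := by rw [← this]
        _ ≤ _ := norm_sub_le _ _
    have hi1 : IntegrableOn f (dyCube (k : ℤ) x) volume :=
        (hf.integrableOn_isCompact (isCompact_closedBall x (δ k))).mono_set (hsub k)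
    rw [integral_add hi1.norm ((hintg k).mono_set (hsub k)), setIntegral_const, smul_eq_mul] at e1
    have e2 : ∫ y in dyCube (k : ℤ) x, ‖f y - f x‖ ≤ ∫ y in closedBall x (δ k), ‖f y - f x‖ :=
      setIntegral_mono_set (hintg k) (Eventually.of_forall fun y => norm_nonneg _)
        (hsub k).eventuallyLE
    have e3 : ∫ y in closedBall x (δ k), ‖f y - f x‖ =
        V * volume.real (dyCube (k : ℤ) x) * ⨍ y in closedBall x (δ k), ‖f y - f x‖ := by
      rw [setAverage_eq, hball, smul_eq_mul, ← mul_assoc, mul_inv_cancel₀ (by positivity), one_mul]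
    have e4 := hs (k : ℤ)
    have e5 : volume.real (dyCube (k : ℤ) x) * ‖f x‖ ≤ volume.real (dyCube (k : ℤ) x) *
        (s + V * ⨍ y in closedBall x (δ k), ‖f y - f x‖) := by
      rw [mul_add]
      nlinarith
    exact le_of_mul_le_mul_left e5 hc
  have hlim : Tendsto (fun k => s + V * ⨍ y in closedBall x (δ k), ‖f y - f x‖) atTop
      (𝓝 (s + V * 0)) := (h0.const_mul V).const_add s
  have := ge_of_tendsto' hlim hmain
  simpa using this

end Dyadic

section Kernels

variable {n : ℕ}

/-- Bounded, measurable, integrable functions. -/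
structure NiceFun (f : En n → ℂ) : Prop where
  meas : Measurable f
  int : Integrable f volume
  bdd : ∃ C : ℝ≥0, ∀ x, ‖f x‖ₑ ≤ C

/-- Bounded measurable kernels which are uniformly integrable in each variable. -/
structure NiceKer (κ : En n → En n → ℂ) : Prop where
  meas : Measurable (Function.uncurry κ)
  bdd : ∃ D : ℝ≥0, (∀ x y, ‖κ x y‖ₑ ≤ D) ∧ (∀ x, ∫⁻ y, ‖κ x y‖ₑ ≤ D) ∧ ∀ y, ∫⁻ x, ‖κ x y‖ₑ ≤ D

/-- The integral operator with kernel `κ`. -/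
def kOp (κ : En n → En n → ℂ) (f : En n → ℂ) (x : En n) : ℂ := ∫ y, κ x y * f y

/-- The kernel of the composition of two integral operators. -/
def kComp (κ₁ κ₂ : En n → En n → ℂ) (x y : En n) : ℂ := ∫ z, κ₁ x z * κ₂ z y

/-- The `L²` norm as a real number. -/
def N2 (f : En n → ℂ) : ℝ := (eLpNorm f 2 volume).toReal

namespace NiceFun

lemma zero : NiceFun (fun _ : En n => (0 : ℂ)) :=
  ⟨measurable_const, integrable_zero _ _ _, 0, by simp⟩

lemma add {f g : En n → ℂ} (hf : NiceFun f) (hg : NiceFun g) : NiceFun (fun x => f x + g x) := by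
  obtain ⟨C, hC⟩ := hf.bdd
  obtain ⟨D, hD⟩ := hg.bdd
  refine ⟨hf.meas.add hg.meas, hf.int.add hg.int, C + D, fun x => ?_⟩
  push_cast
  exact (enorm_add_le _ _).trans (add_le_add (hC x) (hD x))

lemma mul_bdd {f v : En n → ℂ} (hf : NiceFun f) (hv : Measurable v)
    {C : ℝ≥0} (hC : ∀ x, ‖v x‖ₑ ≤ C) : NiceFun (fun x => v x * f x) := by
  obtain ⟨D, hD⟩ := hf.bdd
  refine ⟨hv.mul hf.meas, ?_, C * D, fun x => ?_⟩
  · refine hf.int.bdd_mul (c := C) hv.aestronglyMeasurable (Eventually.of_forall fun x => ?_)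
    have := hC x
    rw [enorm_le_coe] at this
    exact_mod_cast this
  · rw [enorm_mul]; push_cast; exact mul_le_mul' (hC x) (hD x)

lemma const_mul {f : En n → ℂ} (hf : NiceFun f) (c : ℂ) : NiceFun (fun x => c * f x) :=
  hf.mul_bdd (v := fun _ => c) measurable_const (C := ‖c‖₊) fun _ => le_of_eq rfl

lemma sub {f g : En n → ℂ} (hf : NiceFun f) (hg : NiceFun g) : NiceFun (fun x => f x - g x) := by
  simpa [sub_eq_add_neg] using hf.add (hg.const_mul (-1))

lemma sum {ι : Type*} {s : Finset ι} {f : ι → En n → ℂ} (hf : ∀ i ∈ s, NiceFun (f i)) :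
    NiceFun (fun x => ∑ i ∈ s, f i x) := by
  classical
  induction s using Finset.induction_on with
  | empty => simpa using zero
  | insert a s ha ih =>
    simp only [Finset.sum_insert ha]
    exact (hf a (by simp)).add (ih fun i hi => hf i (by simp [hi]))

lemma conj {f : En n → ℂ} (hf : NiceFun f) : NiceFun (fun x => (starRingEnd ℂ) (f x)) := by
  obtain ⟨C, hC⟩ := hf.bdd
  refine ⟨Complex.continuous_conj.measurable.comp hf.meas, ?_, C, fun x => ?_⟩
  · refine hf.int.mono (Complex.continuous_conj.measurable.comp hf.meas).aestronglyMeasurable ?_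
    exact Eventually.of_forall fun x => by simp
  · rw [show ‖(starRingEnd ℂ) (f x)‖ₑ = ‖f x‖ₑ by simp [enorm_eq_nnnorm]]
    exact hC x

lemma indicator {f : En n → ℂ} (hf : NiceFun f) {s : Set (En n)} (hs : MeasurableSet s) :
    NiceFun (s.indicator f) := by
  obtain ⟨C, hC⟩ := hf.bdd
  refine ⟨hf.meas.indicator hs, hf.int.indicator hs, C, fun x => ?_⟩
  exact (enorm_indicator_le_enorm_self _ _).trans (hC x)

lemma lintegral_rpow_lt_top {f : En n → ℂ} (hf : NiceFun f) {p : ℝ} (hp : 1 ≤ p) :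
    ∫⁻ x, ‖f x‖ₑ ^ p < ∞ := by
  obtain ⟨C, hC⟩ := hf.bdd
  have key : ∀ x, ‖f x‖ₑ ^ p ≤ (C : ℝ≥0∞) ^ (p - 1) * ‖f x‖ₑ := fun x => by
    calc ‖f x‖ₑ ^ p = ‖f x‖ₑ ^ ((p - 1) + 1) := by ring_nf
      _ = ‖f x‖ₑ ^ (p - 1) * ‖f x‖ₑ := by
        rw [ENNReal.rpow_add_of_nonneg _ _ (by linarith) (by norm_num), ENNReal.rpow_one]
      _ ≤ _ := by
        gcongr
        exact hC x
  refine (lintegral_mono key).trans_lt ?_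
  rw [lintegral_const_mul _ hf.meas.enorm]
  exact ENNReal.mul_lt_top (ENNReal.rpow_lt_top_of_nonneg (by linarith) ENNReal.coe_ne_top)
    hf.int.2

lemma memLp {f : En n → ℂ} (hf : NiceFun f) {p : ℝ≥0∞} (hp : 1 ≤ p) : MemLp f p volume := by
  rcases eq_or_ne p ∞ with rfl | hp'
  · obtain ⟨C, hC⟩ := hf.bdd
    refine memLp_top_of_bound hf.meas.aestronglyMeasurable C (Eventually.of_forall fun x => ?_)
    have := hC x
    rw [enorm_le_coe] at this
    exact_mod_cast this
  · refine ⟨hf.meas.aestronglyMeasurable, ?_⟩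
    rw [eLpNorm_lt_top_iff_lintegral_rpow_enorm_lt_top (by positivity) hp']
    refine hf.lintegral_rpow_lt_top ?_
    rw [← ENNReal.toReal_one]
    exact ENNReal.toReal_mono hp' hp

lemma lintegral_lt_top {f : En n → ℂ} (hf : NiceFun f) : ∫⁻ x, ‖f x‖ₑ < ∞ := hf.int.2

end NiceFun

namespace NiceKer

lemma zero : NiceKer (fun _ _ : En n => (0 : ℂ)) :=
  ⟨measurable_const, 0, by simp, by simp, by simp⟩

lemma add {κ κ' : En n → En n → ℂ} (h : NiceKer κ) (h' : NiceKer κ') :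
    NiceKer (fun x y => κ x y + κ' x y) := by
  obtain ⟨C, h1, h2, h3⟩ := h.bdd
  obtain ⟨D, h1', h2', h3'⟩ := h'.bdd
  refine ⟨h.meas.add h'.meas, C + D, fun x y => ?_, fun x => ?_, fun y => ?_⟩ <;> push_cast
  · exact (enorm_add_le _ _).trans (add_le_add (h1 x y) (h1' x y))
  · refine (lintegral_mono fun y => enorm_add_le _ _).trans ?_
    rw [lintegral_add_left (h.meas.of_uncurry_left.enorm)]
    exact add_le_add (h2 x) (h2' x)
  · refine (lintegral_mono fun x => enorm_add_le _ _).trans ?_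
    rw [lintegral_add_left (h.meas.of_uncurry_right.enorm)]
    exact add_le_add (h3 y) (h3' y)

lemma mul_bdd {κ : En n → En n → ℂ} (h : NiceKer κ) {v : En n → ℂ} (hv : Measurable v)
    {C : ℝ≥0} (hC : ∀ x, ‖v x‖ₑ ≤ C) : NiceKer (fun x y => v x * κ x y) := by
  obtain ⟨D, h1, h2, h3⟩ := h.bdd
  refine ⟨(hv.comp measurable_fst).mul h.meas, C * D, fun x y => ?_, fun x => ?_, fun y => ?_⟩ <;>
    push_cast <;> simp only [enorm_mul]
  · exact mul_le_mul' (hC x) (h1 x y)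
  · rw [lintegral_const_mul _ h.meas.of_uncurry_left.enorm]
    exact mul_le_mul' (hC x) (h2 x)
  · refine (lintegral_mono fun x => mul_le_mul_left (hC x) _).trans ?_
    rw [lintegral_const_mul _ h.meas.of_uncurry_right.enorm]
    exact mul_le_mul' le_rfl (h3 y)

lemma const_mul {κ : En n → En n → ℂ} (h : NiceKer κ) (c : ℂ) :
    NiceKer (fun x y => c * κ x y) :=
  h.mul_bdd (v := fun _ => c) measurable_const (C := ‖c‖₊) fun _ => le_of_eq rfl

lemma sub {κ κ' : En n → En n → ℂ} (h : NiceKer κ) (h' : NiceKer κ') :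
    NiceKer (fun x y => κ x y - κ' x y) := by
  simpa [sub_eq_add_neg] using h.add (h'.const_mul (-1))

lemma sum {ι : Type*} {s : Finset ι} {κ : ι → En n → En n → ℂ} (h : ∀ i ∈ s, NiceKer (κ i)) :
    NiceKer (fun x y => ∑ i ∈ s, κ i x y) := by
  classical
  induction s using Finset.induction_on with
  | empty => simpa using zero
  | insert a s ha ih =>
    simp only [Finset.sum_insert ha]
    exact (h a (by simp)).add (ih fun i hi => h i (by simp [hi]))

lemma transpose {κ : En n → En n → ℂ} (h : NiceKer κ) : NiceKer (fun x y => κ y x) := by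
  obtain ⟨D, h1, h2, h3⟩ := h.bdd
  exact ⟨h.meas.comp measurable_swap, D, fun x y => h1 y x, h3, h2⟩

lemma integrable_left {κ : En n → En n → ℂ} (h : NiceKer κ) (x : En n) :
    Integrable (κ x) volume := by
  obtain ⟨D, h1, h2, h3⟩ := h.bdd
  exact ⟨h.meas.of_uncurry_left.aestronglyMeasurable, (h2 x).trans_lt ENNReal.coe_lt_top⟩

lemma niceFun_left {κ : En n → En n → ℂ} (h : NiceKer κ) (x : En n) : NiceFun (κ x) := by
  obtain ⟨D, h1, h2, h3⟩ := h.bdd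
  exact ⟨h.meas.of_uncurry_left, h.integrable_left x, D, h1 x⟩

lemma integrable_mul {κ : En n → En n → ℂ} (h : NiceKer κ) {f : En n → ℂ} (hf : NiceFun f)
    (x : En n) : Integrable (fun y => κ x y * f y) volume := by
  obtain ⟨D, h1, h2, h3⟩ := h.bdd
  exact (hf.mul_bdd h.meas.of_uncurry_left (h1 x)).int

lemma measurable_enorm_mul {κ : En n → En n → ℂ} (h : NiceKer κ) {f : En n → ℂ}
    (hf : Measurable f) : Measurable fun z : En n × En n => ‖κ z.1 z.2 * f z.2‖ₑ :=
  (h.meas.mul (hf.comp measurable_snd)).enorm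

lemma integrable_prod {κ : En n → En n → ℂ} (h : NiceKer κ) {f : En n → ℂ} (hf : NiceFun f) :
    Integrable (fun z : En n × En n => κ z.1 z.2 * f z.2) (volume.prod volume) := by
  obtain ⟨D, h1, h2, h3⟩ := h.bdd
  refine ⟨(h.meas.mul (hf.meas.comp measurable_snd)).aestronglyMeasurable, ?_⟩
  rw [HasFiniteIntegral, lintegral_prod_symm' _ (h.measurable_enorm_mul hf.meas)]
  calc ∫⁻ y, ∫⁻ x, ‖κ x y * f y‖ₑ ≤ ∫⁻ y, D * ‖f y‖ₑ := by
        refine lintegral_mono fun y => ?_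
        simp only [enorm_mul]
        rw [lintegral_mul_const _ h.meas.of_uncurry_right.enorm]
        gcongr
        exact h3 y
    _ = D * ∫⁻ y, ‖f y‖ₑ := lintegral_const_mul _ hf.meas.enorm
    _ < ∞ := ENNReal.mul_lt_top ENNReal.coe_lt_top hf.lintegral_lt_top

lemma niceFun_kOp {κ : En n → En n → ℂ} (h : NiceKer κ) {f : En n → ℂ} (hf : NiceFun f) :
    NiceFun (kOp κ f) := by
  refine ⟨?_, (h.integrable_prod hf).integral_prod_left, ?_⟩
  · exact (StronglyMeasurable.integral_prod_right
      (h.meas.mul (hf.meas.comp measurable_snd)).stronglyMeasurable).measurable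
  · obtain ⟨D, h1, h2, h3⟩ := h.bdd
    refine ⟨D * (∫⁻ y, ‖f y‖ₑ).toNNReal, fun x => ?_⟩
    push_cast
    rw [ENNReal.coe_toNNReal hf.lintegral_lt_top.ne]
    refine (enorm_integral_le_lintegral_enorm _).trans ?_
    rw [← lintegral_const_mul _ hf.meas.enorm]
    refine lintegral_mono fun y => ?_
    rw [enorm_mul]
    exact mul_le_mul' (h1 x y) le_rfl

lemma integral_kOp_mul {κ : En n → En n → ℂ} (h : NiceKer κ) {f g : En n → ℂ} (hf : NiceFun f)
    (hg : NiceFun g) : ∫ x, kOp κ f x * g x = ∫ y, f y * kOp (fun x y => κ y x) g y := by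
  obtain ⟨C, hC⟩ := hg.bdd
  have key : Integrable (fun z : En n × En n => g z.1 * (κ z.1 z.2 * f z.2))
      (volume.prod volume) := by
    refine (h.integrable_prod hf).bdd_mul (c := C)
      (hg.meas.comp measurable_fst).aestronglyMeasurable (Eventually.of_forall fun x => ?_)
    have := hC x.1
    rw [enorm_le_coe] at this
    exact_mod_cast this
  calc ∫ x, kOp κ f x * g x = ∫ x, ∫ y, g x * (κ x y * f y) := by
        refine integral_congr_ae (Eventually.of_forall fun x => ?_)
        simp only [kOp]
        rw [mul_comm, ← integral_const_mul]
    _ = ∫ y, ∫ x, g x * (κ x y * f y) := integral_integral_swap key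
    _ = _ := by
        refine integral_congr_ae (Eventually.of_forall fun y => ?_)
        simp only [kOp]
        rw [← integral_const_mul]
        refine integral_congr_ae (Eventually.of_forall fun x => ?_)
        simp only
        ring

lemma comp {κ₁ κ₂ : En n → En n → ℂ} (h₁ : NiceKer κ₁) (h₂ : NiceKer κ₂) :
    NiceKer (kComp κ₁ κ₂) := by
  obtain ⟨C, a1, a2, a3⟩ := h₁.bdd
  obtain ⟨D, b1, b2, b3⟩ := h₂.bdd
  have hm : Measurable fun w : (En n × En n) × En n => κ₁ w.1.1 w.2 * κ₂ w.2 w.1.2 :=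
    (h₁.meas.comp (measurable_fst.fst.prodMk measurable_snd)).mul
      (h₂.meas.comp (measurable_snd.prodMk measurable_fst.snd))
  have hb : ∀ x y, ‖kComp κ₁ κ₂ x y‖ₑ ≤ ∫⁻ z, ‖κ₁ x z‖ₑ * ‖κ₂ z y‖ₑ := fun x y => by
    refine (enorm_integral_le_lintegral_enorm _).trans (le_of_eq ?_)
    simp only [enorm_mul]
  refine ⟨(StronglyMeasurable.integral_prod_right hm.stronglyMeasurable).measurable, C * D,
    fun x y => ?_, fun x => ?_, fun y => ?_⟩ <;> push_cast
  · refine (hb x y).trans ?_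
    refine (lintegral_mono fun z => mul_le_mul_right (b1 z y) _).trans ?_
    rw [lintegral_mul_const _ h₁.meas.of_uncurry_left.enorm]
    exact mul_le_mul' (a2 x) le_rfl
  · refine (lintegral_mono fun y => hb x y).trans ?_
    rw [lintegral_lintegral_swap]
    · calc ∫⁻ z, ∫⁻ y, ‖κ₁ x z‖ₑ * ‖κ₂ z y‖ₑ ≤ ∫⁻ z, ‖κ₁ x z‖ₑ * D := by
            refine lintegral_mono fun z => ?_
            rw [lintegral_const_mul _ h₂.meas.of_uncurry_left.enorm]
            exact mul_le_mul' le_rfl (b2 z)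
        _ ≤ C * D := by
            rw [lintegral_mul_const _ h₁.meas.of_uncurry_left.enorm]
            exact mul_le_mul' (a2 x) le_rfl
    · exact ((h₁.meas.of_uncurry_left.comp measurable_snd).enorm.mul
        (h₂.meas.comp measurable_swap).enorm).aemeasurable
  · refine (lintegral_mono fun x => hb x y).trans ?_
    rw [lintegral_lintegral_swap]
    · calc ∫⁻ z, ∫⁻ x, ‖κ₁ x z‖ₑ * ‖κ₂ z y‖ₑ ≤ ∫⁻ z, C * ‖κ₂ z y‖ₑ := by
            refine lintegral_mono fun z => ?_
            rw [lintegral_mul_const _ h₁.meas.of_uncurry_right.enorm]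
            exact mul_le_mul' (a3 z) le_rfl
        _ ≤ C * D := by
            rw [lintegral_const_mul _ h₂.meas.of_uncurry_right.enorm]
            exact mul_le_mul' le_rfl (b3 y)
    · exact (h₁.meas.enorm.mul
        (h₂.meas.of_uncurry_right.comp measurable_snd).enorm).aemeasurable

lemma kOp_comp {κ₁ κ₂ : En n → En n → ℂ} (h₁ : NiceKer κ₁) (h₂ : NiceKer κ₂) {f : En n → ℂ}
    (hf : NiceFun f) (x : En n) : kOp (kComp κ₁ κ₂) f x = kOp κ₁ (kOp κ₂ f) x := by
  have := h₂.integral_kOp_mul hf (h₁.niceFun_left x)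
  calc kOp (kComp κ₁ κ₂) f x = ∫ y, f y * kOp (fun x y => κ₂ y x) (κ₁ x) y := by
        refine integral_congr_ae (Eventually.of_forall fun y => ?_)
        simp only [kComp, kOp]
        rw [mul_comm]
        congr 1
        exact integral_congr_ae (Eventually.of_forall fun z => mul_comm _ _)
    _ = _ := by
        rw [← this]
        exact integral_congr_ae (Eventually.of_forall fun z => mul_comm _ _)

end NiceKer

lemma kOp_add_right {κ : En n → En n → ℂ} (h : NiceKer κ) {f g : En n → ℂ} (hf : NiceFun f)
    (hg : NiceFun g) (x : En n) : kOp κ (fun y => f y + g y) x = kOp κ f x + kOp κ g x := by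
  simp only [kOp, mul_add]
  exact integral_add (h.integrable_mul hf x) (h.integrable_mul hg x)

lemma kOp_sub_right {κ : En n → En n → ℂ} (h : NiceKer κ) {f g : En n → ℂ} (hf : NiceFun f)
    (hg : NiceFun g) (x : En n) : kOp κ (fun y => f y - g y) x = kOp κ f x - kOp κ g x := by
  simp only [kOp, mul_sub]
  exact integral_sub (h.integrable_mul hf x) (h.integrable_mul hg x)

lemma kOp_sum_right {κ : En n → En n → ℂ} (h : NiceKer κ) {ι : Type*} {s : Finset ι}
    {f : ι → En n → ℂ} (hf : ∀ i ∈ s, NiceFun (f i)) (x : En n) :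
    kOp κ (fun y => ∑ i ∈ s, f i y) x = ∑ i ∈ s, kOp κ (f i) x := by
  simp only [kOp, Finset.mul_sum]
  exact integral_finsetSum _ fun i hi => h.integrable_mul (hf i hi) x

lemma kOp_sub_left {κ κ' : En n → En n → ℂ} (h : NiceKer κ) (h' : NiceKer κ') {f : En n → ℂ}
    (hf : NiceFun f) (x : En n) :
    kOp (fun x y => κ x y - κ' x y) f x = kOp κ f x - kOp κ' f x := by
  simp only [kOp, sub_mul]
  exact integral_sub (h.integrable_mul hf x) (h'.integrable_mul hf x)

lemma kOp_sum_left {ι : Type*} {s : Finset ι} {κ : ι → En n → En n → ℂ}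
    (h : ∀ i ∈ s, NiceKer (κ i)) {f : En n → ℂ} (hf : NiceFun f) (x : En n) :
    kOp (fun x y => ∑ i ∈ s, κ i x y) f x = ∑ i ∈ s, kOp (κ i) f x := by
  simp only [kOp, Finset.sum_mul]
  exact integral_finsetSum _ fun i hi => (h i hi).integrable_mul hf x

lemma kOp_mul_left (v : En n → ℂ) (κ : En n → En n → ℂ) (f : En n → ℂ) (x : En n) :
    kOp (fun x y => v x * κ x y) f x = v x * kOp κ f x := by
  simp only [kOp, mul_assoc]
  exact integral_const_mul _ _

/-- Schur's test. -/
lemma lintegral_kOp_sq_le {κ : En n → En n → ℂ} (h : NiceKer κ) {a b : ℝ≥0∞}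
    (ha : ∀ x, ∫⁻ y, ‖κ x y‖ₑ ≤ a) (hb : ∀ y, ∫⁻ x, ‖κ x y‖ₑ ≤ b) {f : En n → ℂ}
    (hf : NiceFun f) : ∫⁻ x, ‖kOp κ f x‖ₑ ^ (2 : ℝ) ≤ a * b * ∫⁻ x, ‖f x‖ₑ ^ (2 : ℝ) := by
  have key : ∀ x, ‖kOp κ f x‖ₑ ^ (2 : ℝ) ≤ a * ∫⁻ y, ‖κ x y‖ₑ * ‖f y‖ₑ ^ (2 : ℝ) := by
    intro x
    have hk := h.meas.of_uncurry_left (x := x) |>.enorm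
    have h1 : ‖kOp κ f x‖ₑ ≤ ∫⁻ y, ‖κ x y‖ₑ ^ (1 / 2 : ℝ) *
        (‖κ x y‖ₑ ^ (1 / 2 : ℝ) * ‖f y‖ₑ) := by
      refine (enorm_integral_le_lintegral_enorm _).trans (le_of_eq (lintegral_congr fun y => ?_))
      rw [← mul_assoc, ← ENNReal.rpow_add_of_nonneg _ _ (by norm_num) (by norm_num), enorm_mul]
      norm_num
    have h2 := ENNReal.lintegral_mul_le_Lp_mul_Lq volume Real.HolderConjugate.two_two
      (f := fun y => ‖κ x y‖ₑ ^ (1 / 2 : ℝ)) (g := fun y => ‖κ x y‖ₑ ^ (1 / 2 : ℝ) * ‖f y‖ₑ)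
      (hk.pow_const _).aemeasurable ((hk.pow_const _).mul hf.meas.enorm).aemeasurable
    have h3 := ENNReal.rpow_le_rpow (h1.trans h2) (show (0 : ℝ) ≤ 2 by norm_num)
    rw [ENNReal.mul_rpow_of_nonneg _ _ (by norm_num), ← ENNReal.rpow_mul, ← ENNReal.rpow_mul] at h3
    norm_num only [ENNReal.rpow_one] at h3
    refine h3.trans (mul_le_mul' ?_ (le_of_eq ?_))
    · refine le_trans (le_of_eq (lintegral_congr fun y => ?_)) (ha x)
      rw [← ENNReal.rpow_mul]; norm_num
    · refine lintegral_congr fun y => ?_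
      rw [ENNReal.mul_rpow_of_nonneg _ _ (by norm_num), ← ENNReal.rpow_mul]; norm_num
  have hm : Measurable (Function.uncurry fun x y : En n => ‖κ x y‖ₑ * ‖f y‖ₑ ^ (2 : ℝ)) :=
    h.meas.enorm.mul ((hf.meas.comp measurable_snd).enorm.pow_const _)
  calc ∫⁻ x, ‖kOp κ f x‖ₑ ^ (2 : ℝ) ≤ ∫⁻ x, a * ∫⁻ y, ‖κ x y‖ₑ * ‖f y‖ₑ ^ (2 : ℝ) :=
        lintegral_mono key
    _ = a * ∫⁻ x, ∫⁻ y, ‖κ x y‖ₑ * ‖f y‖ₑ ^ (2 : ℝ) :=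
        lintegral_const_mul _ hm.lintegral_prod_right'
    _ = a * ∫⁻ y, ∫⁻ x, ‖κ x y‖ₑ * ‖f y‖ₑ ^ (2 : ℝ) := by
        rw [lintegral_lintegral_swap hm.aemeasurable]
    _ ≤ a * ∫⁻ y, b * ‖f y‖ₑ ^ (2 : ℝ) := by
        gcongr with y
        rw [lintegral_mul_const _ h.meas.of_uncurry_right.enorm]
        exact mul_le_mul' (hb y) le_rfl
    _ = _ := by
        rw [lintegral_const_mul _ (hf.meas.enorm.pow_const _), mul_assoc]

lemma N2_nonneg (f : En n → ℂ) : 0 ≤ N2 f := ENNReal.toReal_nonneg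

lemma lintegral_sq_eq {f : En n → ℂ} (hf : NiceFun f) :
    ∫⁻ x, ‖f x‖ₑ ^ (2 : ℝ) = ENNReal.ofReal (N2 f ^ 2) := by
  have h := hf.memLp (p := 2) (by norm_num)
  have h2 := eLpNorm_eq_lintegral_rpow_enorm_toReal (f := f) (μ := volume) (p := 2)
    (by norm_num) (by norm_num)
  rw [ENNReal.ofReal_pow (N2_nonneg f), N2, ENNReal.ofReal_toReal h.2.ne, h2, ← ENNReal.rpow_natCast,
    ← ENNReal.rpow_mul]
  norm_num

lemma N2_sq_eq_integral {f : En n → ℂ} (hf : NiceFun f) : N2 f ^ 2 = ∫ x, ‖f x‖ ^ 2 := by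
  rw [integral_eq_lintegral_of_nonneg_ae (Eventually.of_forall fun x => by positivity)
    (hf.meas.norm.pow_const 2).aestronglyMeasurable]
  have : ∀ x, ENNReal.ofReal (‖f x‖ ^ 2) = ‖f x‖ₑ ^ (2 : ℝ) := fun x => by
    rw [ENNReal.ofReal_pow (norm_nonneg _), ofReal_norm]
    norm_num
  simp only [this]
  rw [lintegral_sq_eq hf, ENNReal.toReal_ofReal (by positivity)]

lemma N2_le_of_lintegral_le {f g : En n → ℂ} (hf : NiceFun f) (hg : NiceFun g) {c : ℝ}
    (hc : 0 ≤ c) (h : ∫⁻ x, ‖f x‖ₑ ^ (2 : ℝ) ≤ ENNReal.ofReal (c ^ 2) * ∫⁻ x, ‖g x‖ₑ ^ (2 : ℝ)) :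
    N2 f ≤ c * N2 g := by
  rw [lintegral_sq_eq hf, lintegral_sq_eq hg, ← ENNReal.ofReal_mul (by positivity),
    ENNReal.ofReal_le_ofReal_iff (by positivity), ← mul_pow] at h
  exact (pow_le_pow_iff_left₀ (N2_nonneg f) (mul_nonneg hc (N2_nonneg g)) two_ne_zero).1 h

lemma lintegral_le_of_N2_le {f g : En n → ℂ} (hf : NiceFun f) (hg : NiceFun g) {c : ℝ}
    (h : N2 f ≤ c * N2 g) :
    ∫⁻ x, ‖f x‖ₑ ^ (2 : ℝ) ≤ ENNReal.ofReal (c ^ 2) * ∫⁻ x, ‖g x‖ₑ ^ (2 : ℝ) := by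
  rw [lintegral_sq_eq hf, lintegral_sq_eq hg, ← ENNReal.ofReal_mul (by positivity), ← mul_pow]
  exact ENNReal.ofReal_le_ofReal (pow_le_pow_left₀ (N2_nonneg f) h 2)

lemma N2_add_le {f g : En n → ℂ} (hf : NiceFun f) (hg : NiceFun g) :
    N2 (fun x => f x + g x) ≤ N2 f + N2 g := by
  have h1 := hf.memLp (p := 2) (by norm_num)
  have h2 := hg.memLp (p := 2) (by norm_num)
  rw [N2, N2, N2, ← ENNReal.toReal_add h1.2.ne h2.2.ne]
  exact ENNReal.toReal_mono (ENNReal.add_lt_top.2 ⟨h1.2, h2.2⟩).ne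
    (eLpNorm_add_le h1.1 h2.1 (by norm_num))

lemma norm_integral_mul_le {f g : En n → ℂ} (hf : NiceFun f) (hg : NiceFun g) :
    ‖∫ x, f x * g x‖ ≤ N2 f * N2 g := by
  have h2 := ENNReal.lintegral_mul_le_Lp_mul_Lq volume Real.HolderConjugate.two_two
      hf.meas.enorm.aemeasurable hg.meas.enorm.aemeasurable
  have h3 : ‖∫ x, f x * g x‖ₑ ≤ ∫⁻ x, ((fun x => ‖f x‖ₑ) * fun x => ‖g x‖ₑ) x := by
    refine (enorm_integral_le_lintegral_enorm _).trans (le_of_eq ?_)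
    simp only [enorm_mul, Pi.mul_apply]
  rw [lintegral_sq_eq hf, lintegral_sq_eq hg, ENNReal.ofReal_rpow_of_nonneg (by positivity)
    (by norm_num), ENNReal.ofReal_rpow_of_nonneg (by positivity) (by norm_num),
    ← Real.sqrt_eq_rpow, ← Real.sqrt_eq_rpow, Real.sqrt_sq (N2_nonneg _),
    Real.sqrt_sq (N2_nonneg _), ← ENNReal.ofReal_mul (N2_nonneg _)] at h2
  have h4 := h3.trans h2
  rw [← ofReal_norm, ENNReal.ofReal_le_ofReal_iff (mul_nonneg (N2_nonneg _) (N2_nonneg _))] at h4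
  exact h4

lemma N2_conj (f : En n → ℂ) : N2 (fun x => (starRingEnd ℂ) (f x)) = N2 f := by
  rw [N2, N2]
  congr 1
  exact eLpNorm_congr_norm_ae (Eventually.of_forall fun x => by simp)

lemma integral_mul_conj_self {f : En n → ℂ} (hf : NiceFun f) :
    ∫ x, f x * (starRingEnd ℂ) (f x) = ((N2 f ^ 2 : ℝ) : ℂ) := by
  rw [N2_sq_eq_integral hf, ← integral_complex_ofReal]
  refine integral_congr_ae (Eventually.of_forall fun x => ?_)
  simp only [Complex.mul_conj, Complex.normSq_eq_norm_sq]

/-- A bound for the bilinear form of an operator bounds its norm. -/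
lemma N2_le_of_bilin {f : En n → ℂ} (hf : NiceFun f) {c : ℝ} (hc : 0 ≤ c)
    (h : ∀ g, NiceFun g → ‖∫ x, f x * g x‖ ≤ c * N2 g) : N2 f ≤ c := by
  have h1 := h _ hf.conj
  rw [integral_mul_conj_self hf, N2_conj, Complex.norm_real, Real.norm_of_nonneg (by positivity)]
    at h1
  rcases (N2_nonneg f).eq_or_lt with h0 | h0
  · exact h0 ▸ hc
  · nlinarith

end Kernels

section CalderonZygmund

variable {n : ℕ}

lemma ofReal_setIntegral_norm {f : En n → ℂ} (hf : Integrable f volume) (s : Set (En n)) :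
    ENNReal.ofReal (∫ y in s, ‖f y‖) = ∫⁻ y in s, ‖f y‖ₑ :=
  ofReal_integral_norm_eq_lintegral_enorm hf.integrableOn

/-- The dyadic Calderón–Zygmund decomposition at height `s`: the selected cubes are the fibres of
a measurable map `G` with countable range on the measurable set `S`. -/
lemma exists_cz_cubes (hn : 1 ≤ n) {f : En n → ℂ} (hf : NiceFun f) {s : ℝ} (hs : 0 < s) :
    ∃ (S : Set (En n)) (G : En n → ℕ × (Fin n → ℤ)), MeasurableSet S ∧ Measurable G ∧
      (∀ c, S ∩ G ⁻¹' {c} = ∅ ∨ ∃ q z, S ∩ G ⁻¹' {c} = dyCube q z ∧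
        ENNReal.ofReal s * volume (dyCube q z) ≤ ∫⁻ y in dyCube q z, ‖f y‖ₑ ∧
        ∫⁻ y in dyCube q z, ‖f y‖ₑ ≤ ENNReal.ofReal (2 ^ n * s) * volume (dyCube q z)) ∧
      ∀ᵐ x, x ∉ S → ‖f x‖ ≤ s := by
  classical
  set Bad : ℤ → En n → Prop := fun k x =>
    s * volume.real (dyCube k x) < ∫ y in dyCube k x, ‖f y‖ with hBad
  have bad_congr : ∀ {k x y}, dyGen k x = dyGen k y → (Bad k x ↔ Bad k y) := by
    intro k x y h
    simp only [hBad, dyCube_eq h]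
  obtain ⟨m₀, hm₀⟩ : ∃ m₀ : ℕ, (∫ y, ‖f y‖) / s ≤ (2 : ℝ) ^ m₀ := by
    obtain ⟨m, hm⟩ := pow_unbounded_of_one_lt ((∫ y, ‖f y‖) / s) (one_lt_two)
    exact ⟨m, hm.le⟩
  set k₀ : ℤ := -(m₀ : ℤ) with hk₀
  have not_bad : ∀ x, ¬ Bad k₀ x := by
    intro x
    simp only [hBad, not_lt]
    rw [volume_real_dyCube]
    have h1 : ∫ y in dyCube k₀ x, ‖f y‖ ≤ ∫ y, ‖f y‖ :=
      setIntegral_le_integral hf.int.norm (Eventually.of_forall fun y => norm_nonneg _)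
    have h2 : (2 : ℝ) ^ m₀ ≤ (((2 : ℝ) ^ k₀)⁻¹) ^ n := by
      rw [hk₀, zpow_neg, inv_inv, zpow_natCast]
      exact le_self_pow₀ (one_le_pow₀ (by norm_num)) (by omega)
    rw [div_le_iff₀ hs] at hm₀
    nlinarith
  set S : Set (En n) := {x | ∃ m : ℕ, Bad (k₀ + m) x} with hS
  have hmeas : ∀ k, MeasurableSet {x | Bad k x} := by
    intro k
    have : {x | Bad k x} = dyGen k ⁻¹' (dyGen k '' {x | Bad k x}) := by
      ext x
      constructor
      · exact fun h => ⟨x, h, rfl⟩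
      · rintro ⟨y, hy, hyx⟩
        exact (bad_congr hyx).1 hy
    rw [this]
    exact measurable_dyGen k (Set.to_countable _).measurableSet
  have hSm : MeasurableSet S := by
    have : S = ⋃ m : ℕ, {x | Bad (k₀ + m) x} := by ext x; simp [hS]
    rw [this]
    exact MeasurableSet.iUnion fun m => hmeas _
  set mm : En n → ℕ := fun x => if h : ∃ m : ℕ, Bad (k₀ + m) x then Nat.find h else 0 with hmm
  have mm_spec : ∀ x ∈ S, Bad (k₀ + mm x) x := by
    intro x hx
    have hx' : ∃ m : ℕ, Bad (k₀ + m) x := hx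
    simp only [hmm, dif_pos hx']
    exact Nat.find_spec hx'
  have mm_min : ∀ x ∈ S, ∀ j < mm x, ¬ Bad (k₀ + j) x := by
    intro x hx j hj
    have hx' : ∃ m : ℕ, Bad (k₀ + m) x := hx
    simp only [hmm, dif_pos hx'] at hj
    exact Nat.find_min hx' hj
  have mm_eq : ∀ x ∈ S, ∀ y, dyGen (k₀ + mm x) y = dyGen (k₀ + mm x) x → y ∈ S ∧ mm y = mm x := by
    intro x hx y hy
    have h1 : Bad (k₀ + mm x) y := (bad_congr hy).2 (mm_spec x hx)
    have hyS : y ∈ S := ⟨mm x, h1⟩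
    refine ⟨hyS, le_antisymm ?_ ?_⟩
    · by_contra h
      exact mm_min y hyS _ (not_le.1 h) h1
    · by_contra h
      push Not at h
      refine mm_min x hx _ h ((bad_congr ?_).1 (mm_spec y hyS))
      exact dyGen_mono (by omega) hy
  have mm_meas : Measurable mm := by
    refine measurable_to_countable' fun j => ?_
    have : mm ⁻¹' {j} = (S ∩ ({x | Bad (k₀ + j) x} ∩ ⋂ i ∈ Finset.range j, {x | Bad (k₀ + i) x}ᶜ))
        ∪ (Sᶜ ∩ {_x | j = 0}) := by
      ext x
      by_cases hx : x ∈ S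
      · have hx' : ∃ m : ℕ, Bad (k₀ + m) x := hx
        simp only [mem_preimage, mem_singleton_iff, mem_union, mem_inter_iff, hx, true_and,
          mem_compl_iff, not_true, false_and, or_false, mem_iInter, Finset.mem_range]
        constructor
        · rintro rfl
          exact ⟨mm_spec x hx, mm_min x hx⟩
        · rintro ⟨h1, h2⟩
          rcases lt_trichotomy (mm x) j with h | h | h
          · exact absurd (mm_spec x hx) (h2 _ h)
          · exact h
          · exact absurd h1 (mm_min x hx _ h)
      · have hx' : ¬ ∃ m : ℕ, Bad (k₀ + m) x := hx
        simp only [mem_preimage, mem_singleton_iff, mem_union, mem_inter_iff, hx, false_and,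
          mem_compl_iff, not_false_iff, true_and, false_or]
        simp only [hmm, dif_neg hx']
        exact eq_comm
    rw [this]
    refine MeasurableSet.union (hSm.inter ((hmeas _).inter ?_)) (hSm.compl.inter (.const _))
    exact Finset.measurableSet_biInter _ fun i _ => (hmeas _).compl
  set G : En n → ℕ × (Fin n → ℤ) := fun x => (mm x, dyGen (k₀ + mm x) x) with hG
  have hGm : Measurable G := by
    refine mm_meas.prodMk (measurable_to_countable' fun d => ?_)
    have : (fun x => dyGen (k₀ + mm x) x) ⁻¹' {d} =
        ⋃ j : ℕ, mm ⁻¹' {j} ∩ dyGen (k₀ + j) ⁻¹' {d} := by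
      ext x; simp
    rw [this]
    exact MeasurableSet.iUnion fun j => (mm_meas (measurableSet_singleton _)).inter
      (measurable_dyGen _ (measurableSet_singleton _))
  refine ⟨S, G, hSm, hGm, fun c => ?_, ?_⟩
  · rcases (S ∩ G ⁻¹' {c}).eq_empty_or_nonempty with h | ⟨z, hzS, hz⟩
    · exact Or.inl h
    right
    refine ⟨k₀ + mm z, z, ?_, ?_, ?_⟩
    · ext y
      simp only [mem_preimage, mem_singleton_iff] at hz
      simp only [mem_inter_iff, mem_preimage, mem_singleton_iff, ← hz, hG, Prod.mk.injEq]
      constructor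
      · rintro ⟨hyS, h1, h2⟩
        rw [h1] at h2
        exact h2
      · intro hy
        obtain ⟨h1, h2⟩ := mm_eq z hzS y hy
        refine ⟨h1, h2, ?_⟩
        rw [h2]
        exact hy
    · rw [← ofReal_setIntegral_norm hf.int, ← ENNReal.ofReal_toReal (volume_dyCube_ne_top _ z),
        ← ENNReal.ofReal_mul hs.le]
      exact ENNReal.ofReal_le_ofReal (mm_spec z hzS).le
    · have hpos : 0 < mm z := by
        rcases Nat.eq_zero_or_pos (mm z) with h | h
        · have := mm_spec z hzS
          rw [h] at this
          exact absurd (by simpa using this) (not_bad z)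
        · exact h
      rw [← ofReal_setIntegral_norm hf.int, ← ENNReal.ofReal_toReal (volume_dyCube_ne_top _ z),
        ← ENNReal.ofReal_mul (by positivity)]
      refine ENNReal.ofReal_le_ofReal ?_
      have h1 := mm_min z hzS (mm z - 1) (by omega)
      simp only [hBad, not_lt] at h1
      have h2 : k₀ + ((mm z - 1 : ℕ) : ℤ) = k₀ + mm z - 1 := by omega
      rw [h2, volume_real_dyCube, zpow_sub_one₀ (by norm_num), mul_inv, inv_inv, mul_pow] at h1
      have h3 : ∫ y in dyCube (k₀ + mm z) z, ‖f y‖ ≤ ∫ y in dyCube (k₀ + mm z - 1) z, ‖f y‖ :=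
        setIntegral_mono_set hf.int.norm.integrableOn (Eventually.of_forall fun y => norm_nonneg _)
          (Eventually.of_forall (dyCube_mono (by omega) z))
      have h4 := volume_real_dyCube (n := n) (k₀ + mm z) z
      rw [measureReal_def] at h4
      rw [h4]
      linarith
  · filter_upwards [ae_norm_le_of_average_le hf.int.locallyIntegrable] with x hx hxS
    refine hx s fun k => ?_
    rcases le_or_gt k₀ k with h | h
    · obtain ⟨m, rfl⟩ := Int.exists_add_of_le h
      by_contra h'
      exact hxS ⟨m, not_le.1 h'⟩
    · rw [volume_real_dyCube]
      have h1 : ∫ y in dyCube k x, ‖f y‖ ≤ ∫ y, ‖f y‖ :=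
        setIntegral_le_integral hf.int.norm (Eventually.of_forall fun y => norm_nonneg _)
      have h2 : (2 : ℝ) ^ m₀ ≤ (((2 : ℝ) ^ k)⁻¹) ^ n := by
        have h3 : (2 : ℝ) ^ m₀ ≤ ((2 : ℝ) ^ k)⁻¹ := by
          rw [← zpow_neg, ← zpow_natCast]
          exact zpow_le_zpow_right₀ (by norm_num) (by omega)
        exact h3.trans (le_self_pow₀ ((one_le_pow₀ (by norm_num)).trans h3) (by omega))
      rw [div_le_iff₀ hs] at hm₀
      nlinarith

end CalderonZygmund

section WeakType

variable {n : ℕ}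

lemma lintegral_eq_tsum_fibre {L : Type*} [Countable L] [MeasurableSpace L]
    [MeasurableSingletonClass L] {S : Set (En n)} (hS : MeasurableSet S) {G : En n → L}
    (hG : Measurable G) (h : En n → ℝ≥0∞) :
    ∫⁻ x in S, h x = ∑' c, ∫⁻ x in S ∩ G ⁻¹' {c}, h x := by
  rw [← lintegral_iUnion (fun c => hS.inter (hG (measurableSet_singleton c)))]
  · congr 2
    ext x; simp
  · intro c d hcd
    refine Set.disjoint_left.2 ?_
    rintro x ⟨_, hx⟩ ⟨_, hx'⟩
    exact hcd (hx.symm.trans hx')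

lemma exists_cz_good (hn : 1 ≤ n) {f : En n → ℂ} (hf : NiceFun f) {s : ℝ} (hs : 0 < s) :
    ∃ (S : Set (En n)) (G : En n → ℕ × (Fin n → ℤ)) (g : En n → ℂ), MeasurableSet S ∧
      Measurable G ∧
      (∀ c, S ∩ G ⁻¹' {c} = ∅ ∨ ∃ q z, S ∩ G ⁻¹' {c} = dyCube q z ∧
        ENNReal.ofReal s * volume (dyCube q z) ≤ ∫⁻ y in dyCube q z, ‖f y‖ₑ) ∧
      NiceFun g ∧ (∀ x ∉ S, g x = f x) ∧ (∀ c, ∫ x in S ∩ G ⁻¹' {c}, (f x - g x) = 0) ∧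
      (∀ᵐ x, ‖g x‖ₑ ≤ ENNReal.ofReal (2 ^ n * s)) ∧ ∫⁻ x, ‖g x‖ₑ ≤ ∫⁻ x, ‖f x‖ₑ := by
  classical
  obtain ⟨S, G, hS, hG, hc, hae⟩ := exists_cz_cubes hn hf hs
  set Q : ℕ × (Fin n → ℤ) → Set (En n) := fun c => S ∩ G ⁻¹' {c} with hQ
  have hQm : ∀ c, MeasurableSet (Q c) := fun c => hS.inter (hG (measurableSet_singleton c))
  set A : ℕ × (Fin n → ℤ) → ℂ := fun c => (volume.real (Q c) : ℂ)⁻¹ * ∫ y in Q c, f y with hA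
  set g : En n → ℂ := S.piecewise (fun x => A (G x)) f with hg
  have gS : ∀ x ∈ S, g x = A (G x) := fun x hx => by simp [hg, hx]
  have gS' : ∀ x ∉ S, g x = f x := fun x hx => by simp [hg, hx]
  have gQ : ∀ c, ∀ x ∈ Q c, g x = A c := fun c x hx => by
    rw [gS x hx.1, show G x = c from hx.2]
  have gm : Measurable g := Measurable.piecewise hS ((measurable_of_countable A).comp hG) hf.meas
  have hA_le : ∀ c, ‖A c‖ₑ * volume (Q c) ≤ ∫⁻ y in Q c, ‖f y‖ₑ := by
    intro c
    rcases hc c with h | ⟨q, z, h, -, -⟩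
    · rw [show Q c = ∅ from h]; simp
    · rw [show Q c = dyCube q z from h, hA]
      simp only
      rw [show Q c = dyCube q z from h, enorm_mul]
      have h0 := volume_dyCube_ne_zero q z
      have h1 := volume_dyCube_ne_top q z
      have h2 : ‖((volume.real (dyCube q z) : ℝ) : ℂ)⁻¹‖ₑ = (volume (dyCube q z))⁻¹ := by
        have hpos : (volume.real (dyCube q z)) ≠ 0 := by
          rw [measureReal_def, ENNReal.toReal_ne_zero]; exact ⟨h0, h1⟩
        rw [enorm_inv (by exact_mod_cast hpos), ← ofReal_norm, Complex.norm_real,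
          Real.norm_of_nonneg measureReal_nonneg, measureReal_def, ENNReal.ofReal_toReal h1]
      rw [h2, mul_comm, ← mul_assoc, ENNReal.mul_inv_cancel h0 h1, one_mul]
      exact enorm_integral_le_lintegral_enorm _
  have hA_bd : ∀ x ∈ S, ‖g x‖ₑ ≤ ENNReal.ofReal (2 ^ n * s) := by
    intro x hx
    have hxQ : x ∈ Q (G x) := ⟨hx, rfl⟩
    rw [gS x hx]
    rcases hc (G x) with h | ⟨q, z, h, -, h3⟩
    · exact absurd (show x ∈ (∅ : Set (En n)) from h ▸ hxQ) (by simp)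
    · have h4 := hA_le (G x)
      rw [show Q (G x) = dyCube q z from h] at h4
      exact (ENNReal.mul_le_mul_iff_left (volume_dyCube_ne_zero q z)
        (volume_dyCube_ne_top q z)).1 (h4.trans h3)
  have hg_le : ∫⁻ x, ‖g x‖ₑ ≤ ∫⁻ x, ‖f x‖ₑ := by
    rw [← lintegral_add_compl _ hS, ← lintegral_add_compl (fun x => ‖f x‖ₑ) hS]
    refine add_le_add ?_ (le_of_eq (setLIntegral_congr_fun hS.compl fun x hx => ?_))
    · rw [lintegral_eq_tsum_fibre hS hG, lintegral_eq_tsum_fibre hS hG]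
      refine ENNReal.tsum_le_tsum fun c => ?_
      rw [setLIntegral_congr_fun (g := fun _ => ‖A c‖ₑ) (hQm c)
        (fun x hx => by simp only [gQ c x hx]), setLIntegral_const]
      exact hA_le c
    · simp only [gS' x hx]
  have gnice : NiceFun g := by
    obtain ⟨C, hC⟩ := hf.bdd
    refine ⟨gm, ⟨gm.aestronglyMeasurable, hg_le.trans_lt hf.lintegral_lt_top⟩,
      C + (2 ^ n * s).toNNReal, fun x => ?_⟩
    by_cases hx : x ∈ S
    · refine (hA_bd x hx).trans ?_
      rw [ENNReal.ofReal]
      exact_mod_cast le_add_self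
    · rw [gS' x hx]
      refine (hC x).trans ?_
      exact_mod_cast le_self_add
  refine ⟨S, G, g, hS, hG, fun c => ?_, gnice, gS', fun c => ?_, ?_, hg_le⟩
  · rcases hc c with h | ⟨q, z, h, h1, -⟩
    · exact Or.inl h
    · exact Or.inr ⟨q, z, h, h1⟩
  · rw [integral_sub hf.int.integrableOn gnice.int.integrableOn,
      setIntegral_congr_fun (g := fun _ => A c) (hQm c) (fun x hx => gQ c x hx),
      setIntegral_const]
    rcases hc c with h | ⟨q, z, h, -, -⟩
    · simp [h, show Q c = ∅ from h]
    · have hpos : (volume.real (Q c)) ≠ 0 := by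
        rw [show Q c = dyCube q z from h, measureReal_def, ENNReal.toReal_ne_zero]
        exact ⟨volume_dyCube_ne_zero q z, volume_dyCube_ne_top q z⟩
      rw [Complex.real_smul, hA]
      simp only
      rw [← mul_assoc, mul_inv_cancel₀ (by exact_mod_cast hpos), one_mul, sub_self]
  · filter_upwards [hae] with x hx
    by_cases hxS : x ∈ S
    · exact hA_bd x hxS
    · rw [gS' x hxS, ← ofReal_norm]
      refine ENNReal.ofReal_le_ofReal ((hx hxS).trans ?_)
      exact le_mul_of_one_le_left hs.le (one_le_pow₀ (by norm_num))

/-- The vector valued operator with component kernels `u i`. -/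
def vOp {ι : Type*} [Fintype ι] (u : ι → En n → En n → ℂ) (f : En n → ℂ) (x : En n) :
    EuclideanSpace ℂ ι := WithLp.toLp 2 fun i => kOp (u i) f x

variable {ι : Type*} [Fintype ι] {u : ι → En n → En n → ℂ}

lemma measurable_vOp (hu : ∀ i, NiceKer (u i)) {f : En n → ℂ} (hf : NiceFun f) :
    Measurable (vOp u f) :=
  (WithLp.measurable_toLp 2 _).comp
    (measurable_pi_lambda _ fun i => ((hu i).niceFun_kOp hf).meas)

lemma vOp_add (hu : ∀ i, NiceKer (u i)) {f g : En n → ℂ} (hf : NiceFun f) (hg : NiceFun g)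
    (x : En n) : vOp u (fun y => f y + g y) x = vOp u f x + vOp u g x := by
  ext i
  simp [vOp, kOp_add_right (hu i) hf hg]

lemma enorm_euclidean_le_sum (v : EuclideanSpace ℂ ι) : ‖v‖ₑ ≤ ∑ i, ‖v i‖ₑ := by
  classical
  have h := (EuclideanSpace.basisFun ι ℂ).sum_repr v
  calc ‖v‖ₑ = ‖∑ i, (EuclideanSpace.basisFun ι ℂ).repr v i • EuclideanSpace.basisFun ι ℂ i‖ₑ := by
        rw [h]
    _ ≤ ∑ i, ‖(EuclideanSpace.basisFun ι ℂ).repr v i • EuclideanSpace.basisFun ι ℂ i‖ₑ :=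
        enorm_sum_le _ _
    _ = _ := by
        refine Finset.sum_congr rfl fun i _ => ?_
        rw [enorm_smul, show ‖EuclideanSpace.basisFun ι ℂ i‖ₑ = 1 by
          rw [← ofReal_norm, OrthonormalBasis.norm_eq_one]; simp, mul_one]
        rfl

/-- The far part of a sum of atoms supported in dyadic cubes. -/
lemma lintegral_vOp_atoms_le (hu : ∀ i, NiceKer (u i)) {A : ℝ≥0∞}
    (hH : ∀ q (y y' : En n), dyGen q y = dyGen q y' →
      ∫⁻ x in (dyStar q y)ᶜ, ∑ i, ‖u i x y - u i x y'‖ₑ ≤ A)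
    {b : En n → ℂ} (hb : NiceFun b) {L : Type*} [Countable L] [MeasurableSpace L]
    [MeasurableSingletonClass L] {S : Set (En n)} (hS : MeasurableSet S) {G : En n → L}
    (hG : Measurable G) (hbS : ∀ x ∉ S, b x = 0) (q : L → ℤ) (z : L → En n)
    (hQ : ∀ c, S ∩ G ⁻¹' {c} = ∅ ∨ S ∩ G ⁻¹' {c} = dyCube (q c) (z c))
    (hmean : ∀ c, ∫ x in S ∩ G ⁻¹' {c}, b x = 0) {F : Set (En n)}
    (hFQ : ∀ c, S ∩ G ⁻¹' {c} = dyCube (q c) (z c) → dyStar (q c) (z c) ⊆ F) :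
    ∫⁻ x in Fᶜ, ‖vOp u b x‖ₑ ≤ A * ∫⁻ x, ‖b x‖ₑ := by
  set Q : L → Set (En n) := fun c => S ∩ G ⁻¹' {c} with hQdef
  have hQm : ∀ c, MeasurableSet (Q c) := fun c => hS.inter (hG (measurableSet_singleton c))
  have hQS : S = ⋃ c, Q c := by ext x; simp [hQdef]
  have hQd : Pairwise (Function.onFun Disjoint Q) := by
    intro c d hcd
    refine Set.disjoint_left.2 ?_
    rintro x ⟨_, hx⟩ ⟨_, hx'⟩
    exact hcd (hx.symm.trans hx')
  have h1 : ∀ i x, ‖kOp (u i) b x‖ₑ ≤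
      ∑' c, ∫⁻ y in Q c, ‖u i x y - u i x (z c)‖ₑ * ‖b y‖ₑ := by
    intro i x
    have e1 : kOp (u i) b x = ∫ y in ⋃ c, Q c, u i x y * b y := by
      rw [← hQS, kOp, ← integral_indicator hS]
      congr 1
      ext y
      by_cases hy : y ∈ S
      · simp [hy]
      · simp [hy, hbS y hy]
    have hintg := (hu i).integrable_mul hb x
    have e2 : kOp (u i) b x = ∑' c, ∫ y in Q c, (u i x y - u i x (z c)) * b y := by
      rw [e1, integral_iUnion hQm hQd hintg.integrableOn]
      refine tsum_congr fun c => ?_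
      simp only [sub_mul]
      rw [integral_sub hintg.integrableOn (hb.const_mul _).int.integrableOn, integral_const_mul,
        hmean c, mul_zero, sub_zero]
    rw [e2]
    refine enorm_tsum_le_tsum_enorm.trans (ENNReal.tsum_le_tsum fun c => ?_)
    refine (enorm_integral_le_lintegral_enorm _).trans (le_of_eq ?_)
    simp only [enorm_mul]
  have hm : ∀ i c, Measurable (Function.uncurry fun x y : En n =>
      ‖u i x y - u i x (z c)‖ₑ * ‖b y‖ₑ) := fun i c =>
    ((hu i).meas.sub ((hu i).meas.of_uncurry_right.comp measurable_fst)).enorm.mul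
      (hb.meas.comp measurable_snd).enorm
  calc ∫⁻ x in Fᶜ, ‖vOp u b x‖ₑ
      ≤ ∫⁻ x in Fᶜ, ∑' c, ∫⁻ y in Q c, ∑ i, ‖u i x y - u i x (z c)‖ₑ * ‖b y‖ₑ := by
        refine lintegral_mono fun x => (enorm_euclidean_le_sum _).trans ?_
        refine (Finset.sum_le_sum fun i _ => h1 i x).trans (le_of_eq ?_)
        rw [← Summable.tsum_finsetSum fun i _ => ENNReal.summable]
        refine tsum_congr fun c => ?_
        rw [lintegral_finsetSum]
        exact fun i _ => (hm i c).of_uncurry_left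
    _ = ∑' c, ∫⁻ x in Fᶜ, ∫⁻ y in Q c, ∑ i, ‖u i x y - u i x (z c)‖ₑ * ‖b y‖ₑ := by
        refine lintegral_tsum fun c => Measurable.aemeasurable ?_
        exact Measurable.lintegral_prod_right' (Finset.measurable_sum _ fun i _ => hm i c)
    _ = ∑' c, ∫⁻ y in Q c, ∫⁻ x in Fᶜ, ∑ i, ‖u i x y - u i x (z c)‖ₑ * ‖b y‖ₑ := by
        refine tsum_congr fun c => lintegral_lintegral_swap (Measurable.aemeasurable ?_)
        exact Finset.measurable_sum _ fun i _ => hm i c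
    _ ≤ ∑' c, ∫⁻ y in Q c, A * ‖b y‖ₑ := by
        refine ENNReal.tsum_le_tsum fun c => setLIntegral_mono' (hQm c) fun y hy => ?_
        rcases hQ c with h | h
        · exact absurd (show y ∈ (∅ : Set (En n)) from h ▸ hy) (by simp)
        have hy' : dyGen (q c) y = dyGen (q c) (z c) := by
          have : y ∈ dyCube (q c) (z c) := h ▸ hy
          exact this
        simp only [← Finset.sum_mul]
        rw [lintegral_mul_const _ (Finset.measurable_sum _ fun i _ => ?_)]
        · gcongr
          refine (lintegral_mono_set ?_).trans (hH (q c) y (z c) hy')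
          rw [dyStar_eq hy']
          exact Set.compl_subset_compl.2 (hFQ c h)
        · exact ((hu i).meas.of_uncurry_right.sub (hu i).meas.of_uncurry_right).enorm
    _ = A * ∫⁻ x in S, ‖b x‖ₑ := by
        rw [lintegral_eq_tsum_fibre hS hG, ← ENNReal.tsum_mul_left]
        exact tsum_congr fun c => lintegral_const_mul _ hb.meas.enorm
    _ ≤ _ := by
        gcongr
        exact Measure.restrict_le_self

/-- The weak type (1,1) inequality for vector valued Calderón–Zygmund operators. -/
theorem weak_type_vOp (hn : 1 ≤ n) (hu : ∀ i, NiceKer (u i)) {W : ℝ} (hW : 0 < W)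
    (hL2 : ∀ f, NiceFun f →
      ∫⁻ x, ‖vOp u f x‖ₑ ^ (2 : ℝ) ≤ ENNReal.ofReal (W ^ 2) * ∫⁻ x, ‖f x‖ₑ ^ (2 : ℝ))
    (hH : ∀ q (y y' : En n), dyGen q y = dyGen q y' →
      ∫⁻ x in (dyStar q y)ᶜ, ∑ i, ‖u i x y - u i x y'‖ₑ ≤ ENNReal.ofReal W)
    {f : En n → ℂ} (hf : NiceFun f) {t : ℝ} (ht : 0 < t) :
    volume {x | t < ‖vOp u f x‖} ≤
      ENNReal.ofReal ((4 * 2 ^ n + 3 ^ n + 4) * W / t) * ∫⁻ x, ‖f x‖ₑ := by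
  classical
  set s : ℝ := t / W with hs
  have hs0 : 0 < s := by positivity
  obtain ⟨S, G, g, hS, hG, hQ, hg, hgS, hmean, hgb, hg1⟩ := exists_cz_good hn hf hs0
  set Q : ℕ × (Fin n → ℤ) → Set (En n) := fun c => S ∩ G ⁻¹' {c} with hQdef
  have hQ' : ∀ c, ∃ q z, S ∩ G ⁻¹' {c} = ∅ ∨ (S ∩ G ⁻¹' {c} = dyCube q z ∧
      ENNReal.ofReal s * volume (dyCube q z) ≤ ∫⁻ y in dyCube q z, ‖f y‖ₑ) := by
    intro c
    rcases hQ c with h | ⟨q, z, h⟩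
    · exact ⟨0, 0, Or.inl h⟩
    · exact ⟨q, z, Or.inr h⟩
  choose q z hqz using hQ'
  set b : En n → ℂ := fun x => f x - g x with hb
  have hbn : NiceFun b := hf.sub hg
  set F : Set (En n) := ⋃ c, ⋃ _ : S ∩ G ⁻¹' {c} = dyCube (q c) (z c), dyStar (q c) (z c) with hF
  have hFv : volume F ≤ ENNReal.ofReal (3 ^ n / s) * ∫⁻ x, ‖f x‖ₑ := by
    calc volume F ≤ ∑' c, ENNReal.ofReal (3 ^ n / s) * ∫⁻ y in Q c, ‖f y‖ₑ := by
          refine (measure_iUnion_le _).trans (ENNReal.tsum_le_tsum fun c => ?_)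
          by_cases h : S ∩ G ⁻¹' {c} = dyCube (q c) (z c)
          · simp only [h, iUnion_true]
            rcases hqz c with h' | ⟨-, h2⟩
            · exfalso
              rw [h'] at h
              have := mem_dyCube_self (q c) (z c)
              rw [← h] at this
              exact this
            rw [volume_dyStar, show Q c = dyCube (q c) (z c) from h]
            calc (3 : ℝ≥0∞) ^ n * volume (dyCube (q c) (z c))
                = ENNReal.ofReal (3 ^ n / s) *
                    (ENNReal.ofReal s * volume (dyCube (q c) (z c))) := by
                  rw [← mul_assoc, ← ENNReal.ofReal_mul (by positivity),
                    div_mul_cancel₀ _ hs0.ne', ENNReal.ofReal_pow (by norm_num)]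
                  norm_num
              _ ≤ _ := by gcongr
          · simp [h]
      _ = ENNReal.ofReal (3 ^ n / s) * ∫⁻ y in S, ‖f y‖ₑ := by
          rw [ENNReal.tsum_mul_left, lintegral_eq_tsum_fibre hS hG]
      _ ≤ _ := by
          gcongr
          exact Measure.restrict_le_self
  have hfar := lintegral_vOp_atoms_le hu hH hbn hS hG (fun x hx => by simp [hb, hgS x hx]) q z
    (fun c => (hqz c).imp id And.left) hmean (F := F) (fun c hc => by
      intro x hx
      exact mem_iUnion.2 ⟨c, mem_iUnion.2 ⟨hc, hx⟩⟩)
  have hb1 : ∫⁻ x, ‖b x‖ₑ ≤ ENNReal.ofReal 2 * ∫⁻ x, ‖f x‖ₑ := by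
    calc ∫⁻ x, ‖b x‖ₑ ≤ ∫⁻ x, (‖f x‖ₑ + ‖g x‖ₑ) := lintegral_mono fun x => enorm_sub_le
      _ = (∫⁻ x, ‖f x‖ₑ) + ∫⁻ x, ‖g x‖ₑ := lintegral_add_left hf.meas.enorm _
      _ ≤ _ := by rw [ENNReal.ofReal_ofNat, two_mul]; gcongr
  have hg2 : ∫⁻ x, ‖g x‖ₑ ^ (2 : ℝ) ≤ ENNReal.ofReal (2 ^ n * s) * ∫⁻ x, ‖f x‖ₑ := by
    calc ∫⁻ x, ‖g x‖ₑ ^ (2 : ℝ) ≤ ∫⁻ x, ENNReal.ofReal (2 ^ n * s) * ‖g x‖ₑ := by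
          refine lintegral_mono_ae (hgb.mono fun x hx => ?_)
          rw [ENNReal.rpow_two, sq]
          gcongr
      _ = ENNReal.ofReal (2 ^ n * s) * ∫⁻ x, ‖g x‖ₑ := lintegral_const_mul _ hg.meas.enorm
      _ ≤ _ := by gcongr
  have hsub : {x | t < ‖vOp u f x‖} ⊆
      ({x | ENNReal.ofReal ((t / 2) ^ 2) ≤ ‖vOp u g x‖ₑ ^ (2 : ℝ)} ∪ F) ∪
        {x | ENNReal.ofReal (t / 2) ≤ (Fᶜ).indicator (fun x => ‖vOp u b x‖ₑ) x} := by
    intro x hx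
    by_contra hcon
    simp only [mem_union, not_or, mem_ofPred_eq, not_le] at hcon
    obtain ⟨⟨h1, h2⟩, h3⟩ := hcon
    rw [indicator_of_mem (by exact h2), ← ofReal_norm,
      ENNReal.ofReal_lt_ofReal_iff (by positivity)] at h3
    rw [ENNReal.rpow_two, ← ofReal_norm, ← ENNReal.ofReal_pow (norm_nonneg _),
      ENNReal.ofReal_lt_ofReal_iff (by positivity)] at h1
    have h4 : ‖vOp u g x‖ < t / 2 := lt_of_pow_lt_pow_left₀ 2 (by positivity) h1
    have h5 : vOp u f x = vOp u g x + vOp u b x := by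
      rw [← vOp_add hu hg hbn]
      congr 1
      funext y
      simp [hb]
    have h6 : t < ‖vOp u f x‖ := hx
    rw [h5] at h6
    linarith [norm_add_le (vOp u g x) (vOp u b x)]
  have c1 : volume {x | ENNReal.ofReal ((t / 2) ^ 2) ≤ ‖vOp u g x‖ₑ ^ (2 : ℝ)} ≤
      ENNReal.ofReal (4 * 2 ^ n * W / t) * ∫⁻ x, ‖f x‖ₑ := by
    have h0 : ENNReal.ofReal ((t / 2) ^ 2) ≠ 0 := by
      rw [Ne, ENNReal.ofReal_eq_zero, not_le]; positivity
    refine (meas_ge_le_lintegral_div ((measurable_vOp hu hg).enorm.pow_const _).aemeasurable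
      h0 ENNReal.ofReal_ne_top).trans ?_
    rw [ENNReal.div_le_iff h0 ENNReal.ofReal_ne_top]
    refine ((hL2 g hg).trans (mul_le_mul_right hg2 _)).trans (le_of_eq ?_)
    rw [← mul_assoc, ← ENNReal.ofReal_mul (by positivity), mul_right_comm,
      ← ENNReal.ofReal_mul (by positivity)]
    congr 2
    rw [hs]
    field_simp
    ring
  have c3 : volume {x | ENNReal.ofReal (t / 2) ≤ (Fᶜ).indicator (fun x => ‖vOp u b x‖ₑ) x} ≤
      ENNReal.ofReal (4 * W / t) * ∫⁻ x, ‖f x‖ₑ := by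
    have h0 : ENNReal.ofReal (t / 2) ≠ 0 := by
      rw [Ne, ENNReal.ofReal_eq_zero, not_le]; positivity
    have hFm : MeasurableSet F := MeasurableSet.iUnion fun c => MeasurableSet.iUnion fun _ =>
      measurableSet_dyStar _ _
    refine (meas_ge_le_lintegral_div
      (((measurable_vOp hu hbn).enorm).indicator hFm.compl).aemeasurable
      h0 ENNReal.ofReal_ne_top).trans ?_
    rw [ENNReal.div_le_iff h0 ENNReal.ofReal_ne_top, lintegral_indicator hFm.compl]
    refine (hfar.trans (mul_le_mul_right hb1 _)).trans (le_of_eq ?_)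
    rw [← mul_assoc,
      ← ENNReal.ofReal_mul (by positivity), mul_right_comm, ← ENNReal.ofReal_mul (by positivity)]
    congr 2
    field_simp
    ring
  refine (measure_mono hsub).trans ((measure_union_le _ _).trans
    ((add_le_add ((measure_union_le _ _).trans (add_le_add c1 hFv)) c3).trans (le_of_eq ?_)))
  rw [← add_mul, ← add_mul, ← ENNReal.ofReal_add (by positivity) (by positivity),
    ← ENNReal.ofReal_add (by positivity) (by positivity)]
  congr 2
  rw [hs]
  field_simp

end WeakType

section Marcinkiewicz

variable {n : ℕ}

lemma lintegral_rpow_Ioc {a r : ℝ} (ha : -1 < a) (hr : 0 ≤ r) :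
    ∫⁻ t in Ioc 0 r, ENNReal.ofReal (t ^ a) = ENNReal.ofReal (r ^ (a + 1) / (a + 1)) := by
  rw [← ofReal_integral_eq_lintegral_ofReal]
  · rw [← intervalIntegral.integral_of_le hr, integral_rpow (Or.inl ha),
      Real.zero_rpow (by linarith), sub_zero]
  · exact (intervalIntegral.intervalIntegrable_rpow' ha).1
  · exact (ae_restrict_mem measurableSet_Ioc).mono fun t ht => Real.rpow_nonneg ht.1.le _

lemma lintegral_rpow_Ici {a r : ℝ} (ha : a < -1) (hr : 0 < r) :
    ∫⁻ t in Ici r, ENNReal.ofReal (t ^ a) = ENNReal.ofReal (r ^ (a + 1) / (-(a + 1))) := by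
  rw [← setLIntegral_congr Ioi_ae_eq_Ici, ← ofReal_integral_eq_lintegral_ofReal]
  · rw [integral_Ioi_rpow_of_lt ha hr, div_neg, neg_div]
  · exact integrableOn_Ioi_rpow_of_lt ha hr
  · exact (ae_restrict_mem measurableSet_Ioi).mono fun t ht =>
      Real.rpow_nonneg (hr.trans ht).le _

variable {ι : Type*} [Fintype ι] {u : ι → En n → En n → ℂ}

/-- The splitting used in the interpolation argument. -/
lemma measure_vOp_le_split (hn : 1 ≤ n) (hu : ∀ i, NiceKer (u i)) {W B : ℝ} (hB : 0 < B)
    (hBW : B ≤ W)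
    (hL2 : ∀ f, NiceFun f →
      ∫⁻ x, ‖vOp u f x‖ₑ ^ (2 : ℝ) ≤ ENNReal.ofReal (B ^ 2) * ∫⁻ x, ‖f x‖ₑ ^ (2 : ℝ))
    (hH : ∀ q (y y' : En n), dyGen q y = dyGen q y' →
      ∫⁻ x in (dyStar q y)ᶜ, ∑ i, ‖u i x y - u i x y'‖ₑ ≤ ENNReal.ofReal W)
    {f : En n → ℂ} (hf : NiceFun f) {t : ℝ} (ht : 0 < t) {D : Set (En n)} (hD : MeasurableSet D) :
    volume {x | t < ‖vOp u f x‖} ≤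
      ENNReal.ofReal (2 * (4 * 2 ^ n + 3 ^ n + 4) * W / t) * (∫⁻ x in D, ‖f x‖ₑ) +
      ENNReal.ofReal (4 * B ^ 2 / t ^ 2) * ∫⁻ x in Dᶜ, ‖f x‖ₑ ^ (2 : ℝ) := by
  have hW : 0 < W := hB.trans_le hBW
  have h1 := weak_type_vOp hn hu hW (fun f hf => (hL2 f hf).trans (by gcongr)) hH
    (hf.indicator hD) (half_pos ht)
  have h2 := hL2 _ (hf.indicator hD.compl)
  have e1 : ∫⁻ x, ‖D.indicator f x‖ₑ = ∫⁻ x in D, ‖f x‖ₑ := by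
    rw [← lintegral_indicator hD]
    exact lintegral_congr fun x => enorm_indicator_eq_indicator_enorm _ _
  have e2 : ∫⁻ x, ‖(Dᶜ).indicator f x‖ₑ ^ (2 : ℝ) = ∫⁻ x in Dᶜ, ‖f x‖ₑ ^ (2 : ℝ) := by
    rw [← lintegral_indicator hD.compl]
    refine lintegral_congr fun x => ?_
    by_cases hx : x ∈ Dᶜ
    · simp only [indicator_of_mem hx]
    · simp [indicator_of_notMem hx]
  rw [e1] at h1
  rw [e2] at h2
  have hsub : {x | t < ‖vOp u f x‖} ⊆ {x | t / 2 < ‖vOp u (D.indicator f) x‖} ∪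
      {x | ENNReal.ofReal ((t / 2) ^ 2) ≤ ‖vOp u ((Dᶜ).indicator f) x‖ₑ ^ (2 : ℝ)} := by
    intro x hx
    by_contra hcon
    simp only [mem_union, not_or, mem_ofPred_eq, not_le, not_lt] at hcon
    obtain ⟨h1, h3⟩ := hcon
    rw [ENNReal.rpow_two, ← ofReal_norm, ← ENNReal.ofReal_pow (norm_nonneg _),
      ENNReal.ofReal_lt_ofReal_iff (by positivity)] at h3
    have h4 := lt_of_pow_lt_pow_left₀ 2 (by positivity) h3
    have h5 : vOp u f x = vOp u (D.indicator f) x + vOp u ((Dᶜ).indicator f) x := by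
      rw [← vOp_add hu (hf.indicator hD) (hf.indicator hD.compl)]
      congr 1
      funext y
      exact (congrFun (indicator_self_add_compl D f) y).symm
    have h6 : t < ‖vOp u f x‖ := hx
    rw [h5] at h6
    linarith [norm_add_le (vOp u (D.indicator f) x) (vOp u ((Dᶜ).indicator f) x)]
  refine (measure_mono hsub).trans ((measure_union_le _ _).trans (add_le_add ?_ ?_))
  · refine h1.trans (le_of_eq ?_)
    congr 2
    field_simp
  · have h0 : ENNReal.ofReal ((t / 2) ^ 2) ≠ 0 := by
      rw [Ne, ENNReal.ofReal_eq_zero, not_le]; positivity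
    refine (meas_ge_le_lintegral_div
      ((measurable_vOp hu (hf.indicator hD.compl)).enorm.pow_const _).aemeasurable
      h0 ENNReal.ofReal_ne_top).trans ?_
    rw [ENNReal.div_le_iff h0 ENNReal.ofReal_ne_top]
    refine h2.trans (le_of_eq ?_)
    rw [mul_right_comm, ← ENNReal.ofReal_mul (by positivity)]
    congr 2
    field_simp
    ring

theorem strong_type_vOp (hn : 1 ≤ n) (hu : ∀ i, NiceKer (u i)) {W B : ℝ} (hB : 0 < B)
    (hBW : B ≤ W)
    (hL2 : ∀ f, NiceFun f →
      ∫⁻ x, ‖vOp u f x‖ₑ ^ (2 : ℝ) ≤ ENNReal.ofReal (B ^ 2) * ∫⁻ x, ‖f x‖ₑ ^ (2 : ℝ))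
    (hH : ∀ q (y y' : En n), dyGen q y = dyGen q y' →
      ∫⁻ x in (dyStar q y)ᶜ, ∑ i, ‖u i x y - u i x y'‖ₑ ≤ ENNReal.ofReal W)
    {p : ℝ} (hp1 : 1 < p) (hp2 : p < 2) {f : En n → ℂ} (hf : NiceFun f) :
    ∫⁻ x, ‖vOp u f x‖ₑ ^ p ≤
      ENNReal.ofReal (p * (2 * (4 * 2 ^ n + 3 ^ n + 4) / (p - 1) + 4 / (2 - p)) *
        (W ^ (2 - p) * B ^ (2 * p - 2))) * ∫⁻ x, ‖f x‖ₑ ^ p := by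
  have hW : 0 < W := hB.trans_le hBW
  set K : ℝ := 2 * (4 * 2 ^ n + 3 ^ n + 4) with hK
  have hK0 : 0 < K := by positivity
  set c : ℝ := W / B ^ 2 with hc
  have hc0 : 0 < c := by positivity
  set D : Set (ℝ × En n) := {z | c * z.1 < ‖f z.2‖} with hD
  have hDm : MeasurableSet D :=
    measurableSet_lt (measurable_const.mul measurable_fst) (hf.meas.comp measurable_snd).norm
  set F₁ : ℝ × En n → ℝ≥0∞ :=
    D.indicator fun z => ENNReal.ofReal (z.1 ^ (p - 2)) * ‖f z.2‖ₑ with hF₁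
  set F₂ : ℝ × En n → ℝ≥0∞ :=
    (Dᶜ).indicator fun z => ENNReal.ofReal (z.1 ^ (p - 3)) * ‖f z.2‖ₑ ^ (2 : ℝ) with hF₂
  have hF₁m : Measurable F₁ := Measurable.indicator
    ((measurable_fst.pow_const _).ennreal_ofReal.mul (hf.meas.comp measurable_snd).enorm) hDm
  have hF₂m : Measurable F₂ := Measurable.indicator
    ((measurable_fst.pow_const _).ennreal_ofReal.mul
      ((hf.meas.comp measurable_snd).enorm.pow_const _)) hDm.compl
  have step : ∀ t ∈ Ioi (0 : ℝ), volume {x | t < ‖vOp u f x‖} * ENNReal.ofReal (t ^ (p - 1)) ≤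
      ENNReal.ofReal (K * W) * (∫⁻ y, F₁ (t, y)) +
        ENNReal.ofReal (4 * B ^ 2) * ∫⁻ y, F₂ (t, y) := by
    intro t ht
    have ht : 0 < t := ht
    have hDt : MeasurableSet {y : En n | c * t < ‖f y‖} :=
      measurableSet_lt measurable_const hf.meas.norm
    have e1 : ∫⁻ y, F₁ (t, y) =
        ENNReal.ofReal (t ^ (p - 2)) * ∫⁻ y in {y : En n | c * t < ‖f y‖}, ‖f y‖ₑ := by
      rw [← lintegral_const_mul _ hf.meas.enorm, ← lintegral_indicator hDt]
      exact lintegral_congr fun y => rfl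
    have e2 : ∫⁻ y, F₂ (t, y) =
        ENNReal.ofReal (t ^ (p - 3)) *
          ∫⁻ y in {y : En n | c * t < ‖f y‖}ᶜ, ‖f y‖ₑ ^ (2 : ℝ) := by
      rw [← lintegral_const_mul _ (hf.meas.enorm.pow_const _), ← lintegral_indicator hDt.compl]
      exact lintegral_congr fun y => rfl
    refine (mul_le_mul_left (measure_vOp_le_split hn hu hB hBW hL2 hH hf ht hDt) _).trans
      (le_of_eq ?_)
    rw [e1, e2, add_mul, ← mul_assoc, ← mul_assoc, mul_right_comm, ← ENNReal.ofReal_mul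
      (by positivity), mul_right_comm (ENNReal.ofReal (4 * B ^ 2 / t ^ 2)), ← ENNReal.ofReal_mul
      (by positivity), ← ENNReal.ofReal_mul (by positivity), ← ENNReal.ofReal_mul (by positivity)]
    congr 1 <;> congr 2
    · rw [show p - 1 = p - 2 + 1 by ring, Real.rpow_add ht, Real.rpow_one, ← hK]
      field_simp
    · rw [show p - 1 = p - 3 + 2 by ring, Real.rpow_add ht, Real.rpow_two]
      field_simp
  have hG₁ : ∀ y, ∫⁻ t in Ioi (0 : ℝ), F₁ (t, y) ≤
      ENNReal.ofReal (c ^ (1 - p) / (p - 1)) * ‖f y‖ₑ ^ p := by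
    intro y
    calc ∫⁻ t in Ioi (0 : ℝ), F₁ (t, y)
        ≤ ∫⁻ t in Ioi (0 : ℝ), (Ioc 0 (‖f y‖ / c)).indicator
            (fun t => ENNReal.ofReal (t ^ (p - 2)) * ‖f y‖ₑ) t := by
          refine setLIntegral_mono' measurableSet_Ioi fun t ht => ?_
          by_cases h : (t, y) ∈ D
          · have h' : c * t < ‖f y‖ := h
            rw [hF₁, indicator_of_mem h, indicator_of_mem]
            refine ⟨ht, ?_⟩
            rw [le_div_iff₀ hc0]
            linarith
          · rw [hF₁, indicator_of_notMem h]
            exact zero_le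
      _ ≤ ∫⁻ t, (Ioc 0 (‖f y‖ / c)).indicator
            (fun t => ENNReal.ofReal (t ^ (p - 2)) * ‖f y‖ₑ) t := setLIntegral_le_lintegral _ _
      _ = ENNReal.ofReal ((‖f y‖ / c) ^ (p - 2 + 1) / (p - 2 + 1)) * ‖f y‖ₑ := by
          rw [lintegral_indicator measurableSet_Ioc, lintegral_mul_const _ (by fun_prop),
            lintegral_rpow_Ioc (by linarith) (by positivity)]
      _ = _ := by
          rcases eq_or_ne (f y) 0 with h0 | h0
          · simp [h0, ENNReal.zero_rpow_of_pos (by linarith : 0 < p)]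
          have hpos : 0 < ‖f y‖ := norm_pos_iff.2 h0
          rw [← ofReal_norm, ENNReal.ofReal_rpow_of_pos hpos, ← ENNReal.ofReal_mul
            (by have : 0 < p - 1 := by linarith
                rw [show p - 2 + 1 = p - 1 by ring]; positivity), ← ENNReal.ofReal_mul
            (by have : 0 < p - 1 := by linarith
                positivity)]
          congr 1
          rw [show p - 2 + 1 = p - 1 by ring, Real.div_rpow hpos.le hc0.le,
            show 1 - p = -(p - 1) by ring, Real.rpow_neg hc0.le]
          conv_rhs => rw [show p = p - 1 + 1 by ring, Real.rpow_add hpos, Real.rpow_one]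
          rw [show p - 1 + 1 - 1 = p - 1 by ring]
          ring
  have hG₂ : ∀ y, ∫⁻ t in Ioi (0 : ℝ), F₂ (t, y) ≤
      ENNReal.ofReal (c ^ (2 - p) / (2 - p)) * ‖f y‖ₑ ^ p := by
    intro y
    rcases eq_or_ne (f y) 0 with h0 | h0
    · have : ∀ t, F₂ (t, y) = 0 := fun t => by
        rw [hF₂, indicator_apply]
        split_ifs
        · simp [h0]
        · rfl
      simp [this]
    have hpos : 0 < ‖f y‖ := norm_pos_iff.2 h0
    calc ∫⁻ t in Ioi (0 : ℝ), F₂ (t, y)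
        ≤ ∫⁻ t in Ioi (0 : ℝ), (Ici (‖f y‖ / c)).indicator
            (fun t => ENNReal.ofReal (t ^ (p - 3)) * ‖f y‖ₑ ^ (2 : ℝ)) t := by
          refine setLIntegral_mono' measurableSet_Ioi fun t ht => ?_
          by_cases h : (t, y) ∈ Dᶜ
          · have h' : ¬ (c * t < ‖f y‖) := h
            rw [hF₂, indicator_of_mem h, indicator_of_mem]
            rw [mem_Ici, div_le_iff₀ hc0]
            linarith
          · rw [hF₂, indicator_of_notMem h]
            exact zero_le
      _ ≤ ∫⁻ t, (Ici (‖f y‖ / c)).indicator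
            (fun t => ENNReal.ofReal (t ^ (p - 3)) * ‖f y‖ₑ ^ (2 : ℝ)) t :=
          setLIntegral_le_lintegral _ _
      _ = ENNReal.ofReal ((‖f y‖ / c) ^ (p - 3 + 1) / (-(p - 3 + 1))) * ‖f y‖ₑ ^ (2 : ℝ) := by
          rw [lintegral_indicator measurableSet_Ici, lintegral_mul_const _ (by fun_prop),
            lintegral_rpow_Ici (by linarith) (by positivity)]
      _ = _ := by
          have h2 : 0 < 2 - p := by linarith
          rw [show p - 3 + 1 = -(2 - p) by ring, neg_neg, ← ofReal_norm,
            ENNReal.ofReal_rpow_of_pos hpos, ENNReal.ofReal_rpow_of_pos hpos, ← ENNReal.ofReal_mul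
            (by positivity), ← ENNReal.ofReal_mul (by positivity)]
          congr 1
          rw [Real.div_rpow hpos.le hc0.le, Real.rpow_neg hc0.le]
          have : ‖f y‖ ^ p = ‖f y‖ ^ (-(2 - p)) * ‖f y‖ ^ (2 : ℝ) := by
            rw [← Real.rpow_add hpos]; ring_nf
          rw [this]
          have := Real.rpow_pos_of_pos hc0 (2 - p)
          field_simp
  have e0 : ∫⁻ x, ‖vOp u f x‖ₑ ^ p = ∫⁻ x, ENNReal.ofReal (‖vOp u f x‖ ^ p) :=
    lintegral_congr fun x => by
      rw [← ofReal_norm, ENNReal.ofReal_rpow_of_nonneg (norm_nonneg _) (by linarith)]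
  rw [e0, lintegral_rpow_eq_lintegral_meas_lt_mul _ (Eventually.of_forall fun x => norm_nonneg _)
    (measurable_vOp hu hf).norm.aemeasurable (by linarith)]
  have swap : ∀ F : ℝ × En n → ℝ≥0∞, Measurable F →
      ∫⁻ t in Ioi (0 : ℝ), ∫⁻ y, F (t, y) = ∫⁻ y, ∫⁻ t in Ioi (0 : ℝ), F (t, y) := fun F hF =>
    lintegral_lintegral_swap (f := fun t y => F (t, y)) hF.aemeasurable
  calc ENNReal.ofReal p * ∫⁻ t in Ioi (0 : ℝ),
        volume {x | t < ‖vOp u f x‖} * ENNReal.ofReal (t ^ (p - 1))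
      ≤ ENNReal.ofReal p * ∫⁻ t in Ioi (0 : ℝ), (ENNReal.ofReal (K * W) * (∫⁻ y, F₁ (t, y)) +
        ENNReal.ofReal (4 * B ^ 2) * ∫⁻ y, F₂ (t, y)) := by
        gcongr ENNReal.ofReal p * ?_
        exact setLIntegral_mono' measurableSet_Ioi step
    _ = ENNReal.ofReal p * (ENNReal.ofReal (K * W) * (∫⁻ y, ∫⁻ t in Ioi (0 : ℝ), F₁ (t, y)) +
        ENNReal.ofReal (4 * B ^ 2) * ∫⁻ y, ∫⁻ t in Ioi (0 : ℝ), F₂ (t, y)) := by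
        rw [lintegral_add_left (hF₁m.lintegral_prod_right'.const_mul _),
          lintegral_const_mul _ hF₁m.lintegral_prod_right',
          lintegral_const_mul _ hF₂m.lintegral_prod_right', swap _ hF₁m, swap _ hF₂m]
    _ ≤ ENNReal.ofReal p * (ENNReal.ofReal (K * W) *
          (∫⁻ y, ENNReal.ofReal (c ^ (1 - p) / (p - 1)) * ‖f y‖ₑ ^ p) +
        ENNReal.ofReal (4 * B ^ 2) *
          ∫⁻ y, ENNReal.ofReal (c ^ (2 - p) / (2 - p)) * ‖f y‖ₑ ^ p) := by
        gcongr with y y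
        · exact hG₁ y
        · exact hG₂ y
    _ = _ := by
        have h1 : 0 < p - 1 := by linarith
        have h2 : 0 < 2 - p := by linarith
        rw [lintegral_const_mul _ (hf.meas.enorm.pow_const _),
          lintegral_const_mul _ (hf.meas.enorm.pow_const _), ← mul_assoc (ENNReal.ofReal (K * W)),
          ← mul_assoc (ENNReal.ofReal (4 * B ^ 2)), ← add_mul, ← mul_assoc,
          ← ENNReal.ofReal_mul (by positivity), ← ENNReal.ofReal_mul (by positivity),
          ← ENNReal.ofReal_add (by positivity) (by positivity),
          ← ENNReal.ofReal_mul (by positivity)]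
        congr 2
        have e1 : c ^ (1 - p) * W = W ^ (2 - p) * B ^ (2 * p - 2) := by
          rw [hc, Real.div_rpow hW.le (by positivity), ← Real.rpow_natCast B 2,
            ← Real.rpow_mul hB.le, show (2 : ℝ) - p = (1 - p) + 1 by ring, Real.rpow_add hW,
            Real.rpow_one, div_eq_mul_inv, ← Real.rpow_neg hB.le]
          push_cast
          ring_nf
        have e2 : c ^ (2 - p) * B ^ 2 = W ^ (2 - p) * B ^ (2 * p - 2) := by
          rw [hc, Real.div_rpow hW.le (by positivity), ← Real.rpow_natCast B 2,
            ← Real.rpow_mul hB.le, div_eq_mul_inv, ← Real.rpow_neg hB.le, mul_assoc,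
            ← Real.rpow_add hB]
          push_cast
          ring_nf
        linear_combination (p * K / (p - 1)) * e1 + (4 * p / (2 - p)) * e2

end Marcinkiewicz

section Master

variable {n : ℕ}

/-- Averaging over signs recovers the square function. -/
lemma sum_powerset_norm_sq {ι : Type*} [DecidableEq ι] (s : Finset ι) (a : ι → ℂ) :
    ∑ T ∈ s.powerset, ‖∑ i ∈ s, (if i ∈ T then 1 else -1) * a i‖ ^ 2 =
      2 ^ s.card * ∑ i ∈ s, ‖a i‖ ^ 2 := by
  induction s using Finset.induction_on with
  | empty => simp
  | insert j s hj ih =>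
    rw [Finset.sum_powerset_insert hj, ← Finset.sum_add_distrib, Finset.card_insert_of_notMem hj,
      Finset.sum_insert hj]
    have key : ∀ T ∈ s.powerset,
        ‖∑ i ∈ insert j s, (if i ∈ T then (1 : ℂ) else -1) * a i‖ ^ 2 +
          ‖∑ i ∈ insert j s, (if i ∈ insert j T then (1 : ℂ) else -1) * a i‖ ^ 2 =
        2 * ‖∑ i ∈ s, (if i ∈ T then (1 : ℂ) else -1) * a i‖ ^ 2 + 2 * ‖a j‖ ^ 2 := by
      intro T hT
      have hjT : j ∉ T := fun h => hj (Finset.mem_powerset.1 hT h)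
      rw [Finset.sum_insert hj, Finset.sum_insert hj, if_neg hjT,
        if_pos (Finset.mem_insert_self _ _)]
      have : ∑ i ∈ s, (if i ∈ insert j T then (1 : ℂ) else -1) * a i =
          ∑ i ∈ s, (if i ∈ T then (1 : ℂ) else -1) * a i := by
        refine Finset.sum_congr rfl fun i hi => ?_
        have : i ≠ j := fun h => hj (h ▸ hi)
        simp [this]
      rw [this]
      have h := parallelogram_law_with_norm ℝ
        (∑ i ∈ s, (if i ∈ T then (1 : ℂ) else -1) * a i) (a j)
      have e1 : -1 * a j + ∑ i ∈ s, (if i ∈ T then (1 : ℂ) else -1) * a i =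
        ∑ i ∈ s, (if i ∈ T then (1 : ℂ) else -1) * a i - a j := by ring
      have e2 : 1 * a j + ∑ i ∈ s, (if i ∈ T then (1 : ℂ) else -1) * a i =
        ∑ i ∈ s, (if i ∈ T then (1 : ℂ) else -1) * a i + a j := by ring
      rw [e1, e2]
      linarith
    rw [Finset.sum_congr rfl key, Finset.sum_add_distrib, ← Finset.mul_sum, ih, Finset.sum_const,
      Finset.card_powerset, nsmul_eq_mul]
    push_cast
    ring

variable {ι : Type} [Fintype ι] [DecidableEq ι] {u : ι → En n → En n → ℂ}

/-- The scalar operator obtained from `u` with coefficients `c`. -/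
def sgnKer (u : ι → En n → En n → ℂ) (c : ι → ℂ) (x y : En n) : ℂ := ∑ i, c i * u i x y

lemma niceKer_sgnKer (hu : ∀ i, NiceKer (u i)) (c : ι → ℂ) : NiceKer (sgnKer u c) :=
  NiceKer.sum fun i _ => (hu i).const_mul (c i)

lemma kOp_sgnKer (hu : ∀ i, NiceKer (u i)) (c : ι → ℂ) {f : En n → ℂ} (hf : NiceFun f)
    (x : En n) : kOp (sgnKer u c) f x = ∑ i, c i * kOp (u i) f x := by
  unfold sgnKer
  rw [kOp_sum_left (fun i _ => (hu i).const_mul (c i)) hf]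
  exact Finset.sum_congr rfl fun i _ => kOp_mul_left (fun _ => c i) (u i) f x

/-- The sign vector attached to a set of indices. -/
def sgnVec (T : Finset ι) (i : ι) : ℂ := if i ∈ T then 1 else -1

lemma norm_sgnVec (T : Finset ι) (i : ι) : ‖sgnVec T i‖ ≤ 1 := by
  unfold sgnVec; split_ifs <;> simp

lemma norm_vOp_sq (hu : ∀ i, NiceKer (u i)) {f : En n → ℂ} (hf : NiceFun f) (x : En n) :
    2 ^ Fintype.card ι * ‖vOp u f x‖ ^ 2 =
      ∑ T : Finset ι, ‖kOp (sgnKer u (sgnVec T)) f x‖ ^ 2 := by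
  rw [EuclideanSpace.norm_sq_eq]
  have := sum_powerset_norm_sq (Finset.univ : Finset ι) (fun i => kOp (u i) f x)
  rw [Finset.powerset_univ, Finset.card_univ] at this
  simp only [vOp]
  rw [← this]
  refine Finset.sum_congr rfl fun T _ => ?_
  rw [kOp_sgnKer hu _ hf]
  rfl

lemma lintegral_vOp_rpow_le (hu : ∀ i, NiceKer (u i)) {p : ℝ} (hp : 2 ≤ p) {K : ℝ≥0∞}
    {f : En n → ℂ} (hf : NiceFun f)
    (h : ∀ T, ∫⁻ x, ‖kOp (sgnKer u (sgnVec T)) f x‖ₑ ^ p ≤ K) :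
    ∫⁻ x, ‖vOp u f x‖ₑ ^ p ≤ K := by
  set N : ℝ≥0∞ := 2 ^ Fintype.card ι with hN
  have hN0 : N ≠ 0 := by simp [hN]
  have hNt : N ≠ ∞ := by simp [hN]
  have hcard : ((Finset.univ : Finset (Finset ι)).card : ℝ≥0∞) = N := by
    simp [hN, Fintype.card_finset]
  have key : ∀ x, ‖vOp u f x‖ₑ ^ p ≤
      ∑ T : Finset ι, N⁻¹ * ‖kOp (sgnKer u (sgnVec T)) f x‖ₑ ^ p := by
    intro x
    have h1 : ‖vOp u f x‖ₑ ^ (2 : ℝ) =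
        ∑ T : Finset ι, N⁻¹ * ‖kOp (sgnKer u (sgnVec T)) f x‖ₑ ^ (2 : ℝ) := by
      have h2 := congrArg ENNReal.ofReal (norm_vOp_sq hu hf x)
      rw [ENNReal.ofReal_mul (by positivity), ENNReal.ofReal_sum_of_nonneg
        (fun _ _ => by positivity), ENNReal.ofReal_pow (by norm_num), ENNReal.ofReal_ofNat,
        ENNReal.ofReal_pow (norm_nonneg _), ofReal_norm] at h2
      rw [← Finset.mul_sum]
      have h3 : ∀ T : Finset ι, ENNReal.ofReal (‖kOp (sgnKer u (sgnVec T)) f x‖ ^ 2) =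
          ‖kOp (sgnKer u (sgnVec T)) f x‖ₑ ^ (2 : ℝ) := fun T => by
        rw [ENNReal.ofReal_pow (norm_nonneg _), ofReal_norm, ENNReal.rpow_two]
      simp only [h3] at h2
      rw [← h2, ← mul_assoc, ENNReal.inv_mul_cancel hN0 hNt, one_mul, ENNReal.rpow_two]
    have h4 : ‖vOp u f x‖ₑ ^ p = (‖vOp u f x‖ₑ ^ (2 : ℝ)) ^ (p / 2) := by
      rw [← ENNReal.rpow_mul]; congr 1; ring
    have h5 : ∀ T : Finset ι, ‖kOp (sgnKer u (sgnVec T)) f x‖ₑ ^ p =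
        (‖kOp (sgnKer u (sgnVec T)) f x‖ₑ ^ (2 : ℝ)) ^ (p / 2) := fun T => by
      rw [← ENNReal.rpow_mul]; congr 1; ring
    rw [h4, h1]
    simp only [h5]
    refine ENNReal.rpow_arith_mean_le_arith_mean_rpow _ _ _ ?_ (by linarith)
    rw [Finset.sum_const, nsmul_eq_mul, hcard, ENNReal.mul_inv_cancel hN0 hNt]
  refine (lintegral_mono key).trans ?_
  rw [lintegral_finsetSum]
  · calc ∑ T : Finset ι, ∫⁻ x, N⁻¹ * ‖kOp (sgnKer u (sgnVec T)) f x‖ₑ ^ p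
        ≤ ∑ T : Finset ι, N⁻¹ * K := by
          refine Finset.sum_le_sum fun T _ => ?_
          rw [lintegral_const_mul']
          · gcongr
            exact h T
          · simp [hN0]
      _ = K := by
          rw [Finset.sum_const, nsmul_eq_mul, hcard, ← mul_assoc, ENNReal.mul_inv_cancel hN0 hNt,
            one_mul]
  · exact fun T _ => (((niceKer_sgnKer hu _).niceFun_kOp hf).meas.enorm.pow_const _).const_mul _

lemma N2_transpose {κ : En n → En n → ℂ} (hκ : NiceKer κ) {B : ℝ} (hB : 0 ≤ B)
    (h : ∀ f, NiceFun f → N2 (kOp κ f) ≤ B * N2 f) {f : En n → ℂ} (hf : NiceFun f) :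
    N2 (kOp (fun x y => κ y x) f) ≤ B * N2 f := by
  refine N2_le_of_bilin (hκ.transpose.niceFun_kOp hf) (mul_nonneg hB (N2_nonneg f)) fun g hg => ?_
  have := hκ.transpose.integral_kOp_mul hf hg
  rw [this]
  refine (norm_integral_mul_le hf (hκ.niceFun_kOp hg)).trans ?_
  nlinarith [h g hg, N2_nonneg f]

lemma enorm_vOp_unit (κ : En n → En n → ℂ) (f : En n → ℂ) (x : En n) :
    ‖vOp (fun _ : Unit => κ) f x‖ₑ = ‖kOp κ f x‖ₑ := by
  rw [← ofReal_norm, ← ofReal_norm, EuclideanSpace.norm_eq]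
  simp [vOp]

/-- The constant in the interpolation theorem. -/
def strongConst (n : ℕ) (p : ℝ) : ℝ :=
  p * (2 * (4 * 2 ^ n + 3 ^ n + 4) / (p - 1) + 4 / (2 - p))

lemma strongConst_pos (n : ℕ) {p : ℝ} (hp1 : 1 < p) (hp2 : p < 2) : 0 < strongConst n p := by
  have h1 : 0 < p - 1 := by linarith
  have h2 : 0 < 2 - p := by linarith
  unfold strongConst
  positivity

/-- Duality: `L^p` bounds for `p > 2` from the dual exponent. -/
lemma lintegral_kOp_rpow_le_of_dual {κ : En n → En n → ℂ} (hκ : NiceKer κ) {p q : ℝ}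
    (hp : 2 < p) (hpq : p.HolderConjugate q) {K : ℝ≥0∞}
    (h : ∀ g, NiceFun g → ∫⁻ x, ‖kOp (fun x y => κ y x) g x‖ₑ ^ q ≤ K ^ q * ∫⁻ x, ‖g x‖ₑ ^ q)
    {f : En n → ℂ} (hf : NiceFun f) :
    ∫⁻ x, ‖kOp κ f x‖ₑ ^ p ≤ K ^ p * ∫⁻ x, ‖f x‖ₑ ^ p := by
  have hh := hκ.niceFun_kOp hf
  set w := kOp κ f with hw
  set g : En n → ℂ := fun x => ((‖w x‖ ^ (p - 2) : ℝ) : ℂ) * (starRingEnd ℂ) (w x) with hg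
  have hq0 : 0 < q := hpq.symm.pos
  have hgn : NiceFun g := by
    obtain ⟨C, hC⟩ := hh.bdd
    refine hh.conj.mul_bdd (C := C ^ (p - 2))
      (Complex.measurable_ofReal.comp (hh.meas.norm.pow_const _)) fun x => ?_
    rw [← ofReal_norm, Complex.norm_real, Real.norm_of_nonneg (by positivity),
      ← ENNReal.ofReal_rpow_of_nonneg (norm_nonneg _) (by linarith), ofReal_norm,
      ENNReal.coe_rpow_of_nonneg _ (by linarith)]
    exact ENNReal.rpow_le_rpow (hC x) (by linarith)
  have e1 : ∀ x, ‖g x‖ₑ ^ q = ‖w x‖ₑ ^ p := by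
    intro x
    have : ‖g x‖ₑ = ‖w x‖ₑ ^ (p - 1) := by
      rw [hg]
      simp only
      rw [enorm_mul, ← ofReal_norm, Complex.norm_real, Real.norm_of_nonneg (by positivity),
        ← ENNReal.ofReal_rpow_of_nonneg (norm_nonneg _) (by linarith), ofReal_norm,
        show ‖(starRingEnd ℂ) (w x)‖ₑ = ‖w x‖ₑ ^ (1 : ℝ) by simp [enorm_eq_nnnorm],
        ← ENNReal.rpow_add_of_nonneg _ _ (by linarith) (by norm_num)]
      congr 1; ring
    rw [this, ← ENNReal.rpow_mul, hpq.sub_one_mul_conj]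
  have e2 : ∀ x, w x * g x = ((‖w x‖ ^ p : ℝ) : ℂ) := by
    intro x
    rw [hg]
    simp only
    rw [mul_left_comm, Complex.mul_conj, Complex.normSq_eq_norm_sq, ← Complex.ofReal_mul]
    congr 1
    rcases eq_or_ne (w x) 0 with h0 | h0
    · rw [h0, norm_zero, Real.zero_rpow (by linarith), Real.zero_rpow (by linarith)]; simp
    · rw [← Real.rpow_natCast, ← Real.rpow_add (norm_pos_iff.2 h0)]
      congr 1; push_cast; ring
  set X := ∫⁻ x, ‖w x‖ₑ ^ p with hX
  set F := ∫⁻ x, ‖f x‖ₑ ^ p with hF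
  have hXt : X ≠ ∞ := (hh.lintegral_rpow_lt_top (by linarith)).ne
  have e3 : X = ‖∫ x, w x * g x‖ₑ := by
    simp only [e2]
    rw [integral_complex_ofReal, ← ofReal_norm, Complex.norm_real,
      Real.norm_of_nonneg (integral_nonneg fun x => by positivity),
      ofReal_integral_eq_lintegral_ofReal]
    · refine lintegral_congr fun x => ?_
      rw [← ofReal_norm, ENNReal.ofReal_rpow_of_nonneg (norm_nonneg _) (by linarith)]
    · refine ⟨(hh.meas.norm.pow_const _).aestronglyMeasurable, ?_⟩
      refine lt_of_le_of_lt (le_of_eq (lintegral_congr fun x => ?_))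
        (hh.lintegral_rpow_lt_top (p := p) (by linarith))
      rw [← ofReal_norm, Real.norm_of_nonneg (by positivity), ← ofReal_norm,
        ENNReal.ofReal_rpow_of_nonneg (norm_nonneg _) (by linarith)]
    · exact Eventually.of_forall fun x => by positivity
  have e4 : X ≤ F ^ (1 / p) * (K * X ^ (1 / q)) := by
    have hgn' := hκ.transpose.niceFun_kOp hgn
    calc X = ‖∫ x, f x * kOp (fun x y => κ y x) g x‖ₑ := by
          rw [e3, hw, hκ.integral_kOp_mul hf hgn]
      _ ≤ ∫⁻ x, ‖f x‖ₑ * ‖kOp (fun x y => κ y x) g x‖ₑ := by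
          refine (enorm_integral_le_lintegral_enorm _).trans (le_of_eq ?_)
          simp only [enorm_mul]
      _ ≤ F ^ (1 / p) * (∫⁻ x, ‖kOp (fun x y => κ y x) g x‖ₑ ^ q) ^ (1 / q) :=
          ENNReal.lintegral_mul_le_Lp_mul_Lq volume hpq hf.meas.enorm.aemeasurable
            hgn'.meas.enorm.aemeasurable
      _ ≤ F ^ (1 / p) * (K ^ q * X) ^ (1 / q) := by
          gcongr
          refine (h g hgn).trans (le_of_eq ?_)
          simp only [e1, hX]
      _ = _ := by
          rw [ENNReal.mul_rpow_of_nonneg _ _ (by positivity), ← ENNReal.rpow_mul,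
            mul_one_div_cancel hq0.ne', ENNReal.rpow_one]
  rcases eq_or_ne X 0 with h0 | h0
  · rw [h0]; exact zero_le
  have hp0 : 0 < p := by linarith
  have e5 : X ^ (1 / p) ≤ K * F ^ (1 / p) := by
    have hsplit : X = X ^ (1 / p) * X ^ (1 / q) := by
      rw [← ENNReal.rpow_add _ _ h0 hXt]
      have := hpq.inv_add_inv_eq_one
      rw [one_div, one_div, this, ENNReal.rpow_one]
    have hXq0 : X ^ (1 / q) ≠ 0 := by
      rw [Ne, ENNReal.rpow_eq_zero_iff]
      rintro (⟨h, -⟩ | ⟨h, -⟩)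
      exacts [h0 h, hXt h]
    have hXqt : X ^ (1 / q) ≠ ∞ := (ENNReal.rpow_lt_top_of_nonneg (by positivity) hXt).ne
    refine (ENNReal.mul_le_mul_iff_left hXq0 hXqt).1 ?_
    rw [← hsplit]
    refine e4.trans (le_of_eq ?_)
    ring
  have e6 := ENNReal.rpow_le_rpow e5 hp0.le
  rw [ENNReal.mul_rpow_of_nonneg _ _ hp0.le, ← ENNReal.rpow_mul, ← ENNReal.rpow_mul,
    one_div_mul_cancel hp0.ne', ENNReal.rpow_one, ENNReal.rpow_one] at e6
  exact e6

lemma ofReal_interp_const {K A B p : ℝ} (hK : 0 < K) (hA : 0 < A) (hB : 0 < B) (hp : 0 < p) :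
    ENNReal.ofReal (K * (A ^ (2 - p) * B ^ (2 * p - 2))) =
      ENNReal.ofReal (K ^ (1 / p) * (A ^ (1 - (2 * p - 2) / p) * B ^ ((2 * p - 2) / p))) ^ p := by
  rw [ENNReal.ofReal_rpow_of_pos (by positivity), Real.mul_rpow (by positivity) (by positivity),
    Real.mul_rpow (by positivity) (by positivity), ← Real.rpow_mul hK.le, ← Real.rpow_mul hA.le,
    ← Real.rpow_mul hB.le, one_div_mul_cancel hp.ne', Real.rpow_one, div_mul_cancel₀ _ hp.ne',
    sub_mul, div_mul_cancel₀ _ hp.ne']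
  ring_nf

/-- `L^p` bounds for square functions of Calderón–Zygmund families, with explicit dependence on the
`L²` bound `B` and the Hörmander constant `A`. -/
theorem exists_master_bound (hn : 1 ≤ n) {p : ℝ} (hp : 1 < p) :
    ∃ C θ : ℝ, 0 < C ∧ 0 < θ ∧ θ ≤ 1 ∧ ∀ (ι : Type) [Fintype ι] [DecidableEq ι]
      (u : ι → En n → En n → ℂ) (A B : ℝ), (∀ i, NiceKer (u i)) → 0 < B → B ≤ A →
      (∀ c : ι → ℂ, (∀ i, ‖c i‖ ≤ 1) → ∀ f, NiceFun f →
        N2 (fun x => ∑ i, c i * kOp (u i) f x) ≤ B * N2 f) →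
      (∀ q (y y' : En n), dyGen q y = dyGen q y' →
        ∫⁻ x in (dyStar q y)ᶜ, ∑ i, ‖u i x y - u i x y'‖ₑ ≤ ENNReal.ofReal A) →
      (∀ q (y y' : En n), dyGen q y = dyGen q y' →
        ∫⁻ x in (dyStar q y)ᶜ, ∑ i, ‖u i y x - u i y' x‖ₑ ≤ ENNReal.ofReal A) →
      ∀ f, NiceFun f → ∫⁻ x, ‖vOp u f x‖ₑ ^ p ≤
        ENNReal.ofReal (C * (A ^ (1 - θ) * B ^ θ)) ^ p * ∫⁻ x, ‖f x‖ₑ ^ p := by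
  have scalarL2 : ∀ (ι : Type) [Fintype ι] [DecidableEq ι] (u : ι → En n → En n → ℂ) (B : ℝ),
      (∀ i, NiceKer (u i)) → (∀ c : ι → ℂ, (∀ i, ‖c i‖ ≤ 1) → ∀ f, NiceFun f →
        N2 (fun x => ∑ i, c i * kOp (u i) f x) ≤ B * N2 f) → ∀ T : Finset ι, ∀ f, NiceFun f →
        N2 (kOp (sgnKer u (sgnVec T)) f) ≤ B * N2 f := by
    intro ι _ _ u B hu h T f hf
    have := h (sgnVec T) (norm_sgnVec T) f hf
    rwa [show kOp (sgnKer u (sgnVec T)) f = fun x => ∑ i, sgnVec T i * kOp (u i) f x from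
      funext fun x => kOp_sgnKer hu _ hf x]
  have vecL2 : ∀ (ι : Type) [Fintype ι] [DecidableEq ι] (u : ι → En n → En n → ℂ) (B : ℝ),
      (∀ i, NiceKer (u i)) → (∀ c : ι → ℂ, (∀ i, ‖c i‖ ≤ 1) → ∀ f, NiceFun f →
        N2 (fun x => ∑ i, c i * kOp (u i) f x) ≤ B * N2 f) → ∀ f, NiceFun f →
        ∫⁻ x, ‖vOp u f x‖ₑ ^ (2 : ℝ) ≤ ENNReal.ofReal (B ^ 2) * ∫⁻ x, ‖f x‖ₑ ^ (2 : ℝ) := by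
    intro ι _ _ u B hu h f hf
    refine lintegral_vOp_rpow_le hu le_rfl hf fun T => ?_
    exact lintegral_le_of_N2_le ((niceKer_sgnKer hu _).niceFun_kOp hf) hf
      (scalarL2 ι u B hu h T f hf)
  rcases lt_trichotomy p 2 with h2 | rfl | h2
  · refine ⟨strongConst n p ^ (1 / p), (2 * p - 2) / p,
      Real.rpow_pos_of_pos (strongConst_pos n hp h2) _, div_pos (by linarith) (by linarith),
      (div_le_one (by linarith)).2 (by linarith), ?_⟩
    intro ι _ _ u A B hu hB hBA hL2 hH _ f hf
    refine (strong_type_vOp hn hu hB hBA (vecL2 ι u B hu hL2) hH hp h2 hf).trans (le_of_eq ?_)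
    congr 1
    exact ofReal_interp_const (strongConst_pos n hp h2) (hB.trans_le hBA) hB (by linarith)
  · refine ⟨1, 1, one_pos, one_pos, le_rfl, ?_⟩
    intro ι _ _ u A B hu hB hBA hL2 hH _ f hf
    refine (vecL2 ι u B hu hL2 f hf).trans (le_of_eq ?_)
    rw [one_mul, sub_self, Real.rpow_zero, one_mul, Real.rpow_one, ENNReal.rpow_two,
      ENNReal.ofReal_pow hB.le]
  · set q := p.conjExponent with hq
    have hpq : p.HolderConjugate q := Real.HolderConjugate.conjExponent hp
    have hq1 : 1 < q := hpq.symm.lt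
    have hq2 : q < 2 := by
      rw [hq, Real.conjExponent, div_lt_iff₀ (by linarith)]; linarith
    refine ⟨strongConst n q ^ (1 / q), (2 * q - 2) / q,
      Real.rpow_pos_of_pos (strongConst_pos n hq1 hq2) _, div_pos (by linarith) (by linarith),
      (div_le_one (by linarith)).2 (by linarith), ?_⟩
    intro ι _ _ u A B hu hB hBA hL2 _ hH f hf
    refine lintegral_vOp_rpow_le hu h2.le hf fun T => ?_
    have hκ := niceKer_sgnKer hu (sgnVec T)
    refine lintegral_kOp_rpow_le_of_dual hκ h2 hpq (fun g hg => ?_) hf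
    have hs := strong_type_vOp (u := fun _ : Unit => fun x y => sgnKer u (sgnVec T) y x) hn
      (fun _ => hκ.transpose) hB hBA (fun f hf => ?_) (fun r y y' hy => ?_) hq1 hq2 hg
    · simp only [enorm_vOp_unit] at hs
      refine hs.trans (le_of_eq ?_)
      congr 1
      exact ofReal_interp_const (strongConst_pos n hq1 hq2) (hB.trans_le hBA) hB (by linarith)
    · simp only [enorm_vOp_unit]
      exact lintegral_le_of_N2_le (hκ.transpose.niceFun_kOp hf) hf
        (N2_transpose hκ hB.le (scalarL2 ι u B hu hL2 T) hf)
    · refine (lintegral_mono fun x => ?_).trans (hH r y y' hy)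
      simp only [Finset.univ_unique, Finset.sum_singleton, sgnKer]
      rw [← Finset.sum_sub_distrib]
      refine (enorm_sum_le _ _).trans (Finset.sum_le_sum fun i _ => ?_)
      rw [← mul_sub, enorm_mul]
      refine mul_le_of_le_one_left' ?_
      rw [← ofReal_norm, ← ENNReal.ofReal_one]
      exact ENNReal.ofReal_le_ofReal (norm_sgnVec T i)

end Master

section DyadicMartingale

variable {n : ℕ}

/-- The kernel of the conditional expectation on dyadic cubes of side `2 ^ (-l)`. -/
def eKer (l : ℤ) (x y : En n) : ℂ :=
  if dyGen l x = dyGen l y then ((((2 : ℝ) ^ l) ^ n : ℝ) : ℂ) else 0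

lemma eKer_comm (l : ℤ) (x y : En n) : eKer l x y = eKer l y x := by
  simp only [eKer, eq_comm]

lemma eKer_eq_indicator (l : ℤ) (x y : En n) :
    eKer l x y = (dyCube l x).indicator (fun _ => ((((2 : ℝ) ^ l) ^ n : ℝ) : ℂ)) y := by
  by_cases h : dyGen l x = dyGen l y
  · rw [eKer, if_pos h, Set.indicator_of_mem (show y ∈ dyCube l x from h.symm)]
  · rw [eKer, if_neg h, Set.indicator_of_notMem (show y ∉ dyCube l x from fun h' => h h'.symm)]

lemma eKer_congr {l : ℤ} {x x' : En n} (h : dyGen l x = dyGen l x') (y : En n) :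
    eKer l x y = eKer l x' y := by
  simp only [eKer, h]

lemma lintegral_eKer (l : ℤ) (x : En n) : ∫⁻ y, ‖eKer l x y‖ₑ = 1 := by
  have h2 : (0 : ℝ) < 2 ^ l := by positivity
  simp only [eKer_eq_indicator, enorm_indicator_eq_indicator_enorm]
  rw [lintegral_indicator_const (measurableSet_dyCube l x), volume_dyCube,
    ← ofReal_norm, Complex.norm_real, Real.norm_of_nonneg (by positivity),
    ← ENNReal.ofReal_mul (by positivity), ← mul_pow, mul_inv_cancel₀ h2.ne']
  simp

lemma niceKer_eKer (l : ℤ) : NiceKer (eKer l : En n → En n → ℂ) := by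
  refine ⟨?_, max 1 (Real.toNNReal (((2 : ℝ) ^ l) ^ n)), fun x y => ?_, fun x => ?_, fun y => ?_⟩
  · refine Measurable.ite ?_ measurable_const measurable_const
    exact measurableSet_eq_fun ((measurable_dyGen l).comp measurable_fst)
      ((measurable_dyGen l).comp measurable_snd)
  · rw [enorm_le_coe, ← NNReal.coe_le_coe, coe_nnnorm, NNReal.coe_max, eKer,
      Real.coe_toNNReal _ (by positivity)]
    split_ifs
    · rw [Complex.norm_real, Real.norm_of_nonneg (by positivity)]
      exact le_max_right _ _
    · simp
  · rw [lintegral_eKer]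
    exact_mod_cast le_max_left _ _
  · simp only [eKer_comm l _ y]
    rw [lintegral_eKer]
    exact_mod_cast le_max_left _ _

/-- Conditional expectation on dyadic cubes of side `2 ^ (-l)`. -/
def eOp (l : ℤ) (f : En n → ℂ) : En n → ℂ := kOp (eKer l) f

lemma NiceFun.eOp {f : En n → ℂ} (hf : NiceFun f) (l : ℤ) : NiceFun (eOp l f) :=
  (niceKer_eKer l).niceFun_kOp hf

lemma eOp_congr {l : ℤ} {x x' : En n} (h : dyGen l x = dyGen l x') (f : En n → ℂ) :
    eOp l f x = eOp l f x' := by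
  simp only [eOp, kOp, eKer_congr h]

lemma integral_eKer (l : ℤ) (x : En n) : ∫ y, eKer l x y = 1 := by
  have h2 : (0 : ℝ) < 2 ^ l := by positivity
  simp only [eKer_eq_indicator]
  rw [integral_indicator_const _ (measurableSet_dyCube l x), volume_real_dyCube,
    Complex.real_smul, ← Complex.ofReal_mul, ← mul_pow, inv_mul_cancel₀ h2.ne']
  simp

lemma eOp_of_const {l : ℤ} {h : En n → ℂ} (hh : ∀ x y, dyGen l x = dyGen l y → h x = h y) :
    eOp l h = h := by
  funext x
  have : ∀ y, eKer l x y * h y = eKer l x y * h x := fun y => by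
    by_cases hxy : dyGen l x = dyGen l y
    · rw [hh x y hxy]
    · simp [eKer, hxy]
  simp only [eOp, kOp, this]
  rw [integral_mul_const, integral_eKer, one_mul]

lemma eOp_eOp_of_le {l m : ℤ} (h : m ≤ l) (f : En n → ℂ) : eOp l (eOp m f) = eOp m f :=
  eOp_of_const fun _ _ hxy => eOp_congr (dyGen_mono h hxy) f

lemma eOp_adjoint {l : ℤ} {f g : En n → ℂ} (hf : NiceFun f) (hg : NiceFun g) :
    ∫ x, eOp l f x * g x = ∫ x, f x * eOp l g x := by
  have := (niceKer_eKer l).integral_kOp_mul hf hg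
  simpa only [eOp, show (fun x y : En n => eKer l y x) = eKer l from
    funext fun x => funext fun y => eKer_comm l y x] using this

lemma eOp_eOp_of_ge {l m : ℤ} (h : l ≤ m) {f : En n → ℂ} (hf : NiceFun f) :
    eOp l (eOp m f) = eOp l f := by
  funext x
  have h1 := eOp_adjoint (l := m) hf ((niceKer_eKer l).niceFun_left x)
  have h2 : eOp m (eKer l x) = eKer l x := eOp_of_const fun y z hyz => by
    rw [eKer_comm l x y, eKer_comm l x z, eKer_congr (dyGen_mono h hyz)]
  rw [h2] at h1
  simpa only [eOp, kOp, mul_comm] using h1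

lemma eOp_sub (l : ℤ) {f g : En n → ℂ} (hf : NiceFun f) (hg : NiceFun g) :
    eOp l (fun x => f x - g x) = fun x => eOp l f x - eOp l g x :=
  funext fun x => kOp_sub_right (niceKer_eKer l) hf hg x

lemma eOp_conj (l : ℤ) (f : En n → ℂ) :
    eOp l (fun x => (starRingEnd ℂ) (f x)) = fun x => (starRingEnd ℂ) (eOp l f x) := by
  funext x
  simp only [eOp, kOp]
  rw [← integral_conj]
  refine integral_congr_ae (Eventually.of_forall fun y => ?_)
  simp only [eKer, map_mul]
  split_ifs
  · rw [Complex.conj_ofReal]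
  · simp

lemma N2_add_sq {f g : En n → ℂ} (hf : NiceFun f) (hg : NiceFun g)
    (h : ∫ x, f x * (starRingEnd ℂ) (g x) = 0) :
    N2 (fun x => f x + g x) ^ 2 = N2 f ^ 2 + N2 g ^ 2 := by
  obtain ⟨C, hC⟩ := hf.bdd
  obtain ⟨D, hD⟩ := hg.bdd
  have h' : ∫ x, g x * (starRingEnd ℂ) (f x) = 0 := by
    have := congrArg (starRingEnd ℂ) h
    rw [← integral_conj] at this
    simpa [mul_comm] using this
  have i1 : Integrable (fun x => f x * (starRingEnd ℂ) (f x)) := (hf.conj.mul_bdd hf.meas hC).int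
  have i2 : Integrable (fun x => f x * (starRingEnd ℂ) (g x)) := (hg.conj.mul_bdd hf.meas hC).int
  have i3 : Integrable (fun x => g x * (starRingEnd ℂ) (f x)) := (hf.conj.mul_bdd hg.meas hD).int
  have i4 : Integrable (fun x => g x * (starRingEnd ℂ) (g x)) := (hg.conj.mul_bdd hg.meas hD).int
  have key := integral_mul_conj_self (hf.add hg)
  have e : ∀ x, (f x + g x) * (starRingEnd ℂ) (f x + g x) =
      (f x * (starRingEnd ℂ) (f x) + f x * (starRingEnd ℂ) (g x)) +
      (g x * (starRingEnd ℂ) (f x) + g x * (starRingEnd ℂ) (g x)) := fun x => by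
    rw [map_add]; ring
  simp only [e] at key
  rw [integral_add (by exact i1.add i2) (by exact i3.add i4), integral_add i1 i2, integral_add i3 i4, h, h',
    integral_mul_conj_self hf, integral_mul_conj_self hg] at key
  have key' : ((N2 f ^ 2 + N2 g ^ 2 : ℝ) : ℂ) = ((N2 (fun x => f x + g x) ^ 2 : ℝ) : ℂ) := by
    rw [← key]; push_cast; ring
  exact_mod_cast key'.symm

/-- The truncated dyadic martingale: `0`, then conditional expectations, then `f` itself. -/
def mX (M : ℕ) (r : ℕ) (f : En n → ℂ) : En n → ℂ :=
  if r = 0 then fun _ => 0 else if 2 * M < r then f else eOp ((r : ℤ) - M) f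

/-- Differences of the truncated dyadic martingale. -/
def mP (M : ℕ) (r : ℕ) (f : En n → ℂ) (x : En n) : ℂ := mX M (r + 1) f x - mX M r f x

lemma NiceFun.mX {f : En n → ℂ} (hf : NiceFun f) (M r : ℕ) : NiceFun (mX M r f) := by
  unfold _root_.mX
  split_ifs
  exacts [NiceFun.zero, hf, hf.eOp _]

lemma NiceFun.mP {f : En n → ℂ} (hf : NiceFun f) (M r : ℕ) : NiceFun (mP M r f) :=
  (hf.mX M (r + 1)).sub (hf.mX M r)

lemma sum_mP (M : ℕ) (f : En n → ℂ) (x : En n) :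
    ∑ r ∈ Finset.range (2 * M + 1), mP M r f x = f x := by
  simp only [mP]
  rw [Finset.sum_range_sub (fun r => mX M r f x)]
  simp [mX]

lemma eOp_zero (l : ℤ) : eOp l (fun _ : En n => (0 : ℂ)) = fun _ => 0 :=
  eOp_of_const fun _ _ _ => rfl

lemma eOp_mX_of_le {M r : ℕ} {k : ℤ} (hr : (r : ℤ) - M ≤ k) (hk : k ≤ M) (f : En n → ℂ) :
    eOp k (mX M r f) = mX M r f := by
  unfold mX
  split_ifs with h1 h2
  · exact eOp_zero k
  · omega
  · exact eOp_eOp_of_le hr f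

lemma eOp_mX_of_ge {M r : ℕ} {k : ℤ} (hr : k ≤ (r : ℤ) - M) (hk : -(M : ℤ) < k) {f : En n → ℂ}
    (hf : NiceFun f) : eOp k (mX M r f) = eOp k f := by
  unfold mX
  split_ifs with h1 h2
  · omega
  · rfl
  · exact eOp_eOp_of_ge hr hf

lemma eOp_mP_of_lt {M r : ℕ} {k : ℤ} (hr : (r : ℤ) - M < k) (hk : k ≤ M) {f : En n → ℂ}
    (hf : NiceFun f) : eOp k (mP M r f) = mP M r f := by
  unfold mP
  rw [eOp_sub k (hf.mX M (r + 1)) (hf.mX M r), eOp_mX_of_le (by push_cast; omega) hk,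
    eOp_mX_of_le (by omega) hk]

lemma eOp_mP_of_ge {M r : ℕ} {k : ℤ} (hr : k ≤ (r : ℤ) - M) (hk : -(M : ℤ) < k) {f : En n → ℂ}
    (hf : NiceFun f) : eOp k (mP M r f) = fun _ => 0 := by
  unfold mP
  rw [eOp_sub k (hf.mX M (r + 1)) (hf.mX M r), eOp_mX_of_ge (by push_cast; omega) hk hf,
    eOp_mX_of_ge hr hk hf]
  simp

lemma integral_mX_mul_conj_mP (M r : ℕ) (hr : r ≤ 2 * M) {f : En n → ℂ} (hf : NiceFun f) :
    ∫ x, mX M r f x * (starRingEnd ℂ) (mP M r f x) = 0 := by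
  rcases Nat.eq_zero_or_pos r with rfl | h0
  · simp [mX]
  have h1 : mX M r f = eOp ((r : ℤ) - M) f := by
    rw [mX, if_neg (by omega), if_neg (by omega)]
  rw [h1, eOp_adjoint hf (hf.mP M r).conj, eOp_conj, eOp_mP_of_ge le_rfl (by omega) hf]
  simp

lemma N2_mX_sq (M r : ℕ) (hr : r ≤ 2 * M + 1) {f : En n → ℂ} (hf : NiceFun f) :
    N2 (mX M r f) ^ 2 = ∑ i ∈ Finset.range r, N2 (mP M i f) ^ 2 := by
  induction r with
  | zero => simp [mX, N2]
  | succ r ih =>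
    rw [Finset.sum_range_succ, ← ih (by omega),
      ← N2_add_sq (hf.mX M r) (hf.mP M r) (integral_mX_mul_conj_mP M r (by omega) hf)]
    congr 2
    funext x
    simp [mP]

lemma sum_N2_mP_sq (M : ℕ) {f : En n → ℂ} (hf : NiceFun f) :
    ∑ i ∈ Finset.range (2 * M + 1), N2 (mP M i f) ^ 2 = N2 f ^ 2 := by
  rw [← N2_mX_sq M _ le_rfl hf]
  simp [mX]

end DyadicMartingale

section BilinearSummation

variable {n : ℕ}

/-- The decay factor `2 ^ (-|d| / 2)`. -/
def dec (d : ℤ) : ℝ := (2 : ℝ) ^ (-((d.natAbs : ℝ) / 2))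

lemma dec_pos (d : ℤ) : 0 < dec d := Real.rpow_pos_of_pos two_pos _

lemma summable_dec_rpow : Summable fun d : ℤ => dec d ^ (1 / 12 : ℝ) := by
  have h : ∀ d : ℤ, dec d ^ (1 / 12 : ℝ) = ((2 : ℝ) ^ (-(1 / 24) : ℝ)) ^ d.natAbs := fun d => by
    rw [dec, ← Real.rpow_natCast, ← Real.rpow_mul two_pos.le, ← Real.rpow_mul two_pos.le]
    congr 1
    ring
  have hs : Summable fun k : ℕ => ((2 : ℝ) ^ (-(1 / 24) : ℝ)) ^ k :=
    summable_geometric_of_lt_one (by positivity)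
      (Real.rpow_lt_one_of_one_lt_of_neg one_lt_two (by norm_num))
  simp only [h]
  refine Summable.of_nat_of_neg ?_ ?_ <;> simpa using hs

lemma sum_dec_rpow_le {ι : Type*} (s : Finset ι) {τ : ι → ℤ} (hτ : Set.InjOn τ s) :
    ∑ i ∈ s, dec (τ i) ^ (1 / 12 : ℝ) ≤ ∑' d : ℤ, dec d ^ (1 / 12 : ℝ) := by
  classical
  rw [← Finset.sum_image (f := fun d => dec d ^ (1 / 12 : ℝ)) hτ]
  exact summable_dec_rpow.sum_le_tsum _ fun d _ => Real.rpow_nonneg (dec_pos d).le _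

lemma sum_sq_sum_mul_le {ι κ : Type*} (s : Finset ι) (t : Finset κ) {w : ι → κ → ℝ} {x : κ → ℝ}
    {K : ℝ} (hw : ∀ i r, 0 ≤ w i r) (h1 : ∀ i ∈ s, ∑ r ∈ t, w i r ≤ K)
    (h2 : ∀ r ∈ t, ∑ i ∈ s, w i r ≤ K) (hK : 0 ≤ K) :
    ∑ i ∈ s, (∑ r ∈ t, w i r * x r) ^ 2 ≤ K ^ 2 * ∑ r ∈ t, x r ^ 2 := by
  calc ∑ i ∈ s, (∑ r ∈ t, w i r * x r) ^ 2
      ≤ ∑ i ∈ s, K * ∑ r ∈ t, w i r * x r ^ 2 := by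
        refine Finset.sum_le_sum fun i hi => ?_
        refine (Finset.sum_sq_le_sum_mul_sum_of_sq_eq_mul t (f := fun r => w i r)
          (g := fun r => w i r * x r ^ 2) (fun r _ => hw i r)
          (fun r _ => mul_nonneg (hw i r) (sq_nonneg _)) fun r _ => by ring).trans ?_
        exact mul_le_mul_of_nonneg_right (h1 i hi)
          (Finset.sum_nonneg fun r _ => mul_nonneg (hw i r) (sq_nonneg _))
    _ = K * ∑ r ∈ t, (∑ i ∈ s, w i r) * x r ^ 2 := by
        rw [← Finset.mul_sum, Finset.sum_comm]
        simp only [Finset.sum_mul]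
    _ ≤ K * ∑ r ∈ t, K * x r ^ 2 := by
        refine mul_le_mul_of_nonneg_left (Finset.sum_le_sum fun r hr => ?_) hK
        exact mul_le_mul_of_nonneg_right (h2 r hr) (sq_nonneg _)
    _ = K ^ 2 * ∑ r ∈ t, x r ^ 2 := by
        rw [← Finset.mul_sum]; ring

lemma le_geom_mean {t a b c N : ℝ} (ht : 0 ≤ t) (ha : 0 ≤ a) (hb : 0 ≤ b) (hc : 0 ≤ c)
    (hN : 0 ≤ N) (h1 : t ≤ a * N) (h2 : t ≤ b * N) (h3 : t ≤ c * N) :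
    t ≤ a ^ (5 / 6 : ℝ) * b ^ (1 / 12 : ℝ) * c ^ (1 / 12 : ℝ) * N := by
  have hm : t ≤ min a (min b c) * N := by
    rcases min_choice a (min b c) with h | h <;> rw [h]
    · exact h1
    · rcases min_choice b c with h | h <;> rw [h] <;> assumption
  refine hm.trans (mul_le_mul_of_nonneg_right ?_ hN)
  set m := min a (min b c)
  have hm0 : 0 ≤ m := le_min ha (le_min hb hc)
  calc m = m ^ (5 / 6 : ℝ) * m ^ (1 / 12 : ℝ) * m ^ (1 / 12 : ℝ) := by
        rw [← Real.rpow_add_of_nonneg hm0 (by norm_num) (by norm_num),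
          ← Real.rpow_add_of_nonneg hm0 (by norm_num) (by norm_num)]
        norm_num
    _ ≤ _ := by
        have e1 : m ≤ a := min_le_left _ _
        have e2 : m ≤ b := (min_le_right _ _).trans (min_le_left _ _)
        have e3 : m ≤ c := (min_le_right _ _).trans (min_le_right _ _)
        gcongr

theorem exists_bilinear_bound (n : ℕ) : ∃ C : ℝ, 0 < C ∧ ∀ (M : ℕ) (ι : Type) [Fintype ι]
    (σ : ι → ℤ) (U : ι → En n → En n → ℂ) (b₀ b : ℝ), Function.Injective σ →
    (∀ i, NiceKer (U i)) → 0 < b₀ → 0 < b →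
    (∀ i f g, NiceFun f → NiceFun g → ∀ r ≤ 2 * M, ∀ r' ≤ 2 * M,
      ‖∫ x, kOp (U i) (mP M r f) x * mP M r' g x‖ ≤
        b₀ * (N2 (mP M r f) * N2 (mP M r' g)) ∧
      ‖∫ x, kOp (U i) (mP M r f) x * mP M r' g x‖ ≤
        b * dec (σ i - (r - M)) * (N2 (mP M r f) * N2 (mP M r' g)) ∧
      ‖∫ x, kOp (U i) (mP M r f) x * mP M r' g x‖ ≤
        b * dec (σ i - (r' - M)) * (N2 (mP M r f) * N2 (mP M r' g))) →
    ∀ c : ι → ℂ, (∀ i, ‖c i‖ ≤ 1) → ∀ f, NiceFun f →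
      N2 (fun x => ∑ i, c i * kOp (U i) f x) ≤
        C * (b₀ ^ (5 / 6 : ℝ) * b ^ (1 / 6 : ℝ)) * N2 f := by
  set K : ℝ := ∑' d : ℤ, dec d ^ (1 / 12 : ℝ) with hKdef
  have hK : 0 < K := summable_dec_rpow.tsum_pos
    (fun d => Real.rpow_nonneg (dec_pos d).le _) 0 (Real.rpow_pos_of_pos (dec_pos 0) _)
  refine ⟨K ^ 2, by positivity, fun M ι _ σ U b₀ b hσ hU hb₀ hb h c hc f hf => ?_⟩
  set R := Finset.range (2 * M + 1) with hR
  have hRle : ∀ r ∈ R, r ≤ 2 * M := fun r hr => by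
    rw [hR, Finset.mem_range] at hr; omega
  set w : ι → ℕ → ℝ := fun i r => dec (σ i - (r - M)) ^ (1 / 12 : ℝ) with hw
  have hw0 : ∀ i r, 0 ≤ w i r := fun i r => Real.rpow_nonneg (dec_pos _).le _
  have hrow : ∀ i ∈ Finset.univ, ∑ r ∈ R, w i r ≤ K := fun i _ =>
    sum_dec_rpow_le R (τ := fun r : ℕ => σ i - ((r : ℤ) - M)) fun r _ r' _ hrr => by
      simp only at hrr; omega
  have hcol : ∀ r ∈ R, ∑ i, w i r ≤ K := fun r _ =>
    sum_dec_rpow_le Finset.univ (τ := fun i => σ i - ((r : ℤ) - M)) fun i _ i' _ hii => by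
      simp only at hii; exact hσ (by omega)
  have hF : NiceFun (fun x => ∑ i, c i * kOp (U i) f x) :=
    NiceFun.sum fun i _ => ((hU i).niceFun_kOp hf).const_mul (c i)
  refine N2_le_of_bilin hF (mul_nonneg (by positivity) (N2_nonneg f)) fun g hg => ?_
  obtain ⟨D, hD⟩ := hg.bdd
  set B : ℝ := b₀ ^ (5 / 6 : ℝ) * b ^ (1 / 6 : ℝ) with hB
  set X : ℕ → ℝ := fun r => N2 (mP M r f) with hX
  set Y : ℕ → ℝ := fun r => N2 (mP M r g) with hY
  have hterm : ∀ i, ∀ r ∈ R, ∀ r' ∈ R,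
      ‖∫ x, kOp (U i) (mP M r f) x * mP M r' g x‖ ≤ B * ((w i r * X r) * (w i r' * Y r')) := by
    intro i r hr r' hr'
    obtain ⟨h1, h2, h3⟩ := h i f g hf hg r (hRle r hr) r' (hRle r' hr')
    have := le_geom_mean (norm_nonneg _) hb₀.le (mul_nonneg hb.le (dec_pos _).le)
      (mul_nonneg hb.le (dec_pos _).le) (mul_nonneg (N2_nonneg _) (N2_nonneg _)) h1 h2 h3
    refine this.trans (le_of_eq ?_)
    rw [Real.mul_rpow hb.le (dec_pos _).le, Real.mul_rpow hb.le (dec_pos _).le, hB,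
      show (1 / 6 : ℝ) = 1 / 12 + 1 / 12 by norm_num, Real.rpow_add hb]
    simp only [hw, hX, hY]
    ring
  have hexp : ∀ i, ∫ x, kOp (U i) f x * g x =
      ∑ r ∈ R, ∑ r' ∈ R, ∫ x, kOp (U i) (mP M r f) x * mP M r' g x := by
    intro i
    have hintg : ∀ r r', Integrable fun x => kOp (U i) (mP M r f) x * mP M r' g x := fun r r' => by
      obtain ⟨D, hD⟩ := ((hU i).niceFun_kOp (hf.mP M r)).bdd
      exact ((hg.mP M r').mul_bdd ((hU i).niceFun_kOp (hf.mP M r)).meas hD).int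
    have e1 : ∀ x, kOp (U i) f x * g x =
        ∑ r ∈ R, ∑ r' ∈ R, kOp (U i) (mP M r f) x * mP M r' g x := fun x => by
      have : kOp (U i) f x = ∑ r ∈ R, kOp (U i) (mP M r f) x := by
        rw [← kOp_sum_right (hU i) fun r _ => hf.mP M r]
        simp only [hR, sum_mP]
      rw [this, ← sum_mP M g x, Finset.sum_mul_sum]
    simp only [e1]
    rw [integral_finsetSum _ fun r _ => integrable_finsetSum _ fun r' _ => hintg r r']
    exact Finset.sum_congr rfl fun r _ => integral_finsetSum _ fun r' _ => hintg r r'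
  have e0 : ∫ x, (∑ i, c i * kOp (U i) f x) * g x = ∑ i, c i * ∫ x, kOp (U i) f x * g x := by
    simp only [Finset.sum_mul, mul_assoc]
    rw [integral_finsetSum _ fun i _ => ?_]
    · simp only [integral_const_mul]
    · obtain ⟨D, hD⟩ := ((hU i).niceFun_kOp hf).bdd
      exact ((hg.mul_bdd ((hU i).niceFun_kOp hf).meas hD).const_mul (c i)).int
  rw [e0]
  have hX2 : ∑ r ∈ R, X r ^ 2 = N2 f ^ 2 := sum_N2_mP_sq M hf
  have hY2 : ∑ r ∈ R, Y r ^ 2 = N2 g ^ 2 := sum_N2_mP_sq M hg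
  calc ‖∑ i, c i * ∫ x, kOp (U i) f x * g x‖
      ≤ ∑ i, B * ((∑ r ∈ R, w i r * X r) * (∑ r' ∈ R, w i r' * Y r')) := by
        refine (norm_sum_le _ _).trans (Finset.sum_le_sum fun i _ => ?_)
        rw [norm_mul, hexp, Finset.sum_mul_sum, Finset.mul_sum]
        refine (mul_le_of_le_one_left (norm_nonneg _) (hc i)).trans ?_
        refine (norm_sum_le _ _).trans (Finset.sum_le_sum fun r hr => ?_)
        rw [Finset.mul_sum]
        exact (norm_sum_le _ _).trans (Finset.sum_le_sum fun r' hr' => hterm i r hr r' hr')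
    _ = B * ∑ i, (∑ r ∈ R, w i r * X r) * (∑ r' ∈ R, w i r' * Y r') := by
        rw [Finset.mul_sum]
    _ ≤ B * (√(∑ i, (∑ r ∈ R, w i r * X r) ^ 2) * √(∑ i, (∑ r' ∈ R, w i r' * Y r') ^ 2)) := by
        gcongr
        exact Real.sum_mul_le_sqrt_mul_sqrt _ _ _
    _ ≤ B * (√((K * N2 f) ^ 2) * √((K * N2 g) ^ 2)) := by
        gcongr
        · rw [mul_pow, ← hX2]
          exact sum_sq_sum_mul_le _ _ hw0 hrow hcol hK.le
        · rw [mul_pow, ← hY2]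
          exact sum_sq_sum_mul_le _ _ hw0 hrow hcol hK.le
    _ = K ^ 2 * B * N2 f * N2 g := by
        rw [Real.sqrt_sq (mul_nonneg hK.le (N2_nonneg f)),
          Real.sqrt_sq (mul_nonneg hK.le (N2_nonneg g))]
        ring

end BilinearSummation

section ConvolutionKernels

variable {n : ℕ}

lemma lintegral_enorm_le_of_local {F : En n → ℂ} {x : En n} {c r : ℝ} (hc : 0 ≤ c) (hr : 0 ≤ r)
    (h1 : ∀ y, ‖F y‖ ≤ c) (h2 : ∀ y, r < ‖x - y‖ → F y = 0) :
    ∫⁻ y, ‖F y‖ₑ ≤ ENNReal.ofReal (c * (2 * r) ^ n) := by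
  set S : Set (En n) := {y | ∀ i, y i ∈ Set.Icc (x i - r) (x i + r)} with hS
  have hle : ∀ y, ‖F y‖ₑ ≤ S.indicator (fun _ => ENNReal.ofReal c) y := fun y => by
    by_cases hy : ‖x - y‖ ≤ r
    · have : y ∈ S := fun i => by
        have := abs_le.1 ((abs_coord_le_norm (x - y) i).trans hy)
        simp only [PiLp.sub_apply] at this
        constructor <;> linarith [this.1, this.2]
      rw [Set.indicator_of_mem this, ← ofReal_norm]
      exact ENNReal.ofReal_le_ofReal (h1 y)
    · rw [h2 y (not_le.1 hy)]
      simp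
  refine (lintegral_mono hle).trans ((lintegral_indicator_const_le _ _).trans ?_)
  rw [hS, preimage_Icc_volume]
  have : ∀ i, x i + r - (x i - r) = 2 * r := fun i => by ring
  simp only [this, Finset.prod_const, Finset.card_univ, Fintype.card_fin]
  rw [← ENNReal.ofReal_pow (by positivity), ← ENNReal.ofReal_mul hc]

/-- Lipschitz profiles of mean zero supported in the unit ball. -/
structure Prof (φ : En n → ℂ) (b G : ℝ) : Prop where
  meas : Measurable φ
  supp : ∀ t, 1 < ‖t‖ → φ t = 0
  bdd : ∀ t, ‖φ t‖ ≤ b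
  lip : ∀ t t', ‖φ t - φ t'‖ ≤ G * ‖t - t'‖
  mean : ∫ t, φ t = 0

/-- The dilate of a profile to scale `2 ^ (-s)`, as a convolution kernel. -/
def cKer (φ : En n → ℂ) (s : ℤ) (x y : En n) : ℂ :=
  ((((2 : ℝ) ^ s) ^ n : ℝ) : ℂ) * φ ((2 : ℝ) ^ s • (x - y))

lemma Prof.neg {φ : En n → ℂ} {b G : ℝ} (h : Prof φ b G) : Prof (fun t => φ (-t)) b G := by
  refine ⟨h.meas.comp measurable_neg, fun t ht => h.supp _ (by simpa using ht), fun t => h.bdd _,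
    fun t t' => ?_, ?_⟩
  · refine (h.lip _ _).trans (le_of_eq ?_)
    rw [← norm_neg, neg_sub_neg, neg_sub]
  · rw [integral_neg_eq_self]
    exact h.mean

lemma Prof.b_nonneg {φ : En n → ℂ} {b G : ℝ} (h : Prof φ b G) : 0 ≤ b :=
  (norm_nonneg _).trans (h.bdd 0)

lemma cKer_swap (φ : En n → ℂ) (s : ℤ) (x y : En n) :
    cKer φ s y x = cKer (fun t => φ (-t)) s x y := by
  simp only [cKer]
  rw [← smul_neg, neg_sub]

lemma Prof.cKer_norm_le {φ : En n → ℂ} {b G : ℝ} (h : Prof φ b G) (s : ℤ) (x y : En n) :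
    ‖cKer φ s x y‖ ≤ ((2 : ℝ) ^ s) ^ n * b := by
  rw [cKer, norm_mul, Complex.norm_real, Real.norm_of_nonneg (by positivity)]
  exact mul_le_mul_of_nonneg_left (h.bdd _) (by positivity)

lemma Prof.cKer_eq_zero {φ : En n → ℂ} {b G : ℝ} (h : Prof φ b G) {s : ℤ} {x y : En n}
    (hxy : ((2 : ℝ) ^ s)⁻¹ < ‖x - y‖) : cKer φ s x y = 0 := by
  rw [cKer, h.supp, mul_zero]
  rw [norm_smul, Real.norm_of_nonneg (by positivity)]
  have h2 : (0 : ℝ) < 2 ^ s := by positivity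
  calc (1 : ℝ) = 2 ^ s * (2 ^ s)⁻¹ := (mul_inv_cancel₀ h2.ne').symm
    _ < _ := mul_lt_mul_of_pos_left hxy h2

lemma Prof.lintegral_cKer_le {φ : En n → ℂ} {b G : ℝ} (h : Prof φ b G) (s : ℤ) (x : En n) :
    ∫⁻ y, ‖cKer φ s x y‖ₑ ≤ ENNReal.ofReal (b * 2 ^ n) := by
  have h2 : (0 : ℝ) < 2 ^ s := by positivity
  refine (lintegral_enorm_le_of_local (mul_nonneg (by positivity) h.b_nonneg)
    (inv_pos.2 h2).le (h.cKer_norm_le s x) fun y hy => h.cKer_eq_zero hy).trans (le_of_eq ?_)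
  congr 1
  rw [mul_pow, inv_pow]
  field_simp

lemma Prof.lintegral_cKer_le_right {φ : En n → ℂ} {b G : ℝ} (h : Prof φ b G) (s : ℤ) (y : En n) :
    ∫⁻ x, ‖cKer φ s x y‖ₑ ≤ ENNReal.ofReal (b * 2 ^ n) := by
  simp only [cKer_swap φ s y]
  exact h.neg.lintegral_cKer_le s y

lemma Prof.niceKer {φ : En n → ℂ} {b G : ℝ} (h : Prof φ b G) (s : ℤ) : NiceKer (cKer φ s) := by
  have hb := h.b_nonneg
  refine ⟨?_, max (Real.toNNReal (((2 : ℝ) ^ s) ^ n * b)) (Real.toNNReal (b * 2 ^ n)),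
    fun x y => ?_, fun x => ?_, fun y => ?_⟩
  · exact measurable_const.mul (h.meas.comp
      ((measurable_fst.sub measurable_snd).const_smul ((2 : ℝ) ^ s)))
  · rw [← ofReal_norm]
    exact (ENNReal.ofReal_le_ofReal (h.cKer_norm_le s x y)).trans
      (ENNReal.coe_le_coe.2 (le_max_left _ _))
  · exact (h.lintegral_cKer_le s x).trans (ENNReal.coe_le_coe.2 (le_max_right _ _))
  · exact (h.lintegral_cKer_le_right s y).trans (ENNReal.coe_le_coe.2 (le_max_right _ _))

lemma Prof.integral_cKer {φ : En n → ℂ} {b G : ℝ} (h : Prof φ b G) (s : ℤ) (x : En n) :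
    ∫ y, cKer φ s x y = 0 := by
  simp only [cKer]
  rw [integral_const_mul, integral_sub_left_eq_self (fun t => φ ((2 : ℝ) ^ s • t)) volume x,
    Measure.integral_comp_smul, h.mean]
  simp

lemma Prof.cKer_sub_norm_le {φ : En n → ℂ} {b G : ℝ} (h : Prof φ b G) (s : ℤ) (x y z : En n) :
    ‖cKer φ s x y - cKer φ s x z‖ ≤ ((2 : ℝ) ^ s) ^ n * (G * (2 ^ s * ‖y - z‖)) := by
  rw [cKer, cKer, ← mul_sub, norm_mul, Complex.norm_real, Real.norm_of_nonneg (by positivity)]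
  refine mul_le_mul_of_nonneg_left ((h.lip _ _).trans (le_of_eq ?_)) (by positivity)
  rw [← smul_sub, norm_smul, Real.norm_of_nonneg (by positivity), sub_sub_sub_cancel_left,
    norm_sub_rev]

/-- The conjugation-free `L²` Schur bound for real constants. -/
lemma N2_kOp_le_schur {κ : En n → En n → ℂ} (h : NiceKer κ) {a b c : ℝ} (ha : 0 ≤ a)
    (hc : 0 ≤ c) (habc : a * b ≤ c ^ 2)
    (h1 : ∀ x, ∫⁻ y, ‖κ x y‖ₑ ≤ ENNReal.ofReal a) (h2 : ∀ y, ∫⁻ x, ‖κ x y‖ₑ ≤ ENNReal.ofReal b)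
    {f : En n → ℂ} (hf : NiceFun f) : N2 (kOp κ f) ≤ c * N2 f := by
  refine N2_le_of_lintegral_le (h.niceFun_kOp hf) hf hc
    ((lintegral_kOp_sq_le h h1 h2 hf).trans ?_)
  rw [← ENNReal.ofReal_mul ha]
  gcongr

lemma enorm_integral_mul_eKer_le {F : En n → ℂ} {l : ℤ} {y : En n} {c : ℝ} (hc : 0 ≤ c)
    (hF : ∀ z, dyGen l z = dyGen l y → ‖F z‖ ≤ c) : ‖∫ z, F z * eKer l z y‖ ≤ c := by
  have : ‖∫ z, F z * eKer l z y‖ₑ ≤ ENNReal.ofReal c := by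
    calc ‖∫ z, F z * eKer l z y‖ₑ ≤ ∫⁻ z, ‖F z * eKer l z y‖ₑ :=
          enorm_integral_le_lintegral_enorm _
      _ ≤ ∫⁻ z, ENNReal.ofReal c * ‖eKer l y z‖ₑ := by
          refine lintegral_mono fun z => ?_
          rw [enorm_mul, eKer_comm l y z]
          by_cases h : dyGen l z = dyGen l y
          · gcongr
            rw [← ofReal_norm]
            exact ENNReal.ofReal_le_ofReal (hF z h)
          · simp [eKer, h]
      _ = ENNReal.ofReal c := by
          rw [lintegral_const_mul _ ((niceKer_eKer l).meas.of_uncurry_left.enorm),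
            lintegral_eKer, mul_one]
  rw [← ofReal_norm] at this
  exact (ENNReal.ofReal_le_ofReal_iff hc).1 this

lemma Prof.N2_cOp_le_of_eOp_eq_zero {φ : En n → ℂ} {b G : ℝ} (h : Prof φ b G) (hG : 0 ≤ G)
    {s l : ℤ} (hsl : s ≤ l) {f : En n → ℂ} (hf : NiceFun f) (hl : eOp l f = fun _ => 0) :
    N2 (kOp (cKer φ s) f) ≤ G * n * (2 * (1 + n)) ^ n * (2 : ℝ) ^ (s - l) * N2 f := by
  have h2 : (0 : ℝ) < 2 ^ s := by positivity
  have hcomp := (h.niceKer s).comp (niceKer_eKer l)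
  set D : En n → En n → ℂ := fun x y => cKer φ s x y - kComp (cKer φ s) (eKer l) x y with hD
  have hDn : NiceKer D := (h.niceKer s).sub hcomp
  have e1 : kOp (cKer φ s) f = kOp D f := by
    funext x
    rw [hD, kOp_sub_left (h.niceKer s) hcomp hf, NiceKer.kOp_comp (h.niceKer s) (niceKer_eKer l) hf]
    rw [show kOp (eKer l) f = fun _ => 0 from hl]
    simp [kOp]
  have e2 : ∀ x y, D x y = ∫ z, (cKer φ s x y - cKer φ s x z) * eKer l z y := fun x y => by
    have i1 : Integrable fun z => eKer l z y := by
      simpa only [eKer_comm l _ y] using (niceKer_eKer l).integrable_left y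
    have i2 : Integrable fun z => cKer φ s x z * eKer l z y := by
      simpa only [eKer_comm l _ y] using
        (h.niceKer s).integrable_mul ((niceKer_eKer l).niceFun_left y) x
    simp only [sub_mul]
    rw [integral_sub (i1.const_mul _) i2, integral_const_mul]
    simp only [hD, kComp, eKer_comm l _ y]
    rw [integral_eKer, mul_one]
  have hpow : (2 : ℝ) ^ s * (2 ^ l)⁻¹ = 2 ^ (s - l) := by
    rw [zpow_sub₀ two_ne_zero]; rfl
  have hle : ((2 : ℝ) ^ l)⁻¹ ≤ (2 ^ s)⁻¹ :=
    inv_anti₀ h2 (zpow_le_zpow_right₀ one_le_two hsl)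
  set c : ℝ := ((2 : ℝ) ^ s) ^ n * (G * n * (2 : ℝ) ^ (s - l)) with hc
  have hc0 : 0 ≤ c := by positivity
  have hDb : ∀ x y, ‖D x y‖ ≤ c := fun x y => by
    rw [e2]
    refine enorm_integral_mul_eKer_le hc0 fun z hz => (h.cKer_sub_norm_le s x y z).trans ?_
    rw [hc, ← hpow]
    have := norm_sub_le_of_dyGen hz.symm
    calc ((2 : ℝ) ^ s) ^ n * (G * (2 ^ s * ‖y - z‖))
        ≤ ((2 : ℝ) ^ s) ^ n * (G * (2 ^ s * (n * ((2 : ℝ) ^ l)⁻¹))) := by gcongr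
      _ = _ := by ring
  have hDz : ∀ x y, (1 + n) * ((2 : ℝ) ^ s)⁻¹ < ‖x - y‖ → D x y = 0 := fun x y hxy => by
    have : ‖D x y‖ ≤ 0 := by
      rw [e2]
      refine enorm_integral_mul_eKer_le le_rfl fun z hz => ?_
      have h3 := norm_sub_le_of_dyGen hz
      have h4 : ‖x - y‖ ≤ ‖x - z‖ + ‖z - y‖ := by
        simpa using norm_add_le (x - z) (z - y)
      have h6 : (n : ℝ) * ((2 : ℝ) ^ l)⁻¹ ≤ n * (2 ^ s)⁻¹ := by gcongr
      have hp : 0 < ((2 : ℝ) ^ s)⁻¹ := by positivity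
      have hn0 : 0 ≤ (n : ℝ) * ((2 : ℝ) ^ s)⁻¹ := by positivity
      rw [h.cKer_eq_zero (y := y) (by linarith), h.cKer_eq_zero (y := z) (by linarith)]
      simp
    simpa using this
  have hr : 0 ≤ (1 + n) * ((2 : ℝ) ^ s)⁻¹ := by positivity
  have hval : c * (2 * ((1 + n) * ((2 : ℝ) ^ s)⁻¹)) ^ n =
      G * n * (2 * (1 + n)) ^ n * (2 : ℝ) ^ (s - l) := by
    rw [hc, ← mul_assoc 2 (1 + (n : ℝ)), mul_pow _ ((2 : ℝ) ^ s)⁻¹, inv_pow]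
    field_simp
  rw [e1]
  refine N2_kOp_le_schur hDn (a := G * n * (2 * (1 + n)) ^ n * (2 : ℝ) ^ (s - l))
    (b := G * n * (2 * (1 + n)) ^ n * (2 : ℝ) ^ (s - l)) (by positivity) (by positivity)
    (le_of_eq (by ring)) (fun x => ?_) (fun y => ?_) hf
  · rw [← hval]
    exact lintegral_enorm_le_of_local hc0 hr (hDb x) (hDz x)
  · rw [← hval]
    exact lintegral_enorm_le_of_local hc0 hr (fun x => hDb x y) fun x hx => hDz x y
      (by rwa [norm_sub_rev])

end ConvolutionKernels

section BoundaryLayer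

variable {n : ℕ}

/-- The points of the dyadic cube of `y` at distance at least `d` from its boundary. -/
def innerBox (m : ℤ) (d : ℝ) (y : En n) : Set (En n) :=
  {z : En n | ∀ i, z i ∈ Set.Ico ((dyGen m y i : ℝ) * ((2 : ℝ) ^ m)⁻¹ + d)
    (((dyGen m y i : ℝ) + 1) * ((2 : ℝ) ^ m)⁻¹ - d)}

lemma measurableSet_innerBox (m : ℤ) (d : ℝ) (y : En n) : MeasurableSet (innerBox m d y) := by
  rw [innerBox, Set.ofPred_forall]
  exact MeasurableSet.iInter fun i => measurableSet_Ico.preimage (by fun_prop)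

lemma dyGen_eq_of_mem_innerBox {m : ℤ} {d : ℝ} {x y z : En n} (hz : z ∈ innerBox m d y)
    (hx : ‖x - z‖ ≤ d) : dyGen m x = dyGen m y := by
  have : x ∈ dyCube m y := by
    rw [dyCube_eq_Ico]
    intro i
    have h1 := hz i
    have h2 := abs_le.1 ((abs_coord_le_norm (x - z) i).trans hx)
    simp only [PiLp.sub_apply, Set.mem_Ico] at h1 h2 ⊢
    constructor <;> linarith [h1.1, h1.2, h2.1, h2.2]
  exact this

lemma one_sub_max_pow_le {t : ℝ} (ht : 0 ≤ t) (ht1 : t ≤ 1) :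
    1 - (max (1 - 2 * t) 0) ^ n ≤ 2 * n * t := by
  rcases Nat.eq_zero_or_pos n with rfl | hn
  · simp
  have hn1 : (1 : ℝ) ≤ n := by exact_mod_cast hn
  rcases le_total (1 - 2 * t) 0 with h | h
  · rw [max_eq_right h, zero_pow hn.ne']
    nlinarith
  · rw [max_eq_left h]
    have := one_add_mul_le_pow (a := -(2 * t)) (by linarith) n
    rw [← sub_eq_add_neg] at this
    nlinarith

lemma lintegral_layer_le {m s : ℤ} (hms : m ≤ s) (y : En n) :
    ∫⁻ z, (innerBox m ((2 : ℝ) ^ s)⁻¹ y)ᶜ.indicator (fun _ => (1 : ℝ≥0∞)) z * ‖eKer m y z‖ₑ ≤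
      ENNReal.ofReal (2 * n * 2 ^ (m - s)) := by
  set d : ℝ := ((2 : ℝ) ^ s)⁻¹ with hd
  have hd0 : 0 < d := by positivity
  set I := innerBox m d y with hI
  have h2 : (0 : ℝ) < 2 ^ m := by positivity
  set a : ℝ := ((2 : ℝ) ^ m)⁻¹ with ha
  have ha0 : 0 < a := by positivity
  set t : ℝ := 2 ^ (m - s) with ht
  have hdt : d = a * t := by
    rw [hd, ha, ht, zpow_sub₀ two_ne_zero]
    field_simp
  have ht0 : 0 ≤ t := by positivity
  have ht1 : t ≤ 1 := zpow_le_one_of_nonpos₀ one_le_two (by omega)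
  have hIm := measurableSet_innerBox m d y
  have hsub : I ⊆ dyCube m y := fun z hz =>
    dyGen_eq_of_mem_innerBox hz (by simpa using hd0.le)
  have hvolI : volume I = ENNReal.ofReal ((max (a - 2 * d) 0) ^ n) := by
    rw [hI, innerBox, preimage_Ico_volume]
    have : ∀ i, ((dyGen m y i : ℝ) + 1) * a - d - ((dyGen m y i : ℝ) * a + d) = a - 2 * d :=
      fun i => by ring
    rw [Finset.prod_congr rfl fun i _ => congrArg ENNReal.ofReal (this i), Finset.prod_const,
      Finset.card_univ, Fintype.card_fin, ENNReal.ofReal_pow (le_max_right _ _),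
      ENNReal.ofReal_max]
    simp
  have hvol : volume (dyCube m y \ I) ≤ ENNReal.ofReal (a ^ n * (2 * n * t)) := by
    rw [measure_sdiff hsub hIm.nullMeasurableSet
      ((measure_mono hsub).trans_lt (volume_dyCube_ne_top m y).lt_top).ne, hvolI, volume_dyCube,
      ← ENNReal.ofReal_sub _ (by positivity)]
    refine ENNReal.ofReal_le_ofReal ?_
    have e : max (a - 2 * d) 0 = a * max (1 - 2 * t) 0 := by
      rw [mul_max_of_nonneg _ _ ha0.le, hdt]
      congr 1 <;> ring
    rw [e, mul_pow]
    have := mul_le_mul_of_nonneg_left (one_sub_max_pow_le (n := n) ht0 ht1)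
      (pow_nonneg ha0.le n)
    linarith
  calc ∫⁻ z, Iᶜ.indicator (fun _ => (1 : ℝ≥0∞)) z * ‖eKer m y z‖ₑ
      = ∫⁻ z, (dyCube m y \ I).indicator (fun _ => ENNReal.ofReal (((2 : ℝ) ^ m) ^ n)) z := by
        refine lintegral_congr fun z => ?_
        rw [eKer_eq_indicator]
        by_cases h1 : z ∈ I <;> by_cases h3 : z ∈ dyCube m y
        · simp [h1]
        · simp [h1]
        · rw [Set.indicator_of_mem (show z ∈ Iᶜ from h1), Set.indicator_of_mem h3,
            Set.indicator_of_mem (show z ∈ dyCube m y \ I from ⟨h3, h1⟩), one_mul, ← ofReal_norm,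
            Complex.norm_real, Real.norm_of_nonneg (by positivity)]
        · simp [h3]
    _ ≤ ENNReal.ofReal (((2 : ℝ) ^ m) ^ n) * ENNReal.ofReal (a ^ n * (2 * n * t)) :=
        (lintegral_indicator_const_le _ _).trans (by gcongr)
    _ = _ := by
        rw [← ENNReal.ofReal_mul (by positivity), ← mul_assoc, ← mul_pow, ha,
          mul_inv_cancel₀ h2.ne', one_pow, one_mul]

lemma lintegral_kComp_le {κ₁ κ₂ : En n → En n → ℂ} (h₁ : NiceKer κ₁) (h₂ : NiceKer κ₂)
    {a b : ℝ≥0∞} (ha : ∀ x, ∫⁻ z, ‖κ₁ x z‖ₑ ≤ a) (hb : ∀ z, ∫⁻ y, ‖κ₂ z y‖ₑ ≤ b) (x : En n) :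
    ∫⁻ y, ‖kComp κ₁ κ₂ x y‖ₑ ≤ a * b := by
  have hm : Measurable fun w : En n × En n => ‖κ₁ x w.2‖ₑ * ‖κ₂ w.2 w.1‖ₑ :=
    (h₁.meas.of_uncurry_left.enorm.comp measurable_snd).mul (h₂.meas.comp measurable_swap).enorm
  calc ∫⁻ y, ‖kComp κ₁ κ₂ x y‖ₑ ≤ ∫⁻ y, ∫⁻ z, ‖κ₁ x z‖ₑ * ‖κ₂ z y‖ₑ := by
        refine lintegral_mono fun y => (enorm_integral_le_lintegral_enorm _).trans (le_of_eq ?_)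
        simp only [enorm_mul]
    _ = ∫⁻ z, ∫⁻ y, ‖κ₁ x z‖ₑ * ‖κ₂ z y‖ₑ := lintegral_lintegral_swap hm.aemeasurable
    _ = ∫⁻ z, ‖κ₁ x z‖ₑ * ∫⁻ y, ‖κ₂ z y‖ₑ := by
        refine lintegral_congr fun z => ?_
        rw [lintegral_const_mul _ h₂.meas.of_uncurry_left.enorm]
    _ ≤ ∫⁻ z, ‖κ₁ x z‖ₑ * b := lintegral_mono fun z => by gcongr; exact hb z
    _ ≤ a * b := by
        rw [lintegral_mul_const _ h₁.meas.of_uncurry_left.enorm]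
        gcongr
        exact ha x

lemma Prof.N2_cOp_le_of_eOp_eq_self {φ : En n → ℂ} {b G : ℝ} (h : Prof φ b G)
    {s m : ℤ} (hms : m ≤ s) {f : En n → ℂ} (hf : NiceFun f) (hm : eOp m f = f) :
    N2 (kOp (cKer φ s) f) ≤ b * 2 ^ n * (2 * n) * √((2 : ℝ) ^ (m - s)) * N2 f := by
  have hb := h.b_nonneg
  have hκ := h.niceKer s
  have he := niceKer_eKer (n := n) m
  set κ := cKer φ s with hκdef
  set t : ℝ := 2 ^ (m - s) with ht
  have ht0 : 0 ≤ t := by positivity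
  have hcomp := hκ.comp he
  have e1 : kOp κ f = kOp (kComp κ (eKer m)) f := by
    funext x
    rw [NiceKer.kOp_comp hκ he hf, show kOp (eKer m) f = f from hm]
  have e2 : ∀ x y, kComp κ (eKer m) x y = ∫ z, κ x z * (eKer m z y - eKer m x y) := fun x y => by
    have i2 : Integrable fun z => κ x z * eKer m z y := by
      simpa only [eKer_comm m _ y] using hκ.integrable_mul (he.niceFun_left y) x
    simp only [mul_sub]
    rw [integral_sub i2 ((hκ.integrable_left x).mul_const _), integral_mul_const,
      h.integral_cKer, zero_mul, sub_zero]
    rfl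
  set J : En n → En n → ℝ≥0∞ := fun x z => if dyGen m x = dyGen m z then 0 else ‖κ x z‖ₑ with hJ
  have hJm : Measurable (Function.uncurry J) := by
    refine Measurable.ite ?_ measurable_const hκ.meas.enorm
    exact measurableSet_eq_fun ((measurable_dyGen m).comp measurable_fst)
      ((measurable_dyGen m).comp measurable_snd)
  have hJle : ∀ x z, J x z ≤ ‖κ x z‖ₑ := fun x z => by
    simp only [hJ]; split_ifs <;> simp
  have hJz : ∀ x z y, (x ∈ innerBox m ((2 : ℝ) ^ s)⁻¹ y ∨ z ∈ innerBox m ((2 : ℝ) ^ s)⁻¹ y) →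
      J x z = 0 := fun x z y hxz => by
    have hd0 : (0 : ℝ) ≤ ((2 : ℝ) ^ s)⁻¹ := by positivity
    by_cases hxz' : ‖x - z‖ ≤ ((2 : ℝ) ^ s)⁻¹
    · have : dyGen m x = dyGen m z := by
        rcases hxz with hx | hz
        · rw [dyGen_eq_of_mem_innerBox hx (x := x) (by simpa using hd0),
            dyGen_eq_of_mem_innerBox hx (x := z) (by rwa [norm_sub_rev])]
        · rw [dyGen_eq_of_mem_innerBox hz (x := x) hxz',
            dyGen_eq_of_mem_innerBox hz (x := z) (by simpa using hd0)]
      simp [hJ, this]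
    · have := h.cKer_eq_zero (not_le.1 hxz')
      simp [hJ, hκdef, this]
  have hDle : ∀ x y, ‖kComp κ (eKer m) x y‖ₑ ≤
      (∫⁻ z, J x z * ‖eKer m y z‖ₑ) + ∫⁻ z, J x z * ‖eKer m y x‖ₑ := fun x y => by
    rw [e2, ← lintegral_add_left (f := fun z => J x z * ‖eKer m y z‖ₑ)
      (hJm.of_uncurry_left.mul he.meas.of_uncurry_left.enorm)]
    refine (enorm_integral_le_lintegral_enorm _).trans (lintegral_mono fun z => ?_)
    simp only [hJ, enorm_mul]
    split_ifs with hxz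
    · rw [eKer_congr hxz]
      simp
    · rw [← mul_add, eKer_comm m y z, eKer_comm m y x]
      gcongr
      exact enorm_sub_le
  have hJrow : ∀ x y, ∫⁻ z, J x z ≤ ENNReal.ofReal (b * 2 ^ n) *
      (innerBox m ((2 : ℝ) ^ s)⁻¹ y)ᶜ.indicator (fun _ => (1 : ℝ≥0∞)) x := fun x y => by
    by_cases hx : x ∈ innerBox m ((2 : ℝ) ^ s)⁻¹ y
    · simp [hJz x _ y (Or.inl hx)]
    · rw [Set.indicator_of_mem (show x ∈ (innerBox m ((2 : ℝ) ^ s)⁻¹ y)ᶜ from hx), mul_one]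
      exact (lintegral_mono (hJle x)).trans (h.lintegral_cKer_le s x)
  have hJcol : ∀ z y, ∫⁻ x, J x z ≤ ENNReal.ofReal (b * 2 ^ n) *
      (innerBox m ((2 : ℝ) ^ s)⁻¹ y)ᶜ.indicator (fun _ => (1 : ℝ≥0∞)) z := fun z y => by
    by_cases hz : z ∈ innerBox m ((2 : ℝ) ^ s)⁻¹ y
    · simp [hJz _ z y (Or.inr hz)]
    · rw [Set.indicator_of_mem (show z ∈ (innerBox m ((2 : ℝ) ^ s)⁻¹ y)ᶜ from hz), mul_one]
      exact (lintegral_mono fun x => hJle x z).trans (h.lintegral_cKer_le_right s z)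
  have hcol : ∀ y, ∫⁻ x, ‖kComp κ (eKer m) x y‖ₑ ≤ ENNReal.ofReal (b * 2 ^ n * (4 * n * t)) := by
    intro y
    have hey : Measurable fun z => ‖eKer m y z‖ₑ := he.meas.of_uncurry_left.enorm
    have hm1 : Measurable fun w : En n × En n => J w.1 w.2 * ‖eKer m y w.2‖ₑ :=
      hJm.mul (hey.comp measurable_snd)
    have p1 : ∫⁻ x, ∫⁻ z, J x z * ‖eKer m y z‖ₑ ≤
        ENNReal.ofReal (b * 2 ^ n) * ENNReal.ofReal (2 * n * t) := by
      rw [lintegral_lintegral_swap hm1.aemeasurable]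
      calc ∫⁻ z, ∫⁻ x, J x z * ‖eKer m y z‖ₑ
          ≤ ∫⁻ z, ENNReal.ofReal (b * 2 ^ n) *
            ((innerBox m ((2 : ℝ) ^ s)⁻¹ y)ᶜ.indicator (fun _ => (1 : ℝ≥0∞)) z *
              ‖eKer m y z‖ₑ) := by
            refine lintegral_mono fun z => ?_
            rw [lintegral_mul_const _ hJm.of_uncurry_right, ← mul_assoc]
            gcongr
            exact hJcol z y
        _ ≤ _ := by
            rw [lintegral_const_mul' _ _ ENNReal.ofReal_ne_top]
            gcongr
            exact lintegral_layer_le hms y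
    have p2 : ∫⁻ x, ∫⁻ z, J x z * ‖eKer m y x‖ₑ ≤
        ENNReal.ofReal (b * 2 ^ n) * ENNReal.ofReal (2 * n * t) := by
      calc ∫⁻ x, ∫⁻ z, J x z * ‖eKer m y x‖ₑ
          ≤ ∫⁻ z, ENNReal.ofReal (b * 2 ^ n) *
            ((innerBox m ((2 : ℝ) ^ s)⁻¹ y)ᶜ.indicator (fun _ => (1 : ℝ≥0∞)) z *
              ‖eKer m y z‖ₑ) := by
            refine lintegral_mono fun z => ?_
            rw [lintegral_mul_const _ hJm.of_uncurry_left, ← mul_assoc]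
            gcongr
            exact hJrow z y
        _ ≤ _ := by
            rw [lintegral_const_mul' _ _ ENNReal.ofReal_ne_top]
            gcongr
            exact lintegral_layer_le hms y
    refine (lintegral_mono fun x => hDle x y).trans ?_
    rw [lintegral_add_left hm1.lintegral_prod_right']
    refine (add_le_add p1 p2).trans (le_of_eq ?_)
    rw [← ENNReal.ofReal_mul (by positivity), ← ENNReal.ofReal_add (by positivity) (by positivity)]
    congr 1
    ring
  have hrow : ∀ x, ∫⁻ y, ‖kComp κ (eKer m) x y‖ₑ ≤ ENNReal.ofReal (b * 2 ^ n) := fun x => by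
    simpa using lintegral_kComp_le hκ he (h.lintegral_cKer_le s)
      (fun z => (lintegral_eKer m z).le) x
  rw [e1]
  refine N2_kOp_le_schur hcomp (by positivity) (by positivity) ?_ hrow hcol hf
  rw [mul_pow _ (√t), Real.sq_sqrt ht0]
  have hn2 : (n : ℝ) ≤ (n : ℝ) ^ 2 := by exact_mod_cast Nat.le_self_pow two_ne_zero n
  have : b * 2 ^ n * (b * 2 ^ n * (4 * n * t)) = (b * 2 ^ n) ^ 2 * 4 * t * n := by ring
  rw [this]
  calc (b * 2 ^ n) ^ 2 * 4 * t * n ≤ (b * 2 ^ n) ^ 2 * 4 * t * (n : ℝ) ^ 2 := by gcongr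
    _ = _ := by ring

/-- The dimensional constant in the almost orthogonality estimate. -/
def orthConst (n : ℕ) : ℝ := n * (2 * (1 + n)) ^ n + 2 ^ n * (4 * n) + 2 ^ n

lemma orthConst_pos (n : ℕ) : 0 < orthConst n := by
  unfold orthConst
  positivity

lemma zpow_le_dec {d : ℤ} (hd : 0 ≤ d) : (2 : ℝ) ^ (-d) ≤ dec d := by
  rw [dec, ← Real.rpow_intCast]
  refine Real.rpow_le_rpow_of_exponent_le one_le_two ?_
  have : (d.natAbs : ℝ) = (d : ℝ) := by
    rw [Nat.cast_natAbs, abs_of_nonneg hd]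
  rw [this]
  have : (0 : ℝ) ≤ d := by exact_mod_cast hd
  push_cast
  linarith

lemma dec_neg (d : ℤ) : dec (-d) = dec d := by simp [dec]

lemma sqrt_zpow_le_dec {d : ℤ} (hd : 1 ≤ d) : √((2 : ℝ) ^ (1 - d)) ≤ 2 * dec d := by
  have e : dec d ^ 2 = (2 : ℝ) ^ (-d) := by
    rw [dec, ← Real.rpow_natCast, ← Real.rpow_mul two_pos.le, ← Real.rpow_intCast]
    congr 1
    rw [Nat.cast_natAbs, abs_of_nonneg (by omega)]
    push_cast
    ring
  refine Real.sqrt_le_iff.2 ⟨mul_nonneg two_pos.le (dec_pos d).le, ?_⟩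
  rw [mul_pow, e, sub_eq_add_neg, zpow_add₀ two_ne_zero]
  have : (0 : ℝ) < 2 ^ (-d) := by positivity
  rw [zpow_one]
  linarith

/-- Almost orthogonality of convolutions and martingale differences. -/
theorem Prof.N2_cOp_mP_le {φ : En n → ℂ} {b G : ℝ} (h : Prof φ b G) (hG : 0 ≤ G) {M r : ℕ}
    {s : ℤ} (hs : -(M : ℤ) < s) (hs' : s ≤ M) {f : En n → ℂ} (hf : NiceFun f) :
    N2 (kOp (cKer φ s) (mP M r f)) ≤
      orthConst n * (b + G) * dec (s - (r - M)) * N2 (mP M r f) := by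
  have hb := h.b_nonneg
  rcases le_or_gt s ((r : ℤ) - M) with hsr | hsr
  · refine (h.N2_cOp_le_of_eOp_eq_zero hG hsr (hf.mP M r) (eOp_mP_of_ge le_rfl (by omega) hf)).trans
      (mul_le_mul_of_nonneg_right ?_ (N2_nonneg _))
    have hd := zpow_le_dec (d := (r : ℤ) - M - s) (by omega)
    rw [← dec_neg, neg_sub] at hd
    have h0 : (0 : ℝ) ≤ 2 ^ n * (4 * n) := by positivity
    have h1 : (0 : ℝ) ≤ 2 ^ n := by positivity
    calc G * n * (2 * (1 + n)) ^ n * (2 : ℝ) ^ (s - ((r : ℤ) - M))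
        = (n * (2 * (1 + n)) ^ n) * G * (2 : ℝ) ^ (s - ((r : ℤ) - M)) := by ring
      _ ≤ orthConst n * (b + G) * dec (s - (r - M)) := by
          have := orthConst_pos n
          have h3 := (dec_pos (s - (r - M))).le
          gcongr
          · unfold orthConst; linarith
          · linarith
  · have hk : (r : ℤ) - M + 1 ≤ s := by omega
    refine (h.N2_cOp_le_of_eOp_eq_self hk (hf.mP M r)
      (eOp_mP_of_lt (by omega) (by omega) hf)).trans
      (mul_le_mul_of_nonneg_right ?_ (N2_nonneg _))
    have hd := sqrt_zpow_le_dec (d := s - ((r : ℤ) - M)) (by omega)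
    rw [show 1 - (s - ((r : ℤ) - M)) = (r : ℤ) - M + 1 - s by ring] at hd
    have h0 : (0 : ℝ) ≤ n * (2 * (1 + n)) ^ n := by positivity
    have h1 : (0 : ℝ) ≤ 2 ^ n := by positivity
    calc b * 2 ^ n * (2 * n) * √((2 : ℝ) ^ ((r : ℤ) - M + 1 - s))
        ≤ b * 2 ^ n * (2 * n) * (2 * dec (s - ((r : ℤ) - M))) := by gcongr
      _ = (2 ^ n * (4 * n)) * b * dec (s - (r - M)) := by ring
      _ ≤ orthConst n * (b + G) * dec (s - (r - M)) := by
          have := orthConst_pos n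
          have h3 := (dec_pos (s - (r - M))).le
          gcongr
          · unfold orthConst; linarith
          · linarith

end BoundaryLayer

section SquareFunctionL2

variable {n : ℕ}

lemma Prof.bilin_dec {φ : En n → ℂ} {b G : ℝ} (h : Prof φ b G) (hG : 0 ≤ G) {M : ℕ}
    {s : ℤ} (hs : -(M : ℤ) < s) (hs' : s ≤ M) {f g : En n → ℂ} (hf : NiceFun f) (hg : NiceFun g)
    (r r' : ℕ) :
    ‖∫ x, kOp (cKer φ s) (mP M r f) x * mP M r' g x‖ ≤
        orthConst n * (b + G) * dec (s - (r - M)) * (N2 (mP M r f) * N2 (mP M r' g)) ∧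
    ‖∫ x, kOp (cKer φ s) (mP M r f) x * mP M r' g x‖ ≤
        orthConst n * (b + G) * dec (s - (r' - M)) * (N2 (mP M r f) * N2 (mP M r' g)) := by
  constructor
  · refine (norm_integral_mul_le ((h.niceKer s).niceFun_kOp (hf.mP M r)) (hg.mP M r')).trans ?_
    rw [← mul_assoc]
    exact mul_le_mul_of_nonneg_right (h.N2_cOp_mP_le hG hs hs' hf) (N2_nonneg _)
  · have e : (fun x y => cKer φ s y x) = cKer (fun t => φ (-t)) s :=
      funext fun x => funext fun y => cKer_swap φ s x y
    rw [(h.niceKer s).integral_kOp_mul (hf.mP M r) (hg.mP M r'), e]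
    refine (norm_integral_mul_le (hf.mP M r) ((h.neg.niceKer s).niceFun_kOp (hg.mP M r'))).trans ?_
    rw [mul_left_comm]
    exact mul_le_mul_of_nonneg_left (h.neg.N2_cOp_mP_le hG hs hs' hg) (N2_nonneg _)

theorem exists_l2_osc (n : ℕ) : ∃ C : ℝ, 0 < C ∧ ∀ (M : ℕ) (ι : Type) [Fintype ι]
    (σ : ι → ℤ) (φ : En n → ℂ) (b G b₀ : ℝ), Function.Injective σ →
    (∀ i, -(M : ℤ) < σ i ∧ σ i ≤ M) → Prof φ b G → 0 < b → 0 ≤ G → 0 < b₀ →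
    (∀ s f, NiceFun f → N2 (kOp (cKer φ s) f) ≤ b₀ * N2 f) →
    ∀ c : ι → ℂ, (∀ i, ‖c i‖ ≤ 1) → ∀ f, NiceFun f →
      N2 (fun x => ∑ i, c i * kOp (cKer φ (σ i)) f x) ≤
        C * (b₀ ^ (5 / 6 : ℝ) * (b + G) ^ (1 / 6 : ℝ)) * N2 f := by
  obtain ⟨C, hC, h⟩ := exists_bilinear_bound n
  have hK := orthConst_pos n
  refine ⟨C * orthConst n ^ (1 / 6 : ℝ), by positivity, ?_⟩
  intro M ι _ σ φ b G b₀ hσ hM hφ hb hG hb₀ hL c hc f hf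
  have := h M ι σ (fun i => cKer φ (σ i)) b₀ (orthConst n * (b + G)) hσ
    (fun i => hφ.niceKer _) hb₀ (by positivity) (fun i f g hf hg r _ r' _ => ?_) c hc f hf
  · refine this.trans (le_of_eq ?_)
    rw [Real.mul_rpow hK.le (by positivity)]
    ring
  · obtain ⟨h1, h2⟩ := hφ.bilin_dec hG (hM i).1 (hM i).2 hf hg r r'
    refine ⟨?_, h1, h2⟩
    refine (norm_integral_mul_le ((hφ.niceKer _).niceFun_kOp (hf.mP M r)) (hg.mP M r')).trans ?_
    rw [← mul_assoc]
    exact mul_le_mul_of_nonneg_right (hL _ _ (hf.mP M r)) (N2_nonneg _)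

lemma dec_anti {m : ℕ} {d : ℤ} (h : m ≤ d.natAbs) : dec d ≤ dec m := by
  unfold dec
  refine Real.rpow_le_rpow_of_exponent_le one_le_two ?_
  have : (m : ℝ) ≤ d.natAbs := by exact_mod_cast h
  simp only [Int.natAbs_natCast]
  linarith

theorem exists_l2_red (n : ℕ) : ∃ C : ℝ, 0 < C ∧ ∀ (M : ℕ) (ι : Type) [Fintype ι]
    (σ : ι → ℤ) (φ : En n → ℂ) (b G : ℝ) (U : ι → En n → En n → ℂ) (m : ℕ),
    Function.Injective σ →
    (∀ i, -(M : ℤ) < σ i ∧ σ i ≤ M) → Prof φ b G → 0 < b → 0 ≤ G → (∀ i, NiceKer (U i)) →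
    (∀ i f g, NiceFun f → NiceFun g → ∀ r' ≤ 2 * M,
      ∫ x, kOp (U i) f x * mP M r' g x = 0 ∨ m ≤ (σ i - (r' - M)).natAbs ∧
      ‖∫ x, kOp (U i) f x * mP M r' g x‖ =
        ‖∫ x, kOp (cKer φ (σ i)) f x * mP M r' g x‖) →
    ∀ c : ι → ℂ, (∀ i, ‖c i‖ ≤ 1) → ∀ f, NiceFun f →
      N2 (fun x => ∑ i, c i * kOp (U i) f x) ≤ C * (b + G) * dec m ^ (5 / 6 : ℝ) * N2 f := by
  obtain ⟨C, hC, h⟩ := exists_bilinear_bound n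
  have hK := orthConst_pos n
  refine ⟨C * orthConst n, by positivity, ?_⟩
  intro M ι _ σ φ b G U m hσ hM hφ hb hG hU hred c hc f hf
  have hdm := dec_pos m
  set B : ℝ := orthConst n * (b + G) with hB
  have hB0 : 0 < B := by positivity
  have := h M ι σ U (B * dec m) B hσ hU (by positivity) hB0
    (fun i f g hf hg r _ r' hr' => ?_) c hc f hf
  · refine this.trans (le_of_eq ?_)
    have e : B ^ (5 / 6 : ℝ) * B ^ (1 / 6 : ℝ) = B := by
      rw [← Real.rpow_add hB0]; norm_num
    rw [Real.mul_rpow hB0.le hdm.le]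
    calc C * (B ^ (5 / 6 : ℝ) * dec m ^ (5 / 6 : ℝ) * B ^ (1 / 6 : ℝ)) * N2 f
        = C * (B ^ (5 / 6 : ℝ) * B ^ (1 / 6 : ℝ)) * dec m ^ (5 / 6 : ℝ) * N2 f := by ring
      _ = _ := by rw [e, hB]; ring
  · have hN : 0 ≤ N2 (mP M r f) * N2 (mP M r' g) := mul_nonneg (N2_nonneg _) (N2_nonneg _)
    rcases hred i (mP M r f) g (hf.mP M r) hg r' hr' with h0 | ⟨hm, h0⟩
    · have d1 := dec_pos (σ i - (r - M))
      have d2 := dec_pos (σ i - (r' - M))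
      rw [h0, norm_zero]
      exact ⟨by positivity, by positivity, by positivity⟩
    · obtain ⟨h1, h2⟩ := hφ.bilin_dec hG (hM i).1 (hM i).2 hf hg r r'
      rw [h0]
      refine ⟨h2.trans ?_, h1, h2⟩
      gcongr
      exact dec_anti hm

lemma kOp_kComp_eKer {φ : En n → ℂ} {b G : ℝ} (h : Prof φ b G) (k s : ℤ) {f : En n → ℂ}
    (hf : NiceFun f) : kOp (kComp (eKer k) (cKer φ s)) f = eOp k (kOp (cKer φ s) f) :=
  funext fun x => NiceKer.kOp_comp (niceKer_eKer k) (h.niceKer s) hf x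

/-- The reduction hypothesis for averages at a coarser scale. -/
lemma reduction_coarse {φ : En n → ℂ} {b G : ℝ} (h : Prof φ b G) {M m : ℕ} {k s : ℤ}
    (hk : -(M : ℤ) < k) (hk' : k ≤ M) (hks : k + m = s) {f g : En n → ℂ} (hf : NiceFun f)
    (hg : NiceFun g) (r' : ℕ) :
    ∫ x, kOp (kComp (eKer k) (cKer φ s)) f x * mP M r' g x = 0 ∨
      m ≤ (s - (r' - M)).natAbs ∧
      ‖∫ x, kOp (kComp (eKer k) (cKer φ s)) f x * mP M r' g x‖ =
        ‖∫ x, kOp (cKer φ s) f x * mP M r' g x‖ := by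
  rw [kOp_kComp_eKer h k s hf, eOp_adjoint ((h.niceKer s).niceFun_kOp hf) (hg.mP M r')]
  rcases le_or_gt k ((r' : ℤ) - M) with hr | hr
  · left
    rw [eOp_mP_of_ge hr hk hg]
    simp
  · right
    rw [eOp_mP_of_lt hr hk' hg]
    exact ⟨by omega, rfl⟩

/-- The reduction hypothesis for errors of averages at a finer scale. -/
lemma reduction_fine {φ : En n → ℂ} {b G : ℝ} (h : Prof φ b G) {M m : ℕ} {k s : ℤ}
    (hk : -(M : ℤ) < k) (hk' : k ≤ M) (hks : k = s + m) {f g : En n → ℂ} (hf : NiceFun f)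
    (hg : NiceFun g) (r' : ℕ) :
    ∫ x, kOp (fun x y => kComp (eKer k) (cKer φ s) x y - cKer φ s x y) f x * mP M r' g x = 0 ∨
      m ≤ (s - (r' - M)).natAbs ∧
      ‖∫ x, kOp (fun x y => kComp (eKer k) (cKer φ s) x y - cKer φ s x y) f x * mP M r' g x‖ =
        ‖∫ x, kOp (cKer φ s) f x * mP M r' g x‖ := by
  have hT := (h.niceKer s).niceFun_kOp hf
  have hE := hT.eOp k
  have e : ∫ x, kOp (fun x y => kComp (eKer k) (cKer φ s) x y - cKer φ s x y) f x * mP M r' g x =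
      (∫ x, kOp (cKer φ s) f x * eOp k (mP M r' g) x) -
        ∫ x, kOp (cKer φ s) f x * mP M r' g x := by
    rw [← eOp_adjoint hT (hg.mP M r')]
    obtain ⟨D, hD⟩ := hT.bdd
    obtain ⟨D', hD'⟩ := hE.bdd
    rw [← integral_sub ((hg.mP M r').mul_bdd hE.meas hD').int
      ((hg.mP M r').mul_bdd hT.meas hD).int]
    refine integral_congr_ae (Eventually.of_forall fun x => ?_)
    simp only
    rw [kOp_sub_left ((niceKer_eKer k).comp (h.niceKer s)) (h.niceKer s) hf,
      kOp_kComp_eKer h k s hf]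
    ring
  rw [e]
  rcases le_or_gt k ((r' : ℤ) - M) with hr | hr
  · right
    rw [eOp_mP_of_ge hr hk hg]
    refine ⟨by omega, by simp⟩
  · left
    rw [eOp_mP_of_lt hr hk' hg]
    simp

end SquareFunctionL2

section HormanderCondition

variable {n : ℕ}

lemma sum_le_of_scales {ι : Type*} [Fintype ι] {σ : ι → ℤ} (hσ : Function.Injective σ)
    {h : ι → ℝ≥0∞} {A G : ℝ} {q : ℤ} {m L : ℕ} (hA : 0 ≤ A) (hG : G ≤ A * 2 ^ L)
    (h1 : ∀ i, h i ≤ ENNReal.ofReal A) (h2 : ∀ i, h i ≤ ENNReal.ofReal (G * 2 ^ (σ i - q)))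
    (h3 : ∀ i, q + m ≤ σ i → h i = 0) :
    ∑ i, h i ≤ ENNReal.ofReal (A * (m + L + 2)) := by
  classical
  set a : ℤ := q - L with ha
  set w : ℤ → ℝ := fun t => (if t ∈ Finset.Ico a (q + m) then 1 else 0) +
    if t < a then (1 / 2 : ℝ) ^ (a - t).toNat else 0 with hw
  have hw0 : ∀ t, 0 ≤ w t := fun t => by
    simp only [hw]
    split_ifs <;> positivity
  have hle : ∀ i, h i ≤ ENNReal.ofReal (A * w (σ i)) := fun i => by
    rcases le_or_gt (q + m) (σ i) with hi | hi
    · rw [h3 i hi]; exact zero_le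
    rcases le_or_gt a (σ i) with hi' | hi'
    · refine (h1 i).trans (ENNReal.ofReal_le_ofReal ?_)
      have : w (σ i) = 1 := by
        simp only [hw]
        rw [if_pos (Finset.mem_Ico.2 ⟨hi', hi⟩), if_neg (by omega), add_zero]
      rw [this, mul_one]
    · refine (h2 i).trans (ENNReal.ofReal_le_ofReal ?_)
      have : w (σ i) = (1 / 2 : ℝ) ^ (a - σ i).toNat := by
        simp only [hw]
        rw [if_neg (by rw [Finset.mem_Ico]; omega), if_pos hi', zero_add]
      rw [this]
      have e : (1 / 2 : ℝ) ^ (a - σ i).toNat = 2 ^ L * 2 ^ (σ i - q) := by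
        rw [one_div, inv_pow, ← zpow_natCast, ← zpow_neg, Int.toNat_of_nonneg (by omega),
          ← zpow_natCast, ← zpow_add₀ two_ne_zero]
        congr 1
        omega
      rw [e, ← mul_assoc]
      gcongr
  refine (Finset.sum_le_sum fun i _ => hle i).trans ?_
  rw [← ENNReal.ofReal_sum_of_nonneg fun i _ => mul_nonneg hA (hw0 _), ← Finset.mul_sum]
  refine ENNReal.ofReal_le_ofReal (mul_le_mul_of_nonneg_left ?_ hA)
  have hsum : ∑ i, w (σ i) = ∑ t ∈ Finset.univ.image σ, w t :=
    (Finset.sum_image fun i _ j _ hij => hσ hij).symm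
  rw [hsum]
  simp only [hw]
  rw [Finset.sum_add_distrib]
  have p1 : ∑ t ∈ Finset.univ.image σ, (if t ∈ Finset.Ico a (q + m) then (1 : ℝ) else 0) ≤
      m + L := by
    rw [← Finset.sum_filter, Finset.sum_const, nsmul_eq_mul, mul_one]
    have : ((Finset.univ.image σ).filter (· ∈ Finset.Ico a (q + m))).card ≤ m + L := by
      refine (Finset.card_le_card (t := Finset.Ico a (q + m)) fun t ht =>
        (Finset.mem_filter.1 ht).2).trans ?_
      rw [Int.card_Ico]
      omega
    exact_mod_cast this
  have p2 : ∑ t ∈ Finset.univ.image σ, (if t < a then (1 / 2 : ℝ) ^ (a - t).toNat else 0) ≤ 2 := by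
    rw [← Finset.sum_filter, ← Finset.sum_image (g := fun t : ℤ => (a - t).toNat)
      (f := fun k : ℕ => (1 / 2 : ℝ) ^ k)]
    · exact (summable_geometric_two.sum_le_tsum _ fun k _ => by positivity).trans
        (le_of_eq tsum_geometric_two)
    · intro t ht t' ht' htt
      have h4 := (Finset.mem_filter.1 ht).2
      have h5 := (Finset.mem_filter.1 ht').2
      simp only at htt
      omega
  linarith

/-- Hörmander-type bounds, off the neighbouring cubes, for a kernel living at scale `2 ^ (-s)`. -/
def Horm (U : En n → En n → ℂ) (s : ℤ) (m : ℕ) (A G : ℝ) : Prop :=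
  ∀ q (y y' : En n), dyGen q y = dyGen q y' →
    ∫⁻ x in (dyStar q y)ᶜ, ‖U x y - U x y'‖ₑ ≤ ENNReal.ofReal A ∧
    ∫⁻ x in (dyStar q y)ᶜ, ‖U x y - U x y'‖ₑ ≤ ENNReal.ofReal (G * 2 ^ (s - q)) ∧
    (q + m ≤ s → ∫⁻ x in (dyStar q y)ᶜ, ‖U x y - U x y'‖ₑ = 0)

lemma Horm.sum {ι : Type*} [Fintype ι] {σ : ι → ℤ} (hσ : Function.Injective σ)
    {U : ι → En n → En n → ℂ} {A G : ℝ} {m L : ℕ} (hA : 0 ≤ A) (hG : G ≤ A * 2 ^ L)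
    (hU : ∀ i, NiceKer (U i)) (h : ∀ i, Horm (U i) (σ i) m A G) (q : ℤ) (y y' : En n)
    (hy : dyGen q y = dyGen q y') :
    ∫⁻ x in (dyStar q y)ᶜ, ∑ i, ‖U i x y - U i x y'‖ₑ ≤ ENNReal.ofReal (A * (m + L + 2)) := by
  rw [lintegral_finsetSum]
  · exact sum_le_of_scales hσ hA hG (fun i => (h i q y y' hy).1) (fun i => (h i q y y' hy).2.1)
      fun i => (h i q y y' hy).2.2
  · exact fun i _ => ((hU i).meas.of_uncurry_right.sub (hU i).meas.of_uncurry_right).enorm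

lemma Horm.sub {U V : En n → En n → ℂ} {s : ℤ} {m : ℕ} {A G A' G' : ℝ} (hU : Horm U s m A G)
    (hV : Horm V s m A' G') (hUn : NiceKer U) (hA : 0 ≤ A) (hA' : 0 ≤ A')
    (hG : 0 ≤ G) (hG' : 0 ≤ G') : Horm (fun x y => U x y - V x y) s m (A + A') (G + G') := by
  intro q y y' hy
  obtain ⟨u1, u2, u3⟩ := hU q y y' hy
  obtain ⟨v1, v2, v3⟩ := hV q y y' hy
  have key : ∫⁻ x in (dyStar q y)ᶜ, ‖(U x y - V x y) - (U x y' - V x y')‖ₑ ≤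
      (∫⁻ x in (dyStar q y)ᶜ, ‖U x y - U x y'‖ₑ) +
        ∫⁻ x in (dyStar q y)ᶜ, ‖V x y - V x y'‖ₑ := by
    rw [← lintegral_add_left (f := fun x => ‖U x y - U x y'‖ₑ)
      (hUn.meas.of_uncurry_right.sub hUn.meas.of_uncurry_right).enorm]
    refine lintegral_mono fun x => ?_
    rw [sub_sub_sub_comm]
    exact enorm_sub_le
  refine ⟨?_, ?_, fun hq => ?_⟩
  · rw [ENNReal.ofReal_add hA hA']
    exact key.trans (add_le_add u1 v1)
  · rw [add_mul, ENNReal.ofReal_add (by positivity) (by positivity)]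
    exact key.trans (add_le_add u2 v2)
  · rw [u3 hq, v3 hq, add_zero] at key
    exact le_antisymm key zero_le

lemma Prof.lintegral_cKer_sub_le {φ : En n → ℂ} {b G : ℝ} (h : Prof φ b G) (hG : 0 ≤ G)
    (s : ℤ) {q : ℤ} {y y' : En n} (hy : dyGen q y = dyGen q y') :
    ∫⁻ x, ‖cKer φ s x y - cKer φ s x y'‖ₑ ≤ ENNReal.ofReal (2 * (b * 2 ^ n)) ∧
    ∫⁻ x, ‖cKer φ s x y - cKer φ s x y'‖ₑ ≤
      ENNReal.ofReal (2 * (G * n * 2 ^ n) * 2 ^ (s - q)) := by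
  have hb := h.b_nonneg
  have hm : ∀ y, Measurable fun x => cKer φ s x y := fun y => (h.niceKer s).meas.of_uncurry_right
  constructor
  · rw [two_mul, ENNReal.ofReal_add (by positivity) (by positivity)]
    refine le_trans ?_ (add_le_add (h.lintegral_cKer_le_right s y)
      (h.lintegral_cKer_le_right s y'))
    rw [← lintegral_add_left (hm y).enorm]
    exact lintegral_mono fun x => enorm_sub_le
  · have h2 : (0 : ℝ) < 2 ^ s := by positivity
    set d : En n → ℂ := fun x => cKer φ s x y - cKer φ s x y' with hd
    set r : ℝ := ((2 : ℝ) ^ s)⁻¹ with hr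
    have hr0 : 0 ≤ r := by positivity
    set c : ℝ := ((2 : ℝ) ^ s) ^ n * (G * n * 2 ^ (s - q)) with hc
    have hc0 : 0 ≤ c := by positivity
    have hdc : ∀ x, ‖d x‖ ≤ c := fun x => by
      refine (h.cKer_sub_norm_le s x y y').trans ?_
      have := norm_sub_le_of_dyGen hy
      rw [hc, zpow_sub₀ two_ne_zero]
      calc ((2 : ℝ) ^ s) ^ n * (G * (2 ^ s * ‖y - y'‖))
          ≤ ((2 : ℝ) ^ s) ^ n * (G * (2 ^ s * (n * ((2 : ℝ) ^ q)⁻¹))) := by gcongr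
        _ = _ := by ring
    have hloc : ∀ z : En n, ∫⁻ x, ‖({x | ‖z - x‖ ≤ r} : Set (En n)).indicator d x‖ₑ ≤
        ENNReal.ofReal (G * n * 2 ^ n * 2 ^ (s - q)) := fun z => by
      have e : c * (2 * r) ^ n = G * n * 2 ^ n * 2 ^ (s - q) := by
        rw [hc, mul_pow, hr, inv_pow]
        field_simp
      rw [← e]
      refine lintegral_enorm_le_of_local (x := z) hc0 hr0 (fun x => ?_) fun x hx => ?_
      · exact (norm_indicator_le_norm_self _ _).trans (hdc x)
      · have hx' : x ∉ {x | ‖z - x‖ ≤ r} := not_le.2 hx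
        exact Set.indicator_of_notMem hx' _
    have hmeas : Measurable (({x | ‖y - x‖ ≤ r} : Set (En n)).indicator d) :=
      ((hm y).sub (hm y')).indicator (measurableSet_le (by fun_prop) measurable_const)
    have e2 : 2 * (G * n * 2 ^ n) * (2 : ℝ) ^ (s - q) =
      G * n * 2 ^ n * 2 ^ (s - q) + G * n * 2 ^ n * 2 ^ (s - q) := by ring
    rw [e2, ENNReal.ofReal_add (by positivity) (by positivity)]
    refine le_trans ?_ (add_le_add (hloc y) (hloc y'))
    rw [← lintegral_add_left hmeas.enorm]
    refine lintegral_mono fun x => ?_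
    by_cases hx : ‖y - x‖ ≤ r
    · rw [Set.indicator_of_mem (show x ∈ {x | ‖y - x‖ ≤ r} from hx)]
      exact le_add_right le_rfl
    by_cases hx' : ‖y' - x‖ ≤ r
    · rw [Set.indicator_of_mem (show x ∈ {x | ‖y' - x‖ ≤ r} from hx')]
      exact le_add_left le_rfl
    · rw [norm_sub_rev] at hx hx'
      rw [h.cKer_eq_zero (not_le.1 hx), h.cKer_eq_zero (not_le.1 hx')]
      simp

lemma Prof.cKer_eq_zero_of_notMem_star {φ : En n → ℂ} {b G : ℝ} (h : Prof φ b G) {s q : ℤ}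
    (hq : q ≤ s) {x y z : En n} (hy : dyGen q y = dyGen q z) (hx : x ∉ dyStar q z) :
    cKer φ s x y = 0 := by
  refine h.cKer_eq_zero (not_le.1 fun hle => hx (mem_dyStar_of_norm_sub_le hy (hle.trans ?_)))
  exact inv_anti₀ (by positivity) (zpow_le_zpow_right₀ one_le_two hq)

lemma Prof.horm_cKer {φ : En n → ℂ} {b G : ℝ} (h : Prof φ b G) (hG : 0 ≤ G) (s : ℤ) (m : ℕ) :
    Horm (cKer φ s) s m (2 * (b * 2 ^ n)) (2 * (G * n * 2 ^ n)) := by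
  intro q y y' hy
  obtain ⟨h1, h2⟩ := h.lintegral_cKer_sub_le hG s hy
  refine ⟨(setLIntegral_le_lintegral _ _).trans h1, (setLIntegral_le_lintegral _ _).trans h2,
    fun hq => ?_⟩
  rw [setLIntegral_congr_fun (measurableSet_dyStar q y).compl (g := fun _ => 0)]
  · simp
  · intro x hx
    simp only
    rw [h.cKer_eq_zero_of_notMem_star (by omega) rfl hx,
      h.cKer_eq_zero_of_notMem_star (by omega) hy.symm hx]
    simp

lemma Prof.horm_cKer_swap {φ : En n → ℂ} {b G : ℝ} (h : Prof φ b G) (hG : 0 ≤ G) (s : ℤ)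
    (m : ℕ) :
    Horm (fun x y => cKer φ s y x) s m (2 * (b * 2 ^ n)) (2 * (G * n * 2 ^ n)) := by
  rw [show (fun x y => cKer φ s y x) = cKer (fun t => φ (-t)) s from
      funext fun x => funext fun y => cKer_swap φ s x y]
  exact h.neg.horm_cKer hG s m

lemma integrable_eKer_mul_cKer {φ : En n → ℂ} {b G : ℝ} (h : Prof φ b G) (k s : ℤ) (x y : En n) :
    Integrable fun z => eKer k x z * cKer φ s z y := by
  simp only [cKer_swap φ s y]
  exact (niceKer_eKer k).integrable_mul ((h.neg.niceKer s).niceFun_left y) x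

lemma Prof.horm_kComp {φ : En n → ℂ} {b G : ℝ} (h : Prof φ b G) (hG : 0 ≤ G) {k s : ℤ} {m : ℕ}
    (hks : s ≤ k + m) :
    Horm (kComp (eKer k) (cKer φ s)) s m (2 * (b * 2 ^ n)) (2 * (G * n * 2 ^ n)) := by
  intro q y y' hy
  obtain ⟨h1, h2⟩ := h.lintegral_cKer_sub_le hG s hy
  have he := niceKer_eKer (n := n) k
  have hm : ∀ y, Measurable fun x => cKer φ s x y := fun y => (h.niceKer s).meas.of_uncurry_right
  have key : ∫⁻ x, ‖kComp (eKer k) (cKer φ s) x y - kComp (eKer k) (cKer φ s) x y'‖ₑ ≤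
      ∫⁻ x, ‖cKer φ s x y - cKer φ s x y'‖ₑ := by
    calc ∫⁻ x, ‖kComp (eKer k) (cKer φ s) x y - kComp (eKer k) (cKer φ s) x y'‖ₑ
        ≤ ∫⁻ x, ∫⁻ z, ‖eKer k z x‖ₑ * ‖cKer φ s z y - cKer φ s z y'‖ₑ := by
          refine lintegral_mono fun x => ?_
          simp only [kComp]
          rw [← integral_sub (integrable_eKer_mul_cKer h k s x y)
            (integrable_eKer_mul_cKer h k s x y')]
          refine (enorm_integral_le_lintegral_enorm _).trans (le_of_eq ?_)
          refine lintegral_congr fun z => ?_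
          rw [← mul_sub, enorm_mul, eKer_comm]
      _ = ∫⁻ z, ∫⁻ x, ‖eKer k z x‖ₑ * ‖cKer φ s z y - cKer φ s z y'‖ₑ :=
          lintegral_lintegral_swap (((he.meas.comp measurable_swap).enorm.mul
            (((hm y).sub (hm y')).comp measurable_snd).enorm).aemeasurable)
      _ = ∫⁻ x, ‖cKer φ s x y - cKer φ s x y'‖ₑ := by
          refine lintegral_congr fun z => ?_
          rw [lintegral_mul_const _ he.meas.of_uncurry_left.enorm, lintegral_eKer, one_mul]
  refine ⟨(setLIntegral_le_lintegral _ _).trans (key.trans h1),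
    (setLIntegral_le_lintegral _ _).trans (key.trans h2), fun hq => ?_⟩
  have hz : ∀ w, dyGen q w = dyGen q y → ∀ x ∉ dyStar q y, kComp (eKer k) (cKer φ s) x w = 0 := by
    intro w hw x hx
    rw [kComp]
    refine integral_eq_zero_of_ae (Eventually.of_forall fun z => ?_)
    simp only [Pi.zero_apply]
    by_cases hxz : dyGen k x = dyGen k z
    · rw [h.cKer_eq_zero_of_notMem_star (z := y) (q := q) (by omega) hw fun hz =>
        hx (dyStar_of_dyGen_eq (by omega) hxz hz), mul_zero]
    · simp [eKer, hxz]
  rw [setLIntegral_congr_fun (measurableSet_dyStar q y).compl (g := fun _ => 0)]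
  · simp
  · intro x hx
    simp only
    rw [hz y rfl x hx, hz y' hy.symm x hx]
    simp

lemma Prof.lintegral_kComp_sub_cKer_le {φ : En n → ℂ} {b G : ℝ} (h : Prof φ b G) {k s q : ℤ}
    (hqk : q ≤ k) {y : En n} {B : ℝ≥0∞}
    (hB : ∀ z, dyGen q z = dyGen q y → ∫⁻ x, ‖cKer φ s z x - cKer φ s y x‖ₑ ≤ B) :
    ∫⁻ x, ‖kComp (eKer k) (cKer φ s) y x - cKer φ s y x‖ₑ ≤ B := by
  have he := niceKer_eKer (n := n) k
  have hκ := h.niceKer s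
  calc ∫⁻ x, ‖kComp (eKer k) (cKer φ s) y x - cKer φ s y x‖ₑ
      ≤ ∫⁻ x, ∫⁻ z, ‖eKer k y z‖ₑ * ‖cKer φ s z x - cKer φ s y x‖ₑ := by
        refine lintegral_mono fun x => ?_
        have e : kComp (eKer k) (cKer φ s) y x - cKer φ s y x =
            ∫ z, eKer k y z * (cKer φ s z x - cKer φ s y x) := by
          simp only [mul_sub]
          rw [integral_sub (integrable_eKer_mul_cKer h k s y x)
            ((he.integrable_left y).mul_const _), integral_mul_const, integral_eKer, one_mul]
          rfl
        rw [e]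
        refine (enorm_integral_le_lintegral_enorm _).trans (le_of_eq ?_)
        simp only [enorm_mul]
    _ = ∫⁻ z, ∫⁻ x, ‖eKer k y z‖ₑ * ‖cKer φ s z x - cKer φ s y x‖ₑ := by
        refine lintegral_lintegral_swap (Measurable.aemeasurable ?_)
        exact ((he.meas.of_uncurry_left (x := y)).comp measurable_snd).enorm.mul
          (((hκ.meas.comp measurable_swap).sub
            ((hκ.meas.of_uncurry_left (x := y)).comp measurable_fst)).enorm)
    _ ≤ ∫⁻ z, ‖eKer k y z‖ₑ * B := by
        refine lintegral_mono fun z => ?_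
        rw [lintegral_const_mul _ (f := fun x => ‖cKer φ s z x - cKer φ s y x‖ₑ)
          (hκ.meas.of_uncurry_left.sub hκ.meas.of_uncurry_left).enorm]
        by_cases hz : dyGen k y = dyGen k z
        · gcongr
          exact hB z (dyGen_mono hqk hz).symm
        · simp [eKer, hz]
    _ = B := by
        rw [lintegral_mul_const _ he.meas.of_uncurry_left.enorm, lintegral_eKer, one_mul]

lemma Prof.horm_kComp_swap {φ : En n → ℂ} {b G : ℝ} (h : Prof φ b G) (hG : 0 ≤ G) (k s : ℤ)
    (m : ℕ) :
    Horm (fun x y => kComp (eKer k) (cKer φ s) y x) s m (6 * (b * 2 ^ n))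
      (6 * (G * n * 2 ^ n)) := by
  intro q y y' hy
  have hb := h.b_nonneg
  have he := niceKer_eKer (n := n) k
  have hκ := h.niceKer s
  have hK := he.comp hκ
  rcases le_or_gt k q with hkq | hkq
  · have : ∀ x, kComp (eKer k) (cKer φ s) y x - kComp (eKer k) (cKer φ s) y' x = 0 := fun x => by
      simp only [kComp, eKer_congr (dyGen_mono hkq hy), sub_self]
    simp [this]
  have hB : ∀ z w, dyGen q z = dyGen q w →
      ∫⁻ x, ‖cKer φ s z x - cKer φ s w x‖ₑ ≤ ENNReal.ofReal (2 * (b * 2 ^ n)) ∧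
      ∫⁻ x, ‖cKer φ s z x - cKer φ s w x‖ₑ ≤
        ENNReal.ofReal (2 * (G * n * 2 ^ n) * 2 ^ (s - q)) := fun z w hzw => by
    simpa only [← cKer_swap φ s] using h.neg.lintegral_cKer_sub_le hG s hzw
  have key : ∀ B : ℝ≥0∞, (∀ z w, dyGen q z = dyGen q w →
      ∫⁻ x, ‖cKer φ s z x - cKer φ s w x‖ₑ ≤ B) →
      ∫⁻ x in (dyStar q y)ᶜ,
        ‖kComp (eKer k) (cKer φ s) y x - kComp (eKer k) (cKer φ s) y' x‖ₑ ≤ B + (B + B) := by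
    intro B hB
    refine (setLIntegral_le_lintegral _ _).trans ?_
    have a1 := h.lintegral_kComp_sub_cKer_le hkq.le (y := y) fun z hz => hB z y hz
    have a2 := h.lintegral_kComp_sub_cKer_le hkq.le (y := y') fun z hz => hB z y' hz
    refine le_trans ?_ (add_le_add a1 (add_le_add (hB y y' hy) a2))
    rw [← lintegral_add_left (f := fun x => ‖cKer φ s y x - cKer φ s y' x‖ₑ)
        (hκ.meas.of_uncurry_left.sub hκ.meas.of_uncurry_left).enorm,
      ← lintegral_add_left (f := fun x => ‖kComp (eKer k) (cKer φ s) y x - cKer φ s y x‖ₑ)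
        (hK.meas.of_uncurry_left.sub hκ.meas.of_uncurry_left).enorm]
    refine lintegral_mono fun x => ?_
    set u := kComp (eKer k) (cKer φ s) y x
    set v := kComp (eKer k) (cKer φ s) y' x
    calc ‖u - v‖ₑ = ‖(u - cKer φ s y x) + ((cKer φ s y x - cKer φ s y' x) -
          (v - cKer φ s y' x))‖ₑ := by congr 1; ring
      _ ≤ _ := (enorm_add_le _ _).trans (add_le_add le_rfl enorm_sub_le)
  have e3 : ∀ t : ℝ, 0 ≤ t → ENNReal.ofReal t + (ENNReal.ofReal t + ENNReal.ofReal t) =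
      ENNReal.ofReal (3 * t) := fun t ht => by
    rw [← ENNReal.ofReal_add ht ht, ← ENNReal.ofReal_add ht (by positivity)]
    congr 1; ring
  refine ⟨?_, ?_, fun hq => ?_⟩
  · refine (key _ fun z w hzw => (hB z w hzw).1).trans (le_of_eq ?_)
    rw [e3 _ (by positivity)]
    congr 1; ring
  · refine (key _ fun z w hzw => (hB z w hzw).2).trans (le_of_eq ?_)
    rw [e3 _ (by positivity)]
    congr 1; ring
  · have hz : ∀ w, dyGen q w = dyGen q y → ∀ x ∉ dyStar q y,
        kComp (eKer k) (cKer φ s) w x = 0 := by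
      intro w hw x hx
      rw [kComp]
      refine integral_eq_zero_of_ae (Eventually.of_forall fun z => ?_)
      simp only [Pi.zero_apply]
      by_cases hwz : dyGen k w = dyGen k z
      · rw [cKer_swap φ s x z, h.neg.cKer_eq_zero_of_notMem_star (z := y) (q := q) (by omega)
          ((dyGen_mono hkq.le hwz).symm.trans hw) hx, mul_zero]
      · simp [eKer, hwz]
    rw [setLIntegral_congr_fun (measurableSet_dyStar q y).compl (g := fun _ => 0)]
    · simp
    · intro x hx
      simp only
      rw [hz y rfl x hx, hz y' hy.symm x hx]
      simp

lemma Horm.mono {U : En n → En n → ℂ} {s : ℤ} {m m' : ℕ} {A G A' G' : ℝ} (h : Horm U s m A G)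
    (hm : m ≤ m') (hA : A ≤ A') (hG : G ≤ G') : Horm U s m' A' G' := by
  intro q y y' hy
  obtain ⟨h1, h2, h3⟩ := h q y y' hy
  refine ⟨h1.trans (ENNReal.ofReal_le_ofReal hA), h2.trans (ENNReal.ofReal_le_ofReal ?_),
    fun hq => h3 (by omega)⟩
  gcongr

end HormanderCondition

section MartingaleJumps

variable {n : ℕ}

/-- Greedy stopping: the number of stops before time `r` and the value at the last stop. -/
def greedy (μ : ℝ) (b : ℕ → ℂ) : ℕ → ℕ × ℂ
  | 0 => (0, b 0)
  | r + 1 => if μ < ‖b (r + 1) - (greedy μ b r).2‖ then ((greedy μ b r).1 + 1, b (r + 1))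
      else greedy μ b r

lemma greedy_norm_le {μ : ℝ} (hμ : 0 ≤ μ) (b : ℕ → ℂ) (r : ℕ) :
    ‖b r - (greedy μ b r).2‖ ≤ μ := by
  cases r with
  | zero => simpa [greedy] using hμ
  | succ r =>
    rw [greedy]
    split_ifs with h
    · simpa using hμ
    · exact not_lt.1 h

lemma greedy_fst_mono (μ : ℝ) (b : ℕ → ℂ) : Monotone fun r => (greedy μ b r).1 := by
  refine monotone_nat_of_le_succ fun r => ?_
  rw [greedy]
  split_ifs
  · exact Nat.le_succ _
  · exact le_rfl

lemma greedy_fst_le (μ : ℝ) (b : ℕ → ℂ) (r : ℕ) : (greedy μ b r).1 ≤ r := by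
  induction r with
  | zero => simp [greedy]
  | succ r ih =>
    rw [greedy]
    split_ifs
    · exact Nat.succ_le_succ ih
    · omega

lemma greedy_snd_eq {μ : ℝ} {b : ℕ → ℂ} {s t : ℕ} (hst : s ≤ t)
    (h : (greedy μ b s).1 = (greedy μ b t).1) : (greedy μ b s).2 = (greedy μ b t).2 := by
  induction t, hst using Nat.le_induction with
  | base => rfl
  | succ t hst ih =>
    have h1 : (greedy μ b s).1 ≤ (greedy μ b t).1 := greedy_fst_mono μ b hst
    rw [greedy] at h ⊢
    split_ifs at h ⊢ with h2
    · simp only at h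
      omega
    · exact ih h

lemma greedy_lt_of_jump {μ : ℝ} (hμ : 0 ≤ μ) {b : ℕ → ℂ} {s t : ℕ} (hst : s ≤ t)
    (h : 2 * μ < ‖b t - b s‖) : (greedy μ b s).1 < (greedy μ b t).1 := by
  refine lt_of_le_of_ne (greedy_fst_mono μ b hst) fun he => absurd h (not_lt.2 ?_)
  have h1 := greedy_norm_le hμ b s
  have h2 := greedy_norm_le hμ b t
  rw [greedy_snd_eq hst he] at h1
  calc ‖b t - b s‖ = ‖(b t - (greedy μ b t).2) - (b s - (greedy μ b t).2)‖ := by congr 1; ring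
    _ ≤ _ := norm_sub_le _ _
    _ ≤ 2 * μ := by linarith

/-- The increments of `b` accumulated between consecutive greedy stops. -/
def greedyInc (μ : ℝ) (b : ℕ → ℂ) (R j : ℕ) : ℂ :=
  ∑ r ∈ Finset.range R, (if (greedy μ b r).1 = j then 1 else 0) * (b (r + 1) - b r)

lemma greedyInc_spec (μ : ℝ) (b : ℕ → ℂ) (R : ℕ) :
    (∀ j < (greedy μ b R).1, μ < ‖greedyInc μ b R j‖) ∧
    greedyInc μ b R (greedy μ b R).1 = b R - (greedy μ b R).2 ∧
    ∀ j, (greedy μ b R).1 < j → greedyInc μ b R j = 0 := by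
  induction R with
  | zero => simp [greedy, greedyInc]
  | succ R ih =>
    obtain ⟨h1, h2, h3⟩ := ih
    have hs : ∀ j, greedyInc μ b (R + 1) j = greedyInc μ b R j +
        (if (greedy μ b R).1 = j then 1 else 0) * (b (R + 1) - b R) := fun j =>
      Finset.sum_range_succ _ _
    have hc : greedyInc μ b (R + 1) (greedy μ b R).1 = b (R + 1) - (greedy μ b R).2 := by
      rw [hs, h2, if_pos rfl]
      ring
    rw [greedy]
    split_ifs with h
    · refine ⟨fun j hj => ?_, ?_, fun j hj => ?_⟩
      · rcases (Nat.lt_succ_iff_lt_or_eq.1 hj) with hj | rfl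
        · rw [hs, if_neg (by omega), zero_mul, add_zero]
          exact h1 j hj
        · rwa [hc]
      · simp only
        rw [hs, if_neg (by omega), h3 _ (Nat.lt_succ_self _)]
        simp
      · simp only at hj
        rw [hs, if_neg (by omega), h3 _ (by omega)]
        simp
    · refine ⟨fun j hj => ?_, hc, fun j hj => ?_⟩
      · rw [hs, if_neg (by omega), zero_mul, add_zero]
        exact h1 j hj
      · rw [hs, if_neg (by omega), h3 _ hj]
        simp

lemma greedy_count_le {μ : ℝ} (hμ : 0 ≤ μ) (b : ℕ → ℂ) (R : ℕ) :
    (greedy μ b R).1 * μ ^ 2 ≤ ∑ j : Fin (R + 1), ‖greedyInc μ b R j‖ ^ 2 := by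
  rw [Fin.sum_univ_eq_sum_range (fun j => ‖greedyInc μ b R j‖ ^ 2)]
  have hle := greedy_fst_le μ b R
  calc (greedy μ b R).1 * μ ^ 2 = ∑ j ∈ Finset.range (greedy μ b R).1, μ ^ 2 := by simp
    _ ≤ ∑ j ∈ Finset.range (greedy μ b R).1, ‖greedyInc μ b R j‖ ^ 2 := by
        refine Finset.sum_le_sum fun j hj => ?_
        have := (greedyInc_spec μ b R).1 j (Finset.mem_range.1 hj)
        gcongr
    _ ≤ _ := Finset.sum_le_sum_of_subset_of_nonneg
        (Finset.range_subset_range.2 (by omega)) fun _ _ _ => by positivity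

/-- Jumps of a sequence on `[-M, M]` are controlled by the greedy increments. -/
lemma jumpCount_le_greedy {lam : ℝ} (hlam : 0 < lam) (M : ℕ) (a : ℤ → ℂ) :
    ENNReal.ofReal (lam ^ 2) * jumpCount lam (Set.Icc (-(M : ℤ)) M) a ≤
      ENNReal.ofReal (4 * ∑ j : Fin (2 * M + 1),
        ‖greedyInc (lam / 2) (fun r => a ((r : ℤ) - M)) (2 * M) j‖ ^ 2) := by
  set b : ℕ → ℂ := fun r => a ((r : ℤ) - M) with hb
  have h0 := greedy_count_le (half_pos hlam).le b (2 * M)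
  have hN : jumpCount lam (Set.Icc (-(M : ℤ)) M) a ≤ ((greedy (lam / 2) b (2 * M)).1 : ℝ≥0∞) := by
    simp only [jumpCount, iSup_le_iff]
    intro N s t hs ht hst hts hj
    have hab : ∀ k ∈ Set.Icc (-(M : ℤ)) M, a k = b (k + M).toNat := fun k hk => by
      simp only [hb]
      congr 1
      have := hk.1
      omega
    have hlt : ∀ i, (greedy (lam / 2) b (s i + M).toNat).1 <
        (greedy (lam / 2) b (t i + M).toNat).1 := fun i => by
      refine greedy_lt_of_jump (half_pos hlam).le ?_ ?_
      · have := hst i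
        omega
      · rw [← hab _ (hs i), ← hab _ (ht i)]
        linarith [hj i]
    have hcount : ∀ k (hk : k < N), k < (greedy (lam / 2) b (t ⟨k, hk⟩ + M).toNat).1 := by
      intro k
      induction k with
      | zero => exact fun hk => lt_of_le_of_lt (Nat.zero_le _) (hlt ⟨0, hk⟩)
      | succ k ih =>
        intro hk
        have h1 := ih (by omega)
        have h2 := hts ⟨k, by omega⟩ ⟨k + 1, hk⟩ (by simp)
        have h3 := hlt ⟨k + 1, hk⟩
        have h4 : (greedy (lam / 2) b (t ⟨k, by omega⟩ + M).toNat).1 ≤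
            (greedy (lam / 2) b (s ⟨k + 1, hk⟩ + M).toNat).1 := greedy_fst_mono _ _ (by omega)
        omega
    rcases Nat.eq_zero_or_pos N with rfl | hpos
    · simp
    have h1 := hcount (N - 1) (by omega)
    have h2 : (greedy (lam / 2) b (t ⟨N - 1, by omega⟩ + M).toNat).1 ≤
        (greedy (lam / 2) b (2 * M)).1 := greedy_fst_mono _ _ (by
      have := (ht ⟨N - 1, by omega⟩).2
      omega)
    exact_mod_cast (by omega : N ≤ (greedy (lam / 2) b (2 * M)).1)
  calc _ ≤ ENNReal.ofReal (lam ^ 2) * ((greedy (lam / 2) b (2 * M)).1 : ℝ≥0∞) := by gcongr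
    _ = ENNReal.ofReal (4 * ((greedy (lam / 2) b (2 * M)).1 * (lam / 2) ^ 2)) := by
        rw [← ENNReal.ofReal_natCast, ← ENNReal.ofReal_mul (by positivity)]
        congr 1; ring
    _ ≤ _ := by gcongr

lemma integral_mul_conj_eq_zero {l : ℤ} {h d : En n → ℂ} (hh : NiceFun h) (hd : NiceFun d)
    (hc : ∀ x y, dyGen l x = dyGen l y → h x = h y) (h0 : eOp l d = fun _ => 0) :
    ∫ x, h x * (starRingEnd ℂ) (d x) = 0 := by
  rw [← eOp_of_const hc, eOp_adjoint hh hd.conj, eOp_conj, h0]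
  simp

lemma eOp_succ_sub {l : ℤ} {f : En n → ℂ} (hf : NiceFun f) :
    eOp l (fun x => eOp (l + 1) f x - eOp l f x) = fun _ => 0 := by
  rw [eOp_sub l (hf.eOp _) (hf.eOp _), eOp_eOp_of_ge (by omega) hf, eOp_eOp_of_ge le_rfl hf]
  simp

lemma N2_eOp_le (l : ℤ) {f : En n → ℂ} (hf : NiceFun f) : N2 (eOp l f) ≤ N2 f := by
  have h := N2_add_sq (hf.eOp l) (hf.sub (hf.eOp l)) (integral_mul_conj_eq_zero (l := l)
    (hf.eOp l) (hf.sub (hf.eOp l)) (fun x y hxy => eOp_congr hxy f) (by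
      rw [eOp_sub l hf (hf.eOp _), eOp_eOp_of_ge le_rfl hf]; simp))
  simp only [add_sub_cancel] at h
  refine le_of_sq_le_sq ?_ (N2_nonneg _)
  rw [h]
  exact le_add_of_nonneg_right (sq_nonneg _)

lemma N2_mono {f g : En n → ℂ} (hg : NiceFun g) (h : ∀ x, ‖f x‖ ≤ ‖g x‖) : N2 f ≤ N2 g :=
  ENNReal.toReal_mono (hg.memLp (by norm_num)).2.ne (eLpNorm_mono h)

/-- Predictable martingale transforms are contractions on `L²`. -/
lemma N2_transform_le (M : ℕ) {v : ℕ → En n → ℂ} (hv : ∀ r, Measurable (v r))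
    (hv1 : ∀ r x, ‖v r x‖ ≤ 1)
    (hvc : ∀ (r : ℕ) x y, dyGen ((r : ℤ) - M) x = dyGen ((r : ℤ) - M) y → v r x = v r y)
    {f : En n → ℂ} (hf : NiceFun f) (R : ℕ) :
    N2 (fun x => ∑ r ∈ Finset.range R,
      v r x * (eOp ((r : ℤ) - M + 1) f x - eOp ((r : ℤ) - M) f x)) ≤ N2 f := by
  have hv1' : ∀ r x, ‖v r x‖ₑ ≤ (1 : ℝ≥0) := fun r x => by
    rw [enorm_le_coe, ← NNReal.coe_le_coe]
    exact hv1 r x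
  have hd : ∀ r : ℕ, NiceFun fun x => eOp ((r : ℤ) - M + 1) f x - eOp ((r : ℤ) - M) f x :=
    fun r => (hf.eOp _).sub (hf.eOp _)
  have hvd : ∀ r : ℕ, NiceFun fun x =>
      v r x * (eOp ((r : ℤ) - M + 1) f x - eOp ((r : ℤ) - M) f x) :=
    fun r => (hd r).mul_bdd (hv r) (hv1' r)
  suffices H : N2 (fun x => ∑ r ∈ Finset.range R,
      v r x * (eOp ((r : ℤ) - M + 1) f x - eOp ((r : ℤ) - M) f x)) ^ 2 ≤
      N2 (eOp ((R : ℤ) - M) f) ^ 2 from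
    (le_of_sq_le_sq H (N2_nonneg _)).trans (N2_eOp_le _ hf)
  induction R with
  | zero =>
    simp only [Finset.range_zero, Finset.sum_empty]
    have : N2 (fun _ : En n => (0 : ℂ)) = 0 := by simp [N2]
    rw [this]
    nlinarith [sq_nonneg (N2 (eOp (((0 : ℕ) : ℤ) - M) f))]
  | succ R ih =>
    simp only [Finset.sum_range_succ]
    have hS : NiceFun (fun x => ∑ r ∈ Finset.range R,
        v r x * (eOp ((r : ℤ) - M + 1) f x - eOp ((r : ℤ) - M) f x)) :=
      NiceFun.sum fun r _ => hvd r
    set S : En n → ℂ := fun x => ∑ r ∈ Finset.range R,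
        v r x * (eOp ((r : ℤ) - M + 1) f x - eOp ((r : ℤ) - M) f x) with hSdef
    have hSc : ∀ x y, dyGen ((R : ℤ) - M) x = dyGen ((R : ℤ) - M) y → S x = S y := fun x y hxy => by
      refine Finset.sum_congr rfl fun r hr => ?_
      have hr := Finset.mem_range.1 hr
      rw [hvc r x y (dyGen_mono (by omega) hxy), eOp_congr (dyGen_mono (by omega) hxy),
        eOp_congr (dyGen_mono (by omega : (r : ℤ) - M ≤ (R : ℤ) - M) hxy)]
    have horth : ∫ x, S x * (starRingEnd ℂ)
        (v R x * (eOp ((R : ℤ) - M + 1) f x - eOp ((R : ℤ) - M) f x)) = 0 := by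
      have hw : Measurable fun x => (starRingEnd ℂ) (v R x) :=
        Complex.continuous_conj.measurable.comp (hv R)
      have := integral_mul_conj_eq_zero (l := (R : ℤ) - M)
        (hS.mul_bdd hw (C := 1) fun x => by simpa using hv1' R x) (hd R)
        (fun x y hxy => by rw [hvc R x y hxy, hSc x y hxy]) (eOp_succ_sub hf)
      rw [← this]
      refine integral_congr_ae (Eventually.of_forall fun x => ?_)
      simp only [map_mul]
      ring
    rw [N2_add_sq hS (hvd R) horth]
    have hE := N2_add_sq (hf.eOp ((R : ℤ) - M)) (hd R) (integral_mul_conj_eq_zero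
      (hf.eOp _) (hd R) (fun x y hxy => eOp_congr hxy f) (eOp_succ_sub hf))
    simp only [add_sub_cancel] at hE
    have e : ((R + 1 : ℕ) : ℤ) - M = (R : ℤ) - M + 1 := by push_cast; ring
    have hle : N2 (fun x => v R x * (eOp ((R : ℤ) - M + 1) f x - eOp ((R : ℤ) - M) f x)) ≤
        N2 fun x => eOp ((R : ℤ) - M + 1) f x - eOp ((R : ℤ) - M) f x :=
      N2_mono (hd R) fun x => by
        rw [norm_mul]
        exact mul_le_of_le_one_left (norm_nonneg _) (hv1 R x)
    rw [e, show N2 (eOp ((R : ℤ) - M + 1) f) = N2 fun x => eOp ((R : ℤ) - M + 1) f x from rfl, hE]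
    have := N2_nonneg (fun x => v R x * (eOp ((R : ℤ) - M + 1) f x - eOp ((R : ℤ) - M) f x))
    gcongr

/-- The kernel which sums martingale differences between consecutive greedy stops. -/
def greedyKer (μ : ℝ) (g : En n → ℂ) (M j : ℕ) (x y : En n) : ℂ :=
  ∑ r ∈ Finset.range (2 * M),
    (if (greedy μ (fun r : ℕ => eOp ((r : ℤ) - M) g x) r).1 = j then 1 else 0) *
      (eKer ((r : ℤ) - M + 1) x y - eKer ((r : ℤ) - M) x y)

lemma measurable_greedy (μ : ℝ) {g : En n → ℂ} (hg : NiceFun g) (M r : ℕ) :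
    Measurable fun x => greedy μ (fun r : ℕ => eOp ((r : ℤ) - M) g x) r := by
  induction r with
  | zero =>
    simp only [greedy]
    exact measurable_const.prodMk (hg.eOp _).meas
  | succ r ih =>
    simp only [greedy]
    refine Measurable.ite (measurableSet_lt measurable_const
      ((hg.eOp _).meas.sub ih.snd).norm) ?_ ih
    exact (ih.fst.add measurable_const).prodMk (hg.eOp _).meas

lemma greedy_congr (μ : ℝ) (g : En n → ℂ) (M r : ℕ) {x y : En n}
    (h : dyGen ((r : ℤ) - M) x = dyGen ((r : ℤ) - M) y) :
    greedy μ (fun r : ℕ => eOp ((r : ℤ) - M) g x) r =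
      greedy μ (fun r : ℕ => eOp ((r : ℤ) - M) g y) r := by
  induction r with
  | zero => simp only [greedy, eOp_congr h]
  | succ r ih => simp only [greedy, eOp_congr h, ih (dyGen_mono (by push_cast; omega) h)]

lemma measurable_greedy_ite (μ : ℝ) {g : En n → ℂ} (hg : NiceFun g) (M r j : ℕ) :
    Measurable fun x => if (greedy μ (fun r : ℕ => eOp ((r : ℤ) - M) g x) r).1 = j
      then (1 : ℂ) else 0 :=
  Measurable.ite (measurableSet_eq_fun (measurable_greedy μ hg M r).fst measurable_const)
    measurable_const measurable_const

lemma niceKer_greedyKer (μ : ℝ) {g : En n → ℂ} (hg : NiceFun g) (M j : ℕ) :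
    NiceKer (greedyKer μ g M j) :=
  NiceKer.sum fun r _ => ((niceKer_eKer _).sub (niceKer_eKer _)).mul_bdd
    (measurable_greedy_ite μ hg M r j) (C := 1) fun x => by split_ifs <;> simp

lemma kOp_greedyKer (μ : ℝ) {g f : En n → ℂ} (hg : NiceFun g) (hf : NiceFun f) (M j : ℕ)
    (x : En n) :
    kOp (greedyKer μ g M j) f x = ∑ r ∈ Finset.range (2 * M),
      (if (greedy μ (fun r : ℕ => eOp ((r : ℤ) - M) g x) r).1 = j then 1 else 0) *
        (eOp ((r : ℤ) - M + 1) f x - eOp ((r : ℤ) - M) f x) := by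
  unfold greedyKer
  rw [kOp_sum_left (fun r _ => ((niceKer_eKer _).sub (niceKer_eKer _)).mul_bdd
    (measurable_greedy_ite μ hg M r j) (C := 1) fun x => by split_ifs <;> simp) hf]
  refine Finset.sum_congr rfl fun r _ => ?_
  rw [kOp_mul_left (fun x => if (greedy μ (fun r : ℕ => eOp ((r : ℤ) - M) g x) r).1 = j
    then 1 else 0), kOp_sub_left (niceKer_eKer _) (niceKer_eKer _) hf]
  rfl

lemma dyGen_ne_of_notMem_dyStar {q k : ℤ} (hqk : q ≤ k) {x y z : En n} (hx : x ∉ dyStar q y)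
    (hz : dyGen q z = dyGen q y) : dyGen k x ≠ dyGen k z := fun h =>
  hx (dyCube_subset_dyStar q y ((dyGen_mono hqk h).trans hz))

lemma eKer_sub_congr {q k : ℤ} {x y y' : En n} (hx : x ∉ dyStar q y)
    (hy : dyGen q y = dyGen q y') :
    eKer (k + 1) x y - eKer k x y = eKer (k + 1) x y' - eKer k x y' := by
  rcases le_or_gt q k with hk | hk
  · simp only [eKer]
    rw [if_neg (dyGen_ne_of_notMem_dyStar (by omega) hx rfl),
      if_neg (dyGen_ne_of_notMem_dyStar hk hx rfl),
      if_neg (dyGen_ne_of_notMem_dyStar (by omega) hx hy.symm),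
      if_neg (dyGen_ne_of_notMem_dyStar hk hx hy.symm)]
  · rw [eKer_comm _ x y, eKer_comm _ x y, eKer_comm _ x y', eKer_comm _ x y',
      eKer_congr (dyGen_mono (by omega) hy), eKer_congr (dyGen_mono (by omega : k ≤ q) hy)]

lemma greedyKer_comm (μ : ℝ) (g : En n → ℂ) (M j : ℕ) (x y : En n) :
    greedyKer μ g M j x y = greedyKer μ g M j y x := by
  refine Finset.sum_congr rfl fun r _ => ?_
  by_cases h : dyGen ((r : ℤ) - M) x = dyGen ((r : ℤ) - M) y
  · rw [greedy_congr μ g M r h, eKer_comm _ x y, eKer_comm _ x y]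
  · have h' : ¬ dyGen ((r : ℤ) - M + 1) x = dyGen ((r : ℤ) - M + 1) y := fun h' =>
      h (dyGen_mono (by omega) h')
    simp [eKer, h, h', Ne.symm h, Ne.symm h']

lemma greedyKer_congr (μ : ℝ) (g : En n → ℂ) (M j : ℕ) {q : ℤ} {x y y' : En n}
    (hx : x ∉ dyStar q y) (hy : dyGen q y = dyGen q y') :
    greedyKer μ g M j x y = greedyKer μ g M j x y' :=
  Finset.sum_congr rfl fun r _ => by rw [eKer_sub_congr hx hy]

/-- The jump inequality for dyadic martingales. -/
theorem exists_martingale_jump_bound (hn : 1 ≤ n) {p : ℝ} (hp : 1 < p) :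
    ∃ C : ℝ, 0 < C ∧ ∀ (M : ℕ) (g : En n → ℂ) (lam : ℝ), NiceFun g → 0 < lam →
      ∃ F : En n → ℝ≥0∞, Measurable F ∧
      (∀ x, ENNReal.ofReal lam * (jumpCount lam (Set.Icc (-(M : ℤ)) M) fun k => eOp k g x) ^
        ((1 : ℝ) / 2) ≤ F x) ∧
      ∫⁻ x, F x ^ p ≤ ENNReal.ofReal C ^ p * ∫⁻ x, ‖g x‖ₑ ^ p := by
  obtain ⟨C, θ, hC, hθ0, hθ1, H⟩ := exists_master_bound hn hp
  refine ⟨2 * C, by positivity, fun M g lam hg hlam => ?_⟩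
  set u : Fin (2 * M + 1) → En n → En n → ℂ := fun j => greedyKer (lam / 2) g M j with hu
  have hun : ∀ j, NiceKer (u j) := fun j => niceKer_greedyKer _ hg M j
  have key := H (Fin (2 * M + 1)) u 1 1 hun one_pos le_rfl ?_ ?_ ?_ g hg
  · refine ⟨fun x => 2 * ‖vOp u g x‖ₑ, (measurable_vOp hun hg).enorm.const_mul _, fun x => ?_, ?_⟩
    · have h1 := jumpCount_le_greedy hlam M fun k => eOp k g x
      have h2 : (4 * ∑ j : Fin (2 * M + 1), ‖greedyInc (lam / 2)
          (fun r => eOp ((r : ℤ) - M) g x) (2 * M) j‖ ^ 2) = (2 * ‖vOp u g x‖) ^ 2 := by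
        rw [mul_pow, EuclideanSpace.norm_sq_eq]
        norm_num
        refine Finset.sum_congr rfl fun j _ => ?_
        simp only [vOp, hu, kOp_greedyKer _ hg hg, greedyInc]
        congr 2
        refine Finset.sum_congr rfl fun r _ => ?_
        push_cast
        rw [show (r : ℤ) + 1 - M = r - M + 1 by ring]
      rw [h2] at h1
      have h3 := ENNReal.rpow_le_rpow h1 (by norm_num : (0 : ℝ) ≤ 1 / 2)
      rw [ENNReal.mul_rpow_of_nonneg _ _ (by norm_num), ENNReal.ofReal_rpow_of_nonneg (by positivity)
        (by norm_num), ENNReal.ofReal_rpow_of_nonneg (by positivity) (by norm_num),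
        ← Real.sqrt_eq_rpow, ← Real.sqrt_eq_rpow, Real.sqrt_sq hlam.le,
        Real.sqrt_sq (by positivity)] at h3
      refine h3.trans (le_of_eq ?_)
      rw [ENNReal.ofReal_mul zero_le_two, ofReal_norm, ENNReal.ofReal_ofNat]
    · have e : ∀ x, (2 * ‖vOp u g x‖ₑ) ^ p = (2 : ℝ≥0∞) ^ p * ‖vOp u g x‖ₑ ^ p := fun x =>
        ENNReal.mul_rpow_of_nonneg _ _ (by linarith)
      simp only [e]
      rw [lintegral_const_mul _ ((measurable_vOp hun hg).enorm.pow_const _),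
        ENNReal.ofReal_mul zero_le_two, ENNReal.mul_rpow_of_nonneg _ _ (by linarith : (0:ℝ) ≤ p),
        mul_assoc, ENNReal.ofReal_ofNat]
      simp only [Real.one_rpow, mul_one] at key
      gcongr
  · intro c hc f hf
    rw [one_mul]
    refine le_trans (le_of_eq ?_) (N2_transform_le M
      (v := fun r x => ∑ j : Fin (2 * M + 1), c j *
        if (greedy (lam / 2) (fun r : ℕ => eOp ((r : ℤ) - M) g x) r).1 = j then (1 : ℂ) else 0)
      (fun r => Finset.measurable_sum _ fun j _ =>
        (measurable_greedy_ite _ hg M r j).const_mul _) (fun r x => ?_) (fun r x y hxy => ?_)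
        hf (2 * M))
    · congr 1
      funext x
      simp only [hu, kOp_greedyKer _ hg hf, Finset.mul_sum, Finset.sum_mul]
      rw [Finset.sum_comm]
      refine Finset.sum_congr rfl fun r _ => Finset.sum_congr rfl fun j _ => by ring
    · simp only [mul_ite, mul_one, mul_zero]
      by_cases hj : (greedy (lam / 2) (fun r : ℕ => eOp ((r : ℤ) - M) g x) r).1 < 2 * M + 1
      · rw [Finset.sum_eq_single (⟨_, hj⟩ : Fin (2 * M + 1))]
        · simpa using hc _
        · exact fun j _ hne => if_neg fun h => hne (Fin.ext h.symm)
        · simp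
      · rw [Finset.sum_eq_zero fun j _ => if_neg fun h => hj (by rw [h]; exact j.2)]
        simp
    · simp only [greedy_congr _ g M r hxy]
  · intro q y y' hy
    rw [setLIntegral_congr_fun (measurableSet_dyStar q y).compl (g := fun _ => 0)]
    · simp
    · intro x hx
      refine Finset.sum_eq_zero fun j _ => ?_
      simp only [hu]
      rw [greedyKer_congr _ g M j hx hy]
      simp
  · intro q y y' hy
    rw [setLIntegral_congr_fun (measurableSet_dyStar q y).compl (g := fun _ => 0)]
    · simp
    · intro x hx
      refine Finset.sum_eq_zero fun j _ => ?_
      simp only [hu]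
      rw [greedyKer_comm _ g M j y, greedyKer_comm _ g M j y', greedyKer_congr _ g M j hx hy]
      simp

end MartingaleJumps

section JumpCount

lemma card_le_jumpCount {ι : Type*} [LinearOrder ι] {lam : ℝ} {J : Set ι} {a : ι → ℂ} {N : ℕ}
    {s t : Fin N → ι} (hs : ∀ i, s i ∈ J) (ht : ∀ i, t i ∈ J) (hst : ∀ i, s i < t i)
    (hts : ∀ i j, i < j → t i < s j) (S : Finset (Fin N))
    (hS : ∀ i ∈ S, lam < ‖a (t i) - a (s i)‖) : (S.card : ℝ≥0∞) ≤ jumpCount lam J a := by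
  set e := S.orderEmbOfFin rfl
  unfold jumpCount
  refine le_iSup_of_le S.card <| le_iSup_of_le (s ∘ e) <| le_iSup_of_le (t ∘ e) <|
    le_iSup_of_le (fun i => hs _) <| le_iSup_of_le (fun i => ht _) <|
    le_iSup_of_le (fun i => hst _) <| le_iSup_of_le (fun i j hij => hts _ _ ?_) <|
    le_iSup_of_le (fun i => hS _ (S.orderEmbOfFin_mem rfl i)) le_rfl
  exact e.strictMono hij

lemma jumpCount_add_le {ι : Type*} [LinearOrder ι] (lam : ℝ) (J : Set ι) (a b : ι → ℂ) :
    jumpCount lam J (fun k => a k + b k) ≤ jumpCount (lam / 2) J a + jumpCount (lam / 2) J b := by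
  classical
  conv_lhs => unfold jumpCount
  simp only [iSup_le_iff]
  intro N s t hs ht hst hts hj
  set S : Finset (Fin N) := Finset.univ.filter fun i => lam / 2 < ‖a (t i) - a (s i)‖
  have h1 := card_le_jumpCount (a := a) hs ht hst hts S fun i hi => (Finset.mem_filter.1 hi).2
  have h2 := card_le_jumpCount (lam := lam / 2) (a := b) hs ht hst hts Sᶜ fun i hi => by
    have hi' : ‖a (t i) - a (s i)‖ ≤ lam / 2 := by
      simpa [S] using hi
    have h3 := hj i
    rw [add_sub_add_comm] at h3
    have := norm_add_le (a (t i) - a (s i)) (b (t i) - b (s i))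
    linarith
  refine le_trans (le_of_eq ?_) (add_le_add h1 h2)
  rw [← Nat.cast_add, Finset.card_add_card_compl, Fintype.card_fin]

lemma jumpCount_const_sub {ι : Type*} [LinearOrder ι] (lam : ℝ) (J : Set ι) (c : ℂ) (a : ι → ℂ) :
    jumpCount lam J (fun k => c - a k) = jumpCount lam J a := by
  simp only [jumpCount, sub_sub_sub_cancel_left]
  simp only [norm_sub_rev]

/-- Jumps of a finite family are controlled by its square function. -/
lemma jumpCount_le_norm {lam : ℝ} (hlam : 0 ≤ lam) (s : Finset ℤ)
    (a : ℤ → ℂ) : ENNReal.ofReal lam * jumpCount lam (s : Set ℤ) a ^ ((1 : ℝ) / 2) ≤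
      2 * ‖(WithLp.toLp 2 fun k : s => a k : EuclideanSpace ℂ s)‖ₑ := by
  set v : EuclideanSpace ℂ s := WithLp.toLp 2 fun k : s => a k with hv
  have key : ENNReal.ofReal (lam ^ 2) * jumpCount lam (s : Set ℤ) a ≤
      ENNReal.ofReal ((2 * ‖v‖) ^ 2) := by
    simp only [jumpCount, ENNReal.mul_iSup, iSup_le_iff]
    intro N p t hp ht hpt htp hj
    rw [← ENNReal.ofReal_natCast, ← ENNReal.ofReal_mul (by positivity)]
    refine ENNReal.ofReal_le_ofReal ?_
    have hsum : ∀ q : Fin N → ℤ, (∀ i, q i ∈ (s : Set ℤ)) → Function.Injective q →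
        ∑ i, ‖a (q i)‖ ^ 2 ≤ ‖v‖ ^ 2 := by
      intro q hq hinj
      rw [EuclideanSpace.norm_sq_eq]
      simp only [hv]
      rw [Finset.univ_eq_attach, Finset.sum_attach s (fun k => ‖a k‖ ^ 2),
        ← Finset.sum_image (s := Finset.univ) (g := q) (f := fun k => ‖a k‖ ^ 2)
          fun i _ j _ h => hinj h]
      refine Finset.sum_le_sum_of_subset_of_nonneg ?_ fun _ _ _ => by positivity
      intro k hk
      obtain ⟨i, _, rfl⟩ := Finset.mem_image.1 hk
      exact hq i
    have hpm : StrictMono p := fun i j hij => (hpt i).trans (htp i j hij)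
    have htm : StrictMono t := fun i j hij => (htp i j hij).trans (hpt j)
    have h1 := hsum p hp hpm.injective
    have h2 := hsum t ht htm.injective
    calc lam ^ 2 * N = ∑ i : Fin N, lam ^ 2 := by simp [mul_comm]
      _ ≤ ∑ i : Fin N, (2 * ‖a (t i)‖ ^ 2 + 2 * ‖a (p i)‖ ^ 2) := by
          refine Finset.sum_le_sum fun i _ => ?_
          have h3 := (hj i).le.trans (norm_sub_le _ _)
          nlinarith [sq_nonneg (‖a (t i)‖ - ‖a (p i)‖), norm_nonneg (a (t i)),
            norm_nonneg (a (p i))]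
      _ = 2 * ∑ i, ‖a (t i)‖ ^ 2 + 2 * ∑ i, ‖a (p i)‖ ^ 2 := by
          rw [Finset.sum_add_distrib, Finset.mul_sum, Finset.mul_sum]
      _ ≤ (2 * ‖v‖) ^ 2 := by nlinarith
  have h3 := ENNReal.rpow_le_rpow key (by norm_num : (0 : ℝ) ≤ 1 / 2)
  rw [ENNReal.mul_rpow_of_nonneg _ _ (by norm_num), ENNReal.ofReal_rpow_of_nonneg (by positivity)
    (by norm_num), ENNReal.ofReal_rpow_of_nonneg (by positivity) (by norm_num),
    ← Real.sqrt_eq_rpow, ← Real.sqrt_eq_rpow, Real.sqrt_sq hlam,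
    Real.sqrt_sq (by positivity)] at h3
  refine h3.trans (le_of_eq ?_)
  rw [ENNReal.ofReal_mul zero_le_two, ofReal_norm, ENNReal.ofReal_ofNat]

end JumpCount

section FamilyBound

variable {n : ℕ}

theorem exists_family_bound (hn : 1 ≤ n) {p : ℝ} (hp : 1 < p) {K r : ℝ} (hK : 1 ≤ K)
    (hr0 : 0 < r) (hr1 : r < 1) :
    ∃ C ρ : ℝ, 0 < C ∧ 0 < ρ ∧ ρ < 1 ∧ ∀ (ι : Type) [Fintype ι] [DecidableEq ι] (j : ℕ)
      (σ : ι → ℤ) (U : ι → En n → En n → ℂ) (A G : ℝ) (m L : ℕ), Function.Injective σ →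
      (∀ i, NiceKer (U i)) → 0 ≤ A → G ≤ A * 2 ^ L → A * (m + L + 2) ≤ K * (1 + j) →
      (∀ i, Horm (U i) (σ i) m A G) → (∀ i, Horm (fun x y => U i y x) (σ i) m A G) →
      (∀ c : ι → ℂ, (∀ i, ‖c i‖ ≤ 1) → ∀ f, NiceFun f →
        N2 (fun x => ∑ i, c i * kOp (U i) f x) ≤ K * r ^ j * N2 f) →
      ∀ f, NiceFun f → ∫⁻ x, ‖vOp U f x‖ₑ ^ p ≤
        ENNReal.ofReal (C * ((1 + j) * ρ ^ j)) ^ p * ∫⁻ x, ‖f x‖ₑ ^ p := by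
  obtain ⟨C, θ, hC, hθ0, hθ1, H⟩ := exists_master_bound hn hp
  refine ⟨C * (K * K), r ^ θ, by positivity, by positivity, Real.rpow_lt_one hr0.le hr1 hθ0, ?_⟩
  intro ι _ _ j σ U A G m L hσ hU hA hG hAK hH hH' hL2 f hf
  have hK0 : 0 < K := by linarith
  have h1j : (1 : ℝ) ≤ 1 + j := by simp
  have hKj : 1 ≤ K * (1 + j) := by nlinarith
  have hrj : r ^ j ≤ 1 := pow_le_one₀ hr0.le hr1.le
  refine (H ι U (K * (1 + j)) (K * r ^ j) hU (by positivity) ?_ hL2 ?_ ?_ f hf).trans ?_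
  · gcongr
    linarith
  · exact fun q y y' hy => (Horm.sum hσ hA hG hU hH q y y' hy).trans
      (ENNReal.ofReal_le_ofReal hAK)
  · exact fun q y y' hy => (Horm.sum hσ hA hG (fun i => (hU i).transpose) hH' q y y' hy).trans
      (ENNReal.ofReal_le_ofReal hAK)
  · gcongr ENNReal.ofReal ?_ ^ p * _
    have e1 : (K * (1 + j)) ^ (1 - θ) ≤ K * (1 + j) := by
      calc (K * (1 + j)) ^ (1 - θ) ≤ (K * (1 + j)) ^ (1 : ℝ) :=
            Real.rpow_le_rpow_of_exponent_le hKj (by linarith)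
        _ = _ := Real.rpow_one _
    have e2 : (K * r ^ j) ^ θ ≤ K * (r ^ θ) ^ j := by
      rw [Real.mul_rpow hK0.le (by positivity), ← Real.rpow_natCast, ← Real.rpow_natCast,
        ← Real.rpow_mul hr0.le, ← Real.rpow_mul hr0.le, mul_comm θ]
      gcongr
      calc K ^ θ ≤ K ^ (1 : ℝ) := Real.rpow_le_rpow_of_exponent_le hK hθ1
        _ = _ := Real.rpow_one _
    calc C * ((K * (1 + j)) ^ (1 - θ) * (K * r ^ j) ^ θ)
        ≤ C * ((K * (1 + j)) * (K * (r ^ θ) ^ j)) := by gcongr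
      _ = _ := by ring

end FamilyBound

section SquareFunctions

variable {n : ℕ}

/-- A profile `W` and modulated profiles `M j` with size, smoothness and oscillation bounds. -/
structure ProfFam (W : En n → ℂ) (M : ℤ → En n → ℂ) (β K : ℝ) : Prop where
  one_lt : 1 < β
  one_le : 1 ≤ K
  base : Prof W K K
  osc : ∀ j : ℕ, Prof (M j) K (K * β ^ j)
  flat : ∀ j : ℕ, Prof (fun t => M (-j) t - W t) (K * (β ^ j)⁻¹) (K * (β ^ j)⁻¹)
  l2 : ∀ (j : ℕ) s f, NiceFun f →
    N2 (kOp (cKer (M j) s) f) ≤ K * (β ^ j) ^ (-(1 / 2) : ℝ) * N2 f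

/-- Square functions over finite sets of scales decaying geometrically in the parameter `j`. -/
def SqBound (p : ℝ) (U : ℕ → ℤ → En n → En n → ℂ) : Prop :=
  ∃ C ρ : ℝ, 0 < C ∧ 0 < ρ ∧ ρ < 1 ∧ ∀ (j : ℕ) (s : Finset ℤ) f, NiceFun f →
    ∫⁻ x, ‖vOp (fun k : s => U j k) f x‖ₑ ^ p ≤
      ENNReal.ofReal (C * ((1 + j) * ρ ^ j)) ^ p * ∫⁻ x, ‖f x‖ₑ ^ p

lemma exists_scale_bound (s : Finset ℤ) (j : ℕ) :
    ∃ M : ℕ, ∀ k ∈ s, -(M : ℤ) < k - j ∧ k + j ≤ M := by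
  refine ⟨s.sup Int.natAbs + j + 1, fun k hk => ?_⟩
  have := Finset.le_sup (f := Int.natAbs) hk
  constructor <;> push_cast <;> omega

variable {W : En n → ℂ} {M : ℤ → En n → ℂ} {β K p : ℝ}

lemma osc_const_le {x K : ℝ} (hx : 1 ≤ x) (hK : 1 ≤ K) :
    (K * x ^ (-(1 / 2) : ℝ)) ^ (5 / 6 : ℝ) * (K + K * x) ^ (1 / 6 : ℝ) ≤
      2 * K * x ^ (-(1 / 4) : ℝ) := by
  have hx0 : 0 < x := by linarith
  have hK0 : 0 < K := by linarith
  have e1 : (K * x ^ (-(1 / 2) : ℝ)) ^ (5 / 6 : ℝ) ≤ (2 * K) ^ (5 / 6 : ℝ) * x ^ (-(5 / 12) : ℝ) := by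
    rw [Real.mul_rpow hK0.le (by positivity), ← Real.rpow_mul hx0.le]
    norm_num
    gcongr
    linarith
  have e2 : (K + K * x) ^ (1 / 6 : ℝ) ≤ (2 * K) ^ (1 / 6 : ℝ) * x ^ (1 / 6 : ℝ) := by
    rw [← Real.mul_rpow (by positivity) hx0.le]
    gcongr
    nlinarith
  calc _ ≤ ((2 * K) ^ (5 / 6 : ℝ) * x ^ (-(5 / 12) : ℝ)) *
        ((2 * K) ^ (1 / 6 : ℝ) * x ^ (1 / 6 : ℝ)) := by gcongr
    _ = ((2 * K) ^ (5 / 6 : ℝ) * (2 * K) ^ (1 / 6 : ℝ)) *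
        (x ^ (-(5 / 12) : ℝ) * x ^ (1 / 6 : ℝ)) := by ring
    _ = 2 * K * x ^ (-(1 / 4) : ℝ) := by
        rw [← Real.rpow_add (by positivity), ← Real.rpow_add hx0]
        norm_num

lemma ProfFam.sqBound_osc (hn : 1 ≤ n) (hp : 1 < p) (h : ProfFam W M β K) :
    SqBound p fun j k => cKer (M j) (k - j) := by
  obtain ⟨C, hC, H⟩ := exists_l2_osc n
  have hβ := h.one_lt
  have hK := h.one_le
  obtain ⟨N, hN⟩ := pow_unbounded_of_one_lt β (one_lt_two (α := ℝ))
  have hr : β ^ (-(1 / 4) : ℝ) < 1 := Real.rpow_lt_one_of_one_lt_of_neg hβ (by norm_num)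
  obtain ⟨C', ρ, hC', hρ0, hρ1, H'⟩ := exists_family_bound hn hp
    (K := 1 + C * (2 * K) + 2 * (K * 2 ^ n) * (n + N + 2))
    (le_add_of_le_of_nonneg (le_add_of_nonneg_right (by positivity)) (by positivity))
    (Real.rpow_pos_of_pos (by linarith : 0 < β) (-(1 / 4))) hr
  refine ⟨C', ρ, hC', hρ0, hρ1, fun j s f hf => ?_⟩
  have hφ := h.osc j
  have hβj : 1 ≤ β ^ j := one_le_pow₀ hβ.le
  obtain ⟨R, hR⟩ := exists_scale_bound s j
  have hσ : Function.Injective fun k : s => (k : ℤ) - j := fun k k' hkk =>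
    Subtype.ext (by simpa using hkk)
  refine H' s j (fun k => k - j) _ (2 * (K * 2 ^ n)) (2 * (K * β ^ j * n * 2 ^ n)) 0 (n + N * j)
    hσ (fun k => hφ.niceKer _) (by positivity) ?_ ?_
    (fun k => hφ.horm_cKer (by positivity) _ 0) (fun k => hφ.horm_cKer_swap (by positivity) _ 0)
    ?_ f hf
  · have h1 : β ^ j ≤ 2 ^ (N * j) := by
      rw [pow_mul]
      gcongr
    have h2 : (n : ℝ) ≤ 2 ^ n := by exact_mod_cast Nat.lt_two_pow_self.le
    calc 2 * (K * β ^ j * n * 2 ^ n) = 2 * (K * 2 ^ n) * (n * β ^ j) := by ring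
      _ ≤ 2 * (K * 2 ^ n) * (2 ^ n * 2 ^ (N * j)) := by gcongr
      _ = _ := by rw [pow_add]
  · push_cast
    have hj : (0 : ℝ) ≤ j := by positivity
    have : (0 + (n + N * j) + 2 : ℝ) ≤ (n + N + 2) * (1 + j) := by
      have : (0:ℝ) ≤ n * j := by positivity
      have : (0:ℝ) ≤ N := by positivity
      nlinarith
    calc 2 * (K * 2 ^ n) * (0 + (n + N * j) + 2 : ℝ)
        ≤ 2 * (K * 2 ^ n) * ((n + N + 2) * (1 + j)) := by gcongr
      _ = 2 * (K * 2 ^ n) * (n + N + 2) * (1 + j) := by ring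
      _ ≤ _ := by gcongr; nlinarith
  · intro c hc f hf
    refine (H R s (fun k => k - j) (M j) K (K * β ^ j) (K * (β ^ j) ^ (-(1 / 2) : ℝ)) hσ
      (fun k => ?_) hφ (by positivity) (by positivity) (by positivity) (fun t f hf => h.l2 j t f hf)
      c hc f hf).trans ?_
    · have := hR k k.2
      exact ⟨this.1, by omega⟩
    · refine mul_le_mul_of_nonneg_right ?_ (N2_nonneg f)
      have e : (β ^ (-(1 / 4) : ℝ)) ^ j = (β ^ j) ^ (-(1 / 4) : ℝ) := by
        rw [← Real.rpow_natCast, ← Real.rpow_natCast, ← Real.rpow_mul (by positivity),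
          ← Real.rpow_mul (by positivity), mul_comm]
      rw [e]
      calc _ ≤ C * (2 * K * (β ^ j) ^ (-(1 / 4) : ℝ)) :=
            mul_le_mul_of_nonneg_left (osc_const_le hβj hK) hC.le
        _ = C * (2 * K) * (β ^ j) ^ (-(1 / 4) : ℝ) := by ring
        _ ≤ _ := by
            gcongr
            have : 0 ≤ 2 * (K * 2 ^ n) * (n + N + 2 : ℝ) := by positivity
            linarith

lemma l2_red_trivial (R : ℕ) {φ : En n → ℂ} (t : ℤ) (f g : En n → ℂ) (r' : ℕ) :
    ∫ x, kOp (cKer φ t) f x * mP R r' g x = 0 ∨ 0 ≤ (t - (r' - R)).natAbs ∧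
      ‖∫ x, kOp (cKer φ t) f x * mP R r' g x‖ = ‖∫ x, kOp (cKer φ t) f x * mP R r' g x‖ :=
  Or.inr ⟨Nat.zero_le _, rfl⟩

lemma dec_rpow (j : ℕ) : dec j ^ (5 / 6 : ℝ) = ((2 : ℝ) ^ (-(5 / 12) : ℝ)) ^ j := by
  rw [dec, Int.natAbs_natCast, ← Real.rpow_natCast, ← Real.rpow_mul two_pos.le,
    ← Real.rpow_mul two_pos.le]
  congr 1
  ring

lemma natCast_le_two_pow (n : ℕ) : (n : ℝ) ≤ 2 ^ n := by exact_mod_cast Nat.lt_two_pow_self.le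

lemma ProfFam.sqBound_flat (hn : 1 ≤ n) (hp : 1 < p) (h : ProfFam W M β K) :
    SqBound p fun j k => cKer (fun t => M (-j) t - W t) (k + j) := by
  obtain ⟨C, hC, H⟩ := exists_l2_red n
  have hβ := h.one_lt
  have hK := h.one_le
  have hβ0 : 0 < β := by linarith
  obtain ⟨C', ρ, hC', hρ0, hρ1, H'⟩ := exists_family_bound hn hp
    (K := 1 + C * (2 * K) + 2 * (K * 2 ^ n) * (n + 2))
    (le_add_of_le_of_nonneg (le_add_of_nonneg_right (by positivity)) (by positivity))
    (inv_pos.2 hβ0) (inv_lt_one_of_one_lt₀ hβ)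
  refine ⟨C', ρ, hC', hρ0, hρ1, fun j s f hf => ?_⟩
  have hφ := h.flat j
  have hβj : (β ^ j)⁻¹ ≤ 1 := inv_le_one_of_one_le₀ (one_le_pow₀ hβ.le)
  obtain ⟨R, hR⟩ := exists_scale_bound s j
  have hσ : Function.Injective fun k : s => (k : ℤ) + j := fun k k' hkk =>
    Subtype.ext (by simpa using hkk)
  refine H' s j (fun k => k + j) _ (2 * (K * (β ^ j)⁻¹ * 2 ^ n))
    (2 * (K * (β ^ j)⁻¹ * n * 2 ^ n)) 0 n
    hσ (fun k => hφ.niceKer _) (by positivity) ?_ ?_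
    (fun k => hφ.horm_cKer (by positivity) _ 0) (fun k => hφ.horm_cKer_swap (by positivity) _ 0)
    ?_ f hf
  · calc 2 * (K * (β ^ j)⁻¹ * n * 2 ^ n) = 2 * (K * (β ^ j)⁻¹ * 2 ^ n) * n := by ring
      _ ≤ 2 * (K * (β ^ j)⁻¹ * 2 ^ n) * 2 ^ n := by
        gcongr
        exact natCast_le_two_pow n
  · have hj : (1 : ℝ) ≤ 1 + j := by simp
    calc 2 * (K * (β ^ j)⁻¹ * 2 ^ n) * ((0 : ℕ) + n + 2 : ℝ)
        ≤ 2 * (K * 1 * 2 ^ n) * ((0 : ℕ) + n + 2 : ℝ) := by gcongr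
      _ = 2 * (K * 2 ^ n) * (n + 2) * 1 := by push_cast; ring
      _ ≤ _ := by gcongr; nlinarith
  · intro c hc f hf
    refine (H R s (fun k => k + j) _ (K * (β ^ j)⁻¹) (K * (β ^ j)⁻¹)
      (fun k : s => cKer (fun t => M (-j) t - W t) (k + j)) 0 hσ
      (fun k => ?_) hφ (by positivity) (by positivity) (fun k => hφ.niceKer _)
      (fun k f g hf hg r' _ => l2_red_trivial R _ f g r') c hc f hf).trans ?_
    · have := hR k k.2
      exact ⟨by omega, this.2⟩
    · refine mul_le_mul_of_nonneg_right ?_ (N2_nonneg f)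
      rw [inv_pow]
      calc C * (K * (β ^ j)⁻¹ + K * (β ^ j)⁻¹) * dec (0 : ℕ) ^ (5 / 6 : ℝ)
          = C * (2 * K) * (β ^ j)⁻¹ := by rw [dec_rpow]; ring
        _ ≤ _ := by
            gcongr
            have : 0 ≤ 2 * (K * 2 ^ n) * (n + 2 : ℝ) := by positivity
            linarith

lemma Prof.niceKer_kComp (h : Prof W K K) (k s : ℤ) : NiceKer (kComp (eKer k) (cKer W s)) :=
  (niceKer_eKer k).comp (h.niceKer s)

lemma ProfFam.sqBound_coarse (hn : 1 ≤ n) (hp : 1 < p) (h : ProfFam W M β K) :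
    SqBound p fun j k => kComp (eKer k) (cKer W (k + j)) := by
  obtain ⟨C, hC, H⟩ := exists_l2_red n
  have hK := h.one_le
  have hr : (2 : ℝ) ^ (-(5 / 12) : ℝ) < 1 :=
    Real.rpow_lt_one_of_one_lt_of_neg one_lt_two (by norm_num)
  obtain ⟨C', ρ, hC', hρ0, hρ1, H'⟩ := exists_family_bound hn hp
    (K := 1 + C * (2 * K) + 6 * (K * 2 ^ n) * (n + 2))
    (le_add_of_le_of_nonneg (le_add_of_nonneg_right (by positivity)) (by positivity))
    (by positivity) hr
  refine ⟨C', ρ, hC', hρ0, hρ1, fun j s f hf => ?_⟩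
  have hφ := h.base
  obtain ⟨R, hR⟩ := exists_scale_bound s j
  have hσ : Function.Injective fun k : s => (k : ℤ) + j := fun k k' hkk =>
    Subtype.ext (by simpa using hkk)
  refine H' s j (fun k => k + j) (fun k : s => kComp (eKer k) (cKer W (k + j))) (6 * (K * 2 ^ n)) (6 * (K * n * 2 ^ n)) j n
    hσ (fun k => hφ.niceKer_kComp _ _) (by positivity) ?_ ?_
    (fun k => (hφ.horm_kComp (by positivity) le_rfl).mono le_rfl (by gcongr; norm_num)
      (by gcongr; norm_num))
    (fun k => hφ.horm_kComp_swap (by positivity) _ _ _) ?_ f hf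
  · calc 6 * (K * n * 2 ^ n) = 6 * (K * 2 ^ n) * n := by ring
      _ ≤ 6 * (K * 2 ^ n) * 2 ^ n := by
        gcongr
        exact natCast_le_two_pow n
  · have hj : (0 : ℝ) ≤ j := by positivity
    have : (j + n + 2 : ℝ) ≤ (n + 2) * (1 + j) := by
      have : (0:ℝ) ≤ n * j := by positivity
      nlinarith
    calc 6 * (K * 2 ^ n) * (j + n + 2 : ℝ)
        ≤ 6 * (K * 2 ^ n) * ((n + 2) * (1 + j)) := by gcongr
      _ = 6 * (K * 2 ^ n) * (n + 2) * (1 + j) := by ring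
      _ ≤ _ := by gcongr; nlinarith
  · intro c hc f hf
    refine (H R s (fun k => k + j) W K K
      (fun k : s => kComp (eKer k) (cKer W (k + j))) j hσ
      (fun k => ?_) hφ (by positivity) (by positivity) (fun k => hφ.niceKer_kComp _ _)
      (fun k f g hf hg r' _ => reduction_coarse hφ ?_ ?_ rfl hf hg r') c hc f hf).trans ?_
    · have := hR k k.2
      exact ⟨by omega, this.2⟩
    · have := hR k k.2
      omega
    · have := hR k k.2
      omega
    · refine mul_le_mul_of_nonneg_right ?_ (N2_nonneg f)
      rw [dec_rpow]
      gcongr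
      have : 0 ≤ 6 * (K * 2 ^ n) * (n + 2 : ℝ) := by positivity
      linarith

lemma ProfFam.sqBound_fine (hn : 1 ≤ n) (hp : 1 < p) (h : ProfFam W M β K) :
    SqBound p fun j k => fun x y =>
      kComp (eKer k) (cKer W (k - j)) x y - cKer W (k - j) x y := by
  obtain ⟨C, hC, H⟩ := exists_l2_red n
  have hK := h.one_le
  have hr : (2 : ℝ) ^ (-(5 / 12) : ℝ) < 1 :=
    Real.rpow_lt_one_of_one_lt_of_neg one_lt_two (by norm_num)
  obtain ⟨C', ρ, hC', hρ0, hρ1, H'⟩ := exists_family_bound hn hp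
    (K := 1 + C * (2 * K) + 8 * (K * 2 ^ n) * (n + 2))
    (le_add_of_le_of_nonneg (le_add_of_nonneg_right (by positivity)) (by positivity))
    (by positivity) hr
  refine ⟨C', ρ, hC', hρ0, hρ1, fun j s f hf => ?_⟩
  have hφ := h.base
  obtain ⟨R, hR⟩ := exists_scale_bound s j
  have hσ : Function.Injective fun k : s => (k : ℤ) - j := fun k k' hkk =>
    Subtype.ext (by simpa using hkk)
  have hK0 : 0 ≤ K := by linarith
  refine H' s j (fun k => k - j)
    (fun (k : s) x y => kComp (eKer k) (cKer W (k - j)) x y - cKer W (k - j) x y) (8 * (K * 2 ^ n)) (8 * (K * n * 2 ^ n)) 0 n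
    hσ (fun k => (hφ.niceKer_kComp _ _).sub (hφ.niceKer _)) (by positivity) ?_ ?_
    (fun k => ((hφ.horm_kComp hK0 (by push_cast; omega)).sub (hφ.horm_cKer hK0 _ 0)
      (hφ.niceKer_kComp _ _) (by positivity) (by positivity) (by positivity)
      (by positivity)).mono le_rfl ?_ ?_)
    (fun k => ((hφ.horm_kComp_swap hK0 _ _ 0).sub (hφ.horm_cKer_swap hK0 _ 0)
      (hφ.niceKer_kComp _ _).transpose (by positivity) (by positivity) (by positivity)
      (by positivity)).mono le_rfl ?_ ?_) ?_ f hf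
  · calc 8 * (K * n * 2 ^ n) = 8 * (K * 2 ^ n) * n := by ring
      _ ≤ 8 * (K * 2 ^ n) * 2 ^ n := by
        gcongr
        exact natCast_le_two_pow n
  · have hj : (1 : ℝ) ≤ 1 + j := by simp
    calc 8 * (K * 2 ^ n) * ((0 : ℕ) + n + 2 : ℝ)
        = 8 * (K * 2 ^ n) * (n + 2) * 1 := by push_cast; ring
      _ ≤ _ := by gcongr; nlinarith
  · have : 0 ≤ K * 2 ^ n := by positivity
    linarith
  · have : 0 ≤ K * n * 2 ^ n := by positivity
    linarith
  · linarith
  · linarith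
  · intro c hc f hf
    refine (H R s (fun k => k - j) W K K
      (fun (k : s) x y => kComp (eKer k) (cKer W (k - j)) x y - cKer W (k - j) x y) j hσ
      (fun k => ?_) hφ (by positivity) (by positivity)
      (fun k => (hφ.niceKer_kComp _ _).sub (hφ.niceKer _))
      (fun k f g hf hg r' _ => reduction_fine hφ ?_ ?_ (by ring) hf hg r') c hc f hf).trans ?_
    · have := hR k k.2
      exact ⟨this.1, by omega⟩
    · have := hR k k.2
      omega
    · have := hR k k.2
      omega
    · refine mul_le_mul_of_nonneg_right ?_ (N2_nonneg f)
      rw [dec_rpow]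
      gcongr
      have : 0 ≤ 8 * (K * 2 ^ n) * (n + 2 : ℝ) := by positivity
      linarith

/-- `L^p` bounds for truncated sums of dilates of a profile, uniform in the truncation. -/
lemma Prof.exists_sum_bound (hn : 1 ≤ n) (hp : 1 < p) (hK : 1 ≤ K) (hφ : Prof W K K) :
    ∃ C : ℝ, 0 < C ∧ ∀ (s : Finset ℤ) f, NiceFun f →
      ∫⁻ x, ‖∑ l ∈ s, kOp (cKer W l) f x‖ₑ ^ p ≤ ENNReal.ofReal C ^ p * ∫⁻ x, ‖f x‖ₑ ^ p := by
  obtain ⟨C, hC, H⟩ := exists_l2_red n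
  obtain ⟨C', θ, hC', hθ0, hθ1, H'⟩ := exists_master_bound hn hp
  set B : ℝ := C * (2 * K) with hB
  set A : ℝ := B + 2 * (K * 2 ^ n) * (n + 2) with hA
  have hB0 : 0 < B := by positivity
  have hBA : B ≤ A := le_add_of_nonneg_right (by positivity)
  have hA0 : 0 < A := hB0.trans_le hBA
  refine ⟨C' * (A ^ (1 - θ) * B ^ θ), by positivity, fun s f hf => ?_⟩
  obtain ⟨R, hR⟩ := exists_scale_bound s 0
  have hu : NiceKer fun x y => ∑ l ∈ s, cKer W l x y := NiceKer.sum fun l _ => hφ.niceKer l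
  have hkop : ∀ {f}, NiceFun f → ∀ x, kOp (fun x y => ∑ l ∈ s, cKer W l x y) f x =
      ∑ l ∈ s, kOp (cKer W l) f x := fun hf x => kOp_sum_left (fun l _ => hφ.niceKer l) hf x
  have hGA : 2 * (K * n * 2 ^ n) ≤ 2 * (K * 2 ^ n) * 2 ^ n := by
    calc 2 * (K * n * 2 ^ n) = 2 * (K * 2 ^ n) * n := by ring
      _ ≤ _ := by gcongr; exact natCast_le_two_pow n
  have hA' : 2 * (K * 2 ^ n) * ((0 : ℕ) + n + 2 : ℝ) ≤ A := by
    rw [hA]; push_cast; rw [zero_add]; linarith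
  have hinj : Function.Injective fun l : s => (l : ℤ) := Subtype.val_injective
  have key := H' Unit (fun _ x y => ∑ l ∈ s, cKer W l x y) A B (fun _ => hu) hB0 hBA ?_ ?_ ?_ f hf
  · refine le_trans (le_of_eq ?_) key
    refine lintegral_congr fun x => ?_
    congr 1
    rw [← ofReal_norm, ← ofReal_norm, EuclideanSpace.norm_eq]
    simp [vOp, hkop hf]
  · intro c hc f hf
    have h1 := H R s (fun l => l) W K K (fun l : s => cKer W l) 0 hinj (fun l => by
      have := hR l l.2
      push_cast at this
      omega) hφ (by positivity) (by positivity) (fun l => hφ.niceKer _)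
      (fun l f g _ _ r' _ => l2_red_trivial R _ f g r') (fun _ => c ()) (fun _ => hc ()) f hf
    have e : (fun x => ∑ i : Unit, c i * kOp (fun x y => ∑ l ∈ s, cKer W l x y) f x) =
        fun x => ∑ l : s, c () * kOp (cKer W l) f x := by
      funext x
      rw [hkop hf, ← Finset.mul_sum, Finset.univ_eq_attach,
        Finset.sum_attach s (fun l => kOp (cKer W l) f x)]
      simp
    rw [e]
    refine h1.trans (le_of_eq ?_)
    rw [dec_rpow, hB]
    ring
  · intro q y y' hy
    refine le_trans (lintegral_mono fun x => ?_) ((Horm.sum hinj (by positivity) hGA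
      (fun l : s => hφ.niceKer _) (fun l => hφ.horm_cKer (by positivity) l 0) q y y' hy).trans
      (ENNReal.ofReal_le_ofReal hA'))
    simp only [Finset.univ_unique, Finset.sum_singleton]
    rw [← Finset.sum_sub_distrib, Finset.univ_eq_attach,
      Finset.sum_attach s (fun l => ‖cKer W l x y - cKer W l x y'‖ₑ)]
    exact enorm_sum_le _ _
  · intro q y y' hy
    refine le_trans (lintegral_mono fun x => ?_) ((Horm.sum hinj (by positivity) hGA
      (fun l : s => (hφ.niceKer _).transpose) (fun l => hφ.horm_cKer_swap (by positivity) l 0)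
      q y y' hy).trans (ENNReal.ofReal_le_ofReal hA'))
    simp only [Finset.univ_unique, Finset.sum_singleton]
    rw [← Finset.sum_sub_distrib, Finset.univ_eq_attach,
      Finset.sum_attach s (fun l => ‖cKer W l y x - cKer W l y' x‖ₑ)]
    exact enorm_sum_le _ _

end SquareFunctions

section TruncatedBound

variable {n : ℕ}

/-- The `L^p` norm of a nonnegative function. -/
def lpn (p : ℝ) (F : En n → ℝ≥0∞) : ℝ≥0∞ := (∫⁻ x, F x ^ p) ^ (1 / p)

lemma lpn_add_le {p : ℝ} (hp : 1 ≤ p) {F G : En n → ℝ≥0∞} (hF : Measurable F)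
    (hG : Measurable G) : lpn p (fun x => F x + G x) ≤ lpn p F + lpn p G :=
  ENNReal.lintegral_Lp_add_le hF.aemeasurable hG.aemeasurable hp

lemma lpn_sum_le {p : ℝ} (hp : 1 ≤ p) {ι : Type*} (s : Finset ι) {F : ι → En n → ℝ≥0∞}
    (hF : ∀ i, Measurable (F i)) : lpn p (fun x => ∑ i ∈ s, F i x) ≤ ∑ i ∈ s, lpn p (F i) := by
  classical
  induction s using Finset.induction_on with
  | empty =>
    have : (0 : ℝ) < p := by linarith
    simp [lpn, this]
  | insert i s hi ih =>
    simp only [Finset.sum_insert hi]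
    exact (lpn_add_le hp (hF i) (Finset.measurable_sum _ fun j _ => hF j)).trans
      (add_le_add le_rfl ih)

lemma lpn_const_mul {p : ℝ} (hp : 1 ≤ p) (c : ℝ≥0∞) {F : En n → ℝ≥0∞} (hF : Measurable F) :
    lpn p (fun x => c * F x) = c * lpn p F := by
  have hp0 : 0 < p := by linarith
  unfold lpn
  simp only [ENNReal.mul_rpow_of_nonneg _ _ hp0.le]
  rw [lintegral_const_mul _ (hF.pow_const _), ENNReal.mul_rpow_of_nonneg _ _ (by positivity),
    ← ENNReal.rpow_mul, mul_one_div_cancel hp0.ne', ENNReal.rpow_one]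

lemma lpn_le_of_lintegral_le {p : ℝ} (hp : 1 ≤ p) {c : ℝ≥0∞} {F G : En n → ℝ≥0∞}
    (h : ∫⁻ x, F x ^ p ≤ c ^ p * ∫⁻ x, G x ^ p) : lpn p F ≤ c * lpn p G := by
  have hp0 : 0 < p := by linarith
  refine (ENNReal.rpow_le_rpow h (by positivity : 0 ≤ 1 / p)).trans (le_of_eq ?_)
  rw [ENNReal.mul_rpow_of_nonneg _ _ (by positivity), ← ENNReal.rpow_mul,
    mul_one_div_cancel hp0.ne', ENNReal.rpow_one]
  rfl

lemma SqBound.exists_sum_le {p : ℝ} (hp : 1 < p) {U : ℕ → ℤ → En n → En n → ℂ}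
    (hU : ∀ j k, NiceKer (U j k)) (h : SqBound p U) :
    ∃ D : ℝ, 0 ≤ D ∧ ∀ (R : ℕ) (s : Finset ℤ) f, NiceFun f →
      lpn p (fun x => ∑ j ∈ Finset.range R, ‖vOp (fun k : s => U j k) f x‖ₑ) ≤
        ENNReal.ofReal D * lpn p fun x => ‖f x‖ₑ := by
  obtain ⟨C, ρ, hC, hρ0, hρ1, H⟩ := h
  have hρ : ‖ρ‖ < 1 := by rwa [Real.norm_of_nonneg hρ0.le]
  have hs : Summable fun j : ℕ => C * ((1 + j) * ρ ^ j) := by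
    refine Summable.mul_left _ ?_
    have h1 := summable_pow_mul_geometric_of_norm_lt_one 0 hρ
    have h2 := summable_pow_mul_geometric_of_norm_lt_one 1 hρ
    refine (h1.add h2).congr fun j => ?_
    ring
  have h0 : ∀ j : ℕ, 0 ≤ C * ((1 + j) * ρ ^ j) := fun j => by positivity
  refine ⟨∑' j : ℕ, C * ((1 + j) * ρ ^ j), tsum_nonneg h0, fun R s f hf => ?_⟩
  refine (lpn_sum_le hp.le _ fun j => (measurable_vOp (fun k : s => hU j k) hf).enorm).trans ?_
  refine (Finset.sum_le_sum fun j _ => lpn_le_of_lintegral_le hp.le (H j s f hf)).trans ?_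
  rw [← Finset.sum_mul, ← ENNReal.ofReal_sum_of_nonneg fun j _ => h0 j]
  gcongr
  exact hs.sum_le_tsum _ fun j _ => h0 j

lemma sum_Icc_eq_sum_range {E : Type*} [AddCommMonoid E] (N : ℕ) {k : ℤ}
    (hk : k ∈ Finset.Icc (-(N : ℤ)) N) (T : ℤ → E) :
    ∑ l ∈ Finset.Icc (-(N : ℤ)) N, T l = ∑ j ∈ Finset.range (2 * N + 1),
      ((if k - j ∈ Finset.Icc (-(N : ℤ)) N then T (k - j) else 0) +
        if 1 ≤ j ∧ k + j ∈ Finset.Icc (-(N : ℤ)) N then T (k + j) else 0) := by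
  rw [Finset.mem_Icc] at hk
  rw [Finset.sum_add_distrib, ← Finset.sum_filter, ← Finset.sum_filter,
    ← Finset.sum_filter_add_sum_filter_not _ (fun l => l ≤ k)]
  congr 1
  · refine Finset.sum_nbij' (fun l => (k - l).toNat) (fun j => k - j) ?_ ?_ ?_ ?_ ?_
    · intro l hl
      simp only [Finset.mem_filter, Finset.mem_Icc, Finset.mem_range] at hl ⊢
      omega
    · intro j hj
      simp only [Finset.mem_filter, Finset.mem_Icc, Finset.mem_range] at hj ⊢
      omega
    · intro l hl
      simp only [Finset.mem_filter, Finset.mem_Icc] at hl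
      omega
    · intro j hj
      omega
    · intro l hl
      simp only [Finset.mem_filter, Finset.mem_Icc] at hl
      congr 1
      omega
  · refine Finset.sum_nbij' (fun l => (l - k).toNat) (fun j => k + j) ?_ ?_ ?_ ?_ ?_
    · intro l hl
      simp only [Finset.mem_filter, Finset.mem_Icc, Finset.mem_range] at hl ⊢
      omega
    · intro j hj
      simp only [Finset.mem_filter, Finset.mem_Icc, Finset.mem_range] at hj ⊢
      omega
    · intro l hl
      simp only [Finset.mem_filter, Finset.mem_Icc] at hl
      omega
    · intro j hj
      omega
    · intro l hl
      simp only [Finset.mem_filter, Finset.mem_Icc] at hl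
      congr 1
      omega

lemma enorm_toLp_mono {ι : Type*} [Fintype ι] {x y : ι → ℂ} (h : ∀ i, ‖x i‖ ≤ ‖y i‖) :
    ‖(WithLp.toLp 2 x : EuclideanSpace ℂ ι)‖ₑ ≤ ‖(WithLp.toLp 2 y : EuclideanSpace ℂ ι)‖ₑ := by
  rw [← ofReal_norm, ← ofReal_norm]
  refine ENNReal.ofReal_le_ofReal ?_
  rw [EuclideanSpace.norm_eq, EuclideanSpace.norm_eq]
  exact Real.sqrt_le_sqrt (Finset.sum_le_sum fun i _ =>
    pow_le_pow_left₀ (norm_nonneg _) (h i) 2)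

variable {W : En n → ℂ} {M : ℤ → En n → ℂ} {β K p : ℝ}

lemma ProfFam.niceKer_neg (h : ProfFam W M β K) (j : ℕ) (s : ℤ) : NiceKer (cKer (M (-j)) s) := by
  have e : cKer (M (-j)) s = fun x y => cKer (fun t => M (-j) t - W t) s x y + cKer W s x y := by
    funext x y
    simp only [cKer]
    ring
  rw [e]
  exact ((h.flat j).niceKer s).add (h.base.niceKer s)

lemma ProfFam.kOp_flat (h : ProfFam W M β K) (j : ℕ) (s : ℤ) {f : En n → ℂ} (hf : NiceFun f)
    (x : En n) : kOp (cKer (fun t => M (-j) t - W t) s) f x =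
      kOp (cKer (M (-j)) s) f x - kOp (cKer W s) f x := by
  rw [← kOp_sub_left (h.niceKer_neg j s) (h.base.niceKer s) hf]
  congr 1
  funext x y
  simp only [cKer]
  ring

/-- The jump inequality for sums over finitely many scales, uniformly in the truncation. -/
theorem ProfFam.exists_jump_bound (hn : 1 ≤ n) (hp : 1 < p) (h : ProfFam W M β K) :
    ∃ C : ℝ, 0 ≤ C ∧ ∀ (N : ℕ) (f : En n → ℂ) (lam : ℝ), NiceFun f → 0 < lam →
      ∃ F : En n → ℝ≥0∞, Measurable F ∧
      (∀ x, ENNReal.ofReal lam * (jumpCount lam (Set.Icc (-(N : ℤ)) N) fun k =>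
        ∑ l ∈ Finset.Icc (-(N : ℤ)) N, kOp (cKer (M (k - l)) l) f x) ^ ((1 : ℝ) / 2) ≤ F x) ∧
      lpn p F ≤ ENNReal.ofReal C * lpn p fun x => ‖f x‖ₑ := by
  have n1 : ∀ (j : ℕ) (k : ℤ), NiceKer (cKer (M j) (k - j)) := fun j k => (h.osc j).niceKer _
  have n2 : ∀ (j : ℕ) (k : ℤ), NiceKer fun x y =>
      kComp (eKer k) (cKer W (k - j)) x y - cKer W (k - j) x y := fun j k =>
    (h.base.niceKer_kComp _ _).sub (h.base.niceKer _)
  have n3 : ∀ (j : ℕ) (k : ℤ), NiceKer (cKer (fun t => M (-j) t - W t) (k + j)) := fun j k =>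
    (h.flat j).niceKer _
  have n4 : ∀ (j : ℕ) (k : ℤ), NiceKer (kComp (eKer k) (cKer W (k + j))) := fun j k =>
    h.base.niceKer_kComp _ _
  obtain ⟨D1, hD1, H1⟩ := (h.sqBound_osc hn hp).exists_sum_le hp n1
  obtain ⟨D2, hD2, H2⟩ := (h.sqBound_fine hn hp).exists_sum_le hp n2
  obtain ⟨D3, hD3, H3⟩ := (h.sqBound_flat hn hp).exists_sum_le hp n3
  obtain ⟨D4, hD4, H4⟩ := (h.sqBound_coarse hn hp).exists_sum_le hp n4
  obtain ⟨D5, hD5, H5⟩ := h.base.exists_sum_bound hn hp h.one_le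
  obtain ⟨D6, hD6, H6⟩ := exists_martingale_jump_bound hn hp
  refine ⟨2 * (D6 * D5) + 4 * (D1 + D2 + D3 + D4), by positivity, fun N f lam hf hlam => ?_⟩
  set S : Finset ℤ := Finset.Icc (-(N : ℤ)) N with hS
  set g : En n → ℂ := fun x => ∑ l ∈ S, kOp (cKer W l) f x with hg
  have hgn : NiceFun g := NiceFun.sum fun l _ => (h.base.niceKer l).niceFun_kOp hf
  obtain ⟨F0, hF0, hF0j, hF0p⟩ := H6 N g (lam / 2) hgn (half_pos hlam)
  set V1 : En n → ℝ≥0∞ := fun x => ∑ j ∈ Finset.range (2 * N + 1),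
    ‖vOp (fun k : S => cKer (M j) (k - j)) f x‖ₑ with hV1
  set V2 : En n → ℝ≥0∞ := fun x => ∑ j ∈ Finset.range (2 * N + 1),
    ‖vOp (fun (k : S) x y => kComp (eKer k) (cKer W (k - j)) x y - cKer W (k - j) x y) f x‖ₑ
    with hV2
  set V3 : En n → ℝ≥0∞ := fun x => ∑ j ∈ Finset.range (2 * N + 1),
    ‖vOp (fun k : S => cKer (fun t => M (-j) t - W t) (k + j)) f x‖ₑ with hV3
  set V4 : En n → ℝ≥0∞ := fun x => ∑ j ∈ Finset.range (2 * N + 1),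
    ‖vOp (fun k : S => kComp (eKer k) (cKer W (k + j))) f x‖ₑ with hV4
  have m1 : Measurable V1 :=
    Finset.measurable_sum _ fun j _ => (measurable_vOp (fun k : S => n1 j k) hf).enorm
  have m2 : Measurable V2 :=
    Finset.measurable_sum _ fun j _ => (measurable_vOp (fun k : S => n2 j k) hf).enorm
  have m3 : Measurable V3 :=
    Finset.measurable_sum _ fun j _ => (measurable_vOp (fun k : S => n3 j k) hf).enorm
  have m4 : Measurable V4 :=
    Finset.measurable_sum _ fun j _ => (measurable_vOp (fun k : S => n4 j k) hf).enorm
  refine ⟨fun x => 2 * F0 x + 4 * (V1 x + V2 x + V3 x + V4 x),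
    (hF0.const_mul _).add ((((m1.add m2).add m3).add m4).const_mul _), fun x => ?_, ?_⟩
  · set T : ℤ → ℤ → ℂ := fun k l =>
      kOp (cKer (M (k - l)) l) f x - kOp (cKer W l) f x + eOp k (kOp (cKer W l) f) x with hT
    have hsplit : ∀ k, ∑ l ∈ S, kOp (cKer (M (k - l)) l) f x =
        (g x - eOp k g x) + ∑ l ∈ S, T k l := fun k => by
      have e : eOp k g x = ∑ l ∈ S, eOp k (kOp (cKer W l) f) x :=
        kOp_sum_right (niceKer_eKer k) (fun l _ => (h.base.niceKer l).niceFun_kOp hf) x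
      rw [e, hT, hg]
      simp only [Finset.sum_add_distrib, Finset.sum_sub_distrib]
      ring
    simp only [hsplit]
    set b : ℤ → ℂ := fun k => ∑ l ∈ S, T k l with hb
    have hJ := jumpCount_add_le lam (Set.Icc (-(N : ℤ)) N) (fun k => g x - eOp k g x) b
    rw [jumpCount_const_sub] at hJ
    have hJb := jumpCount_le_norm (half_pos hlam).le S b
    rw [hS, Finset.coe_Icc] at hJb
    have hbv : ‖(WithLp.toLp 2 fun k : S => b k : EuclideanSpace ℂ S)‖ₑ ≤
        V1 x + V2 x + V3 x + V4 x := by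
      set q1 : ℕ → EuclideanSpace ℂ S := fun j => WithLp.toLp 2 fun k : S =>
        if (k : ℤ) - j ∈ S then kOp (cKer (M j) (k - j)) f x else 0 with hq1
      set q2 : ℕ → EuclideanSpace ℂ S := fun j => WithLp.toLp 2 fun k : S =>
        if (k : ℤ) - j ∈ S then kOp (fun x y =>
          kComp (eKer k) (cKer W (k - j)) x y - cKer W (k - j) x y) f x else 0 with hq2
      set q3 : ℕ → EuclideanSpace ℂ S := fun j => WithLp.toLp 2 fun k : S =>
        if 1 ≤ j ∧ (k : ℤ) + j ∈ S then kOp (cKer (fun t => M (-j) t - W t) (k + j)) f x else 0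
        with hq3
      set q4 : ℕ → EuclideanSpace ℂ S := fun j => WithLp.toLp 2 fun k : S =>
        if 1 ≤ j ∧ (k : ℤ) + j ∈ S then kOp (kComp (eKer k) (cKer W (k + j))) f x else 0 with hq4
      have e : (WithLp.toLp 2 fun k : S => b k : EuclideanSpace ℂ S) =
          ∑ j ∈ Finset.range (2 * N + 1), (q1 j + q2 j + q3 j + q4 j) := by
        ext k
        simp only [hb]
        rw [sum_Icc_eq_sum_range N k.2 (T k), WithLp.ofLp_sum, Finset.sum_apply]
        refine Finset.sum_congr rfl fun j _ => ?_
        simp only [hq1, hq2, hq3, hq4, PiLp.add_apply]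
        have e1 : T k (k - j) = kOp (cKer (M j) (k - j)) f x + kOp (fun x y =>
            kComp (eKer k) (cKer W (k - j)) x y - cKer W (k - j) x y) f x := by
          rw [kOp_sub_left (h.base.niceKer_kComp _ _) (h.base.niceKer _) hf,
            kOp_kComp_eKer h.base _ _ hf, hT]
          simp only [sub_sub_cancel]
          ring
        have e2 : T k (k + j) = kOp (cKer (fun t => M (-j) t - W t) (k + j)) f x +
            kOp (kComp (eKer k) (cKer W (k + j))) f x := by
          rw [h.kOp_flat j _ hf, kOp_kComp_eKer h.base _ _ hf, hT]
          simp only [sub_add_cancel_left]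
        rw [e1, e2]
        split_ifs <;> ring
      rw [e]
      refine (enorm_sum_le _ _).trans ?_
      simp only [hV1, hV2, hV3, hV4, ← Finset.sum_add_distrib]
      refine Finset.sum_le_sum fun j _ => ?_
      refine (enorm_add_le _ _).trans (add_le_add ((enorm_add_le _ _).trans
        (add_le_add ((enorm_add_le _ _).trans (add_le_add ?_ ?_)) ?_)) ?_) <;>
      · refine enorm_toLp_mono fun k => ?_
        split_ifs
        · exact le_rfl
        · simp
    calc ENNReal.ofReal lam * jumpCount lam (Set.Icc (-(N : ℤ)) N)
          (fun k => g x - eOp k g x + b k) ^ ((1 : ℝ) / 2)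
        ≤ ENNReal.ofReal lam * (jumpCount (lam / 2) (Set.Icc (-(N : ℤ)) N)
            (fun k => eOp k g x) ^ ((1 : ℝ) / 2) +
            jumpCount (lam / 2) (Set.Icc (-(N : ℤ)) N) b ^ ((1 : ℝ) / 2)) := by
          gcongr
          exact (ENNReal.rpow_le_rpow hJ (by norm_num)).trans
            (ENNReal.rpow_add_le_add_rpow _ _ (by norm_num) (by norm_num))
      _ = 2 * (ENNReal.ofReal (lam / 2) * jumpCount (lam / 2) (Set.Icc (-(N : ℤ)) N)
            (fun k => eOp k g x) ^ ((1 : ℝ) / 2)) + 2 * (ENNReal.ofReal (lam / 2) *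
            jumpCount (lam / 2) (Set.Icc (-(N : ℤ)) N) b ^ ((1 : ℝ) / 2)) := by
          have : ENNReal.ofReal lam = 2 * ENNReal.ofReal (lam / 2) := by
            rw [← ENNReal.ofReal_ofNat 2, ← ENNReal.ofReal_mul zero_le_two]
            congr 1; ring
          rw [this]
          ring
      _ ≤ 2 * F0 x + 2 * (2 * (V1 x + V2 x + V3 x + V4 x)) := by
          exact add_le_add (mul_le_mul_right (hF0j x) _)
            (mul_le_mul_right (hJb.trans (mul_le_mul_right hbv _)) _)
      _ = _ := by ring
  · set Lf := lpn p fun x => ‖f x‖ₑ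
    have b0 : lpn p F0 ≤ ENNReal.ofReal (D6 * D5) * Lf := by
      rw [ENNReal.ofReal_mul hD6.le, mul_assoc]
      exact (lpn_le_of_lintegral_le hp.le hF0p).trans
        (mul_le_mul_right (lpn_le_of_lintegral_le hp.le (H5 S f hf)) _)
    have b1 : lpn p V1 ≤ ENNReal.ofReal D1 * Lf := H1 _ S f hf
    have b2 : lpn p V2 ≤ ENNReal.ofReal D2 * Lf := H2 _ S f hf
    have b3 : lpn p V3 ≤ ENNReal.ofReal D3 * Lf := H3 _ S f hf
    have b4 : lpn p V4 ≤ ENNReal.ofReal D4 * Lf := H4 _ S f hf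
    calc _ ≤ lpn p (fun x => 2 * F0 x) + lpn p fun x => 4 * (V1 x + V2 x + V3 x + V4 x) :=
          lpn_add_le hp.le (hF0.const_mul _) ((((m1.add m2).add m3).add m4).const_mul _)
      _ = 2 * lpn p F0 + 4 * lpn p fun x => V1 x + V2 x + V3 x + V4 x := by
          rw [lpn_const_mul hp.le _ hF0, lpn_const_mul hp.le _
            (F := fun x => V1 x + V2 x + V3 x + V4 x) (((m1.add m2).add m3).add m4)]
      _ ≤ 2 * lpn p F0 + 4 * (lpn p V1 + lpn p V2 + lpn p V3 + lpn p V4) := by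
          gcongr
          exact (lpn_add_le hp.le ((m1.add m2).add m3) m4).trans (add_le_add
            ((lpn_add_le hp.le (m1.add m2) m3).trans
              (add_le_add (lpn_add_le hp.le m1 m2) le_rfl)) le_rfl)
      _ ≤ 2 * (ENNReal.ofReal (D6 * D5) * Lf) + 4 * (ENNReal.ofReal D1 * Lf +
          ENNReal.ofReal D2 * Lf + ENNReal.ofReal D3 * Lf + ENNReal.ofReal D4 * Lf) := by gcongr
      _ = _ := by
          rw [ENNReal.ofReal_add (by positivity) (by positivity), ENNReal.ofReal_mul zero_le_two,
            ENNReal.ofReal_mul (by norm_num : (0 : ℝ) ≤ 4), ENNReal.ofReal_add (by positivity) hD4,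
            ENNReal.ofReal_add (by positivity) hD3, ENNReal.ofReal_add hD1 hD2,
            ENNReal.ofReal_ofNat, ENNReal.ofReal_ofNat]
          ring

end TruncatedBound

section VanDerCorput

/-- A second-derivative van der Corput estimate with explicit constants. -/
theorem norm_integral_exp_mul_le {a b m μ σ B B' : ℝ} {φ φ₁ φ₂ w w₁ : ℝ → ℝ} (ha : 0 < a)
    (hab : a ≤ b) (hm : 0 < m) (hμ : 0 < μ) (hσ : |σ| = 1)
    (hφ : ∀ r, 0 < r → HasDerivAt φ (φ₁ r) r) (hφ₁ : ∀ r, 0 < r → HasDerivAt φ₁ (φ₂ r) r)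
    (hw : ∀ r, 0 < r → HasDerivAt w (w₁ r) r) (hlow : ∀ r ∈ Icc a b, m ≤ σ * φ₂ r)
    (hB : ∀ r ∈ Icc a b, |w r| ≤ B) (hB' : ∀ r ∈ Icc a b, |w₁ r| ≤ B') :
    ‖∫ r in a..b, Complex.exp (Complex.I * φ r) * w r‖ ≤
      (B + B' * (b - a) + B * (μ ^ 2 / m + 1) * Real.pi) / μ := by
  have hpos : ∀ r ∈ Icc a b, 0 < r := fun r hr => ha.trans_le hr.1
  have hB0 : 0 ≤ B := (abs_nonneg _).trans (hB a ⟨le_rfl, hab⟩)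
  have hB'0 : 0 ≤ B' := (abs_nonneg _).trans (hB' a ⟨le_rfl, hab⟩)
  set g : ℝ → ℂ := fun r => Complex.exp (Complex.I * φ r) * w r with hg
  set Q : ℝ → ℝ := fun r => φ₁ r ^ 2 + μ ^ 2 with hQ
  have hQ0 : ∀ r, 0 < Q r := fun r => by positivity
  set H : ℝ → ℂ := fun r => -Complex.I * (Complex.exp (Complex.I * φ r) *
    ((w r * φ₁ r / Q r : ℝ) : ℂ)) with hH
  set q₁ : ℝ → ℝ := fun r => ((w₁ r * φ₁ r + w r * φ₂ r) * Q r -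
    w r * φ₁ r * (2 * φ₁ r * φ₂ r)) / Q r ^ 2 with hq₁
  have hexp : ∀ r : ℝ, ‖Complex.exp (Complex.I * φ r)‖ = 1 := fun r => by
    rw [mul_comm]; exact Complex.norm_exp_ofReal_mul_I _
  have dQ : ∀ r, 0 < r → HasDerivAt Q (2 * φ₁ r * φ₂ r) r := fun r hr => by
    simpa [hQ] using ((hφ₁ r hr).pow 2).add_const (μ ^ 2)
  have dq : ∀ r, 0 < r → HasDerivAt (fun r => w r * φ₁ r / Q r) (q₁ r) r := fun r hr =>
    (((hw r hr).mul (hφ₁ r hr)).div (dQ r hr) (hQ0 r).ne')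
  have de : ∀ r, 0 < r → HasDerivAt (fun r => Complex.exp (Complex.I * φ r))
      (Complex.exp (Complex.I * φ r) * (Complex.I * φ₁ r)) r := fun r hr =>
    ((hφ r hr).ofReal_comp.const_mul Complex.I).cexp
  have dH : ∀ r, 0 < r → HasDerivAt H (-Complex.I * (Complex.exp (Complex.I * φ r) *
      (Complex.I * φ₁ r) * ((w r * φ₁ r / Q r : ℝ) : ℂ) +
      Complex.exp (Complex.I * φ r) * (q₁ r : ℂ))) r := fun r hr =>
    ((de r hr).mul (dq r hr).ofReal_comp).const_mul _
  have cg : ContinuousOn g (Ioi 0) := fun r hr =>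
    ((de r hr).mul (hw r hr).ofReal_comp).continuousAt.continuousWithinAt
  have ig : ∀ r, 0 < r → IntervalIntegrable g volume a r := fun r hr =>
    (cg.mono fun x hx => lt_of_lt_of_le (lt_min ha hr) hx.1).intervalIntegrable
  have dG : ∀ r, 0 < r → HasDerivAt (fun r => ∫ y in a..r, g y) (g r) r := fun r hr =>
    intervalIntegral.integral_hasDerivAt_right (ig r hr)
      (cg.stronglyMeasurableAtFilter isOpen_Ioi r hr) (cg.continuousAt (Ioi_mem_nhds hr))
  have hH_le : ∀ r ∈ Icc a b, ‖H r‖ ≤ B / (2 * μ) := fun r hr => by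
    rw [hH]
    simp only [norm_mul, norm_neg, Complex.norm_I, one_mul, hexp, Complex.norm_real,
      Real.norm_eq_abs, abs_div, abs_of_pos (hQ0 r)]
    rw [div_le_div_iff₀ (hQ0 r) (by positivity)]
    have h2 : |φ₁ r| * (2 * μ) ≤ Q r := by
      have := sq_nonneg (|φ₁ r| - μ)
      have h3 := sq_abs (φ₁ r)
      simp only [hQ]; nlinarith
    rw [abs_mul, mul_assoc]
    exact mul_le_mul (hB r hr) h2 (by positivity) hB0
  set D : ℝ → ℝ := fun r => B / (2 * μ) + B' / (2 * μ) * (r - a) +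
    B * (μ ^ 2 / m + 1) * (σ * (Real.arctan (φ₁ r / μ) - Real.arctan (φ₁ a / μ)) / μ) with hD
  have dD : ∀ r, 0 < r → HasDerivAt D (B' / (2 * μ) +
      B * (μ ^ 2 / m + 1) * (σ * φ₂ r / Q r)) r := fun r hr => by
    have h1 := (((hφ₁ r hr).div_const μ).arctan.sub_const (Real.arctan (φ₁ a / μ))).const_mul σ
    have h2 := ((((hasDerivAt_id r).sub_const a).const_mul (B' / (2 * μ))).const_add
      (B / (2 * μ))).add ((h1.div_const μ).const_mul (B * (μ ^ 2 / m + 1)))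
    refine h2.congr_deriv ?_
    have h3 : 1 + (φ₁ r / μ) ^ 2 = Q r / μ ^ 2 := by simp only [hQ]; field_simp; ring
    have := (hQ0 r).ne'
    rw [h3]
    field_simp
  have key := image_norm_le_of_norm_deriv_right_le_deriv_boundary'
    (f := fun r => (∫ y in a..r, g y) - H r) (a := a) (b := b) (B := D)
    (fun r hr => ((dG r (hpos r hr)).sub (dH r (hpos r hr))).continuousAt.continuousWithinAt)
    (fun r hr => ((dG r (hpos r (Ico_subset_Icc_self hr))).sub
      (dH r (hpos r (Ico_subset_Icc_self hr)))).hasDerivWithinAt)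
    (by simpa [hD] using hH_le a ⟨le_rfl, hab⟩)
    (fun r hr => (dD r (hpos r hr)).continuousAt.continuousWithinAt)
    (fun r hr => (dD r (hpos r (Ico_subset_Icc_self hr))).hasDerivWithinAt)
    (fun r hr' => by
      have hr := Ico_subset_Icc_self hr'
      have hQr := hQ0 r
      have e1 : g r - -Complex.I * (Complex.exp (Complex.I * φ r) *
          (Complex.I * φ₁ r) * ((w r * φ₁ r / Q r : ℝ) : ℂ) +
          Complex.exp (Complex.I * φ r) * (q₁ r : ℂ)) =
          Complex.exp (Complex.I * φ r) * (((w r * (μ ^ 2 / Q r) : ℝ) : ℂ) +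
            Complex.I * (q₁ r : ℂ)) := by
        have e2 : w r * (μ ^ 2 / Q r) = w r - φ₁ r * (w r * φ₁ r / Q r) := by
          field_simp; simp only [hQ]; ring
        rw [e2]
        simp only [hg]
        push_cast
        linear_combination (Complex.exp (Complex.I * φ r)) * (φ₁ r * (w r * φ₁ r / Q r)) *
          Complex.I_sq
      rw [e1, norm_mul, hexp, one_mul]
      refine (norm_add_le _ _).trans ?_
      rw [norm_mul, Complex.norm_I, one_mul, Complex.norm_real, Complex.norm_real,
        Real.norm_eq_abs, Real.norm_eq_abs]
      have hφ2 : |φ₂ r| = σ * φ₂ r := by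
        have h1 : 0 ≤ σ * φ₂ r := hm.le.trans (hlow r hr)
        rw [← abs_of_nonneg h1, abs_mul, hσ, one_mul]
      have t1 : |w r * (μ ^ 2 / Q r)| ≤ B * (μ ^ 2 / m) * (σ * φ₂ r / Q r) := by
        rw [abs_mul, abs_of_pos (by positivity : 0 < μ ^ 2 / Q r), mul_assoc]
        refine mul_le_mul (hB r hr) ?_ (by positivity) hB0
        rw [div_mul_div_comm, div_le_div_iff₀ hQr (by positivity)]
        have := hlow r hr
        have h5 : 0 < μ ^ 2 * Q r := by positivity
        nlinarith
      have t2 : |q₁ r| ≤ B' / (2 * μ) + B * (σ * φ₂ r / Q r) := by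
        have e3 : q₁ r = w₁ r * (φ₁ r / Q r) +
            w r * (φ₂ r / Q r * ((μ ^ 2 - φ₁ r ^ 2) / Q r)) := by
          simp only [hq₁]; field_simp; simp only [hQ]; ring
        rw [e3]
        refine (abs_add_le _ _).trans (add_le_add ?_ ?_)
        · rw [abs_mul, abs_div, abs_of_pos hQr, div_eq_mul_one_div B']
          refine mul_le_mul (hB' r hr) ?_ (by positivity) hB'0
          rw [div_le_div_iff₀ hQr (by positivity)]
          have := sq_nonneg (|φ₁ r| - μ)
          have h3 := sq_abs (φ₁ r)
          simp only [hQ]; nlinarith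
        · rw [abs_mul]
          refine mul_le_mul (hB r hr) ?_ (by positivity) hB0
          rw [abs_mul, abs_div, hφ2, abs_of_pos hQr]
          refine mul_le_of_le_one_right
            (div_nonneg (hm.le.trans (hlow r hr)) hQr.le) ?_
          rw [abs_div, abs_of_pos hQr, div_le_one hQr, abs_le]
          simp only [hQ]
          constructor <;> nlinarith [sq_nonneg μ, sq_nonneg (φ₁ r)]
      calc _ ≤ B * (μ ^ 2 / m) * (σ * φ₂ r / Q r) +
            (B' / (2 * μ) + B * (σ * φ₂ r / Q r)) := add_le_add t1 t2
        _ = _ := by ring)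
    (⟨hab, le_rfl⟩ : b ∈ Icc a b)
  have hlast : D b ≤ B / (2 * μ) + B' / (2 * μ) * (b - a) + B * (μ ^ 2 / m + 1) *
      (Real.pi / μ) := by
    simp only [hD]
    gcongr
    refine (le_abs_self _).trans ?_
    rw [abs_mul, hσ, one_mul, abs_le]
    have h1 := Real.arctan_lt_pi_div_two (φ₁ b / μ)
    have h2 := Real.neg_pi_div_two_lt_arctan (φ₁ b / μ)
    have h3 := Real.arctan_lt_pi_div_two (φ₁ a / μ)
    have h4 := Real.neg_pi_div_two_lt_arctan (φ₁ a / μ)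
    constructor <;> linarith
  have hfin : ‖∫ r in a..b, g r‖ ≤ ‖(∫ r in a..b, g r) - H b‖ + ‖H b‖ := by
    simpa using norm_add_le ((∫ r in a..b, g r) - H b) (H b)
  have hHb := hH_le b ⟨hab, le_rfl⟩
  have e : (B + B' * (b - a) + B * (μ ^ 2 / m + 1) * Real.pi) / μ =
      (B / (2 * μ) + B' / (2 * μ) * (b - a) + B * (μ ^ 2 / m + 1) * (Real.pi / μ)) +
      B / (2 * μ) + B' / (2 * μ) * (b - a) := by field_simp; ring
  have : 0 ≤ B' / (2 * μ) * (b - a) := mul_nonneg (by positivity) (by linarith)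
  rw [e]
  linarith

end VanDerCorput

section FourierMultiplier

open FourierTransform

variable {n : ℕ}

lemma SchwartzMap.niceFun (f : SchwartzMap (En n) ℂ) : NiceFun f where
  meas := f.continuous.measurable
  int := f.integrable
  bdd := by
    refine ⟨(SchwartzMap.seminorm ℝ 0 0 f).toNNReal, fun x => ?_⟩
    rw [← ofReal_norm]
    exact ENNReal.ofReal_le_ofReal (SchwartzMap.norm_le_seminorm ℝ f x)

lemma N2_fourier (f : SchwartzMap (En n) ℂ) : N2 ⇑(𝓕 f : SchwartzMap (En n) ℂ) = N2 f := by
  have h := Lp.norm_fourier_eq (f.toLp 2 volume)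
  rwa [SchwartzMap.toLp_fourier_eq, SchwartzMap.norm_toLp, SchwartzMap.norm_toLp] at h

lemma N2_kOp_schwartz_le {A : ℝ} (g : SchwartzMap (En n) ℂ) (hA : ∀ ξ, ‖𝓕 g ξ‖ ≤ A)
    (h : SchwartzMap (En n) ℂ) : N2 (kOp (fun x y => g (x - y)) h) ≤ A * N2 h := by
  have hA0 : 0 ≤ A := (norm_nonneg _).trans (hA 0)
  set c := SchwartzMap.convolution (ContinuousLinearMap.mul ℂ ℂ) h g with hc
  have e : kOp (fun x y => g (x - y)) h = c := by
    funext x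
    rw [hc, SchwartzMap.convolution_apply]
    simp only [kOp, convolution, ContinuousLinearMap.mul_apply']
    exact integral_congr_ae (Eventually.of_forall fun y => mul_comm _ _)
  rw [e, ← N2_fourier c, ← N2_fourier h]
  refine N2_le_of_lintegral_le (SchwartzMap.niceFun _) (SchwartzMap.niceFun _) hA0 ?_
  rw [← lintegral_const_mul' _ _ ENNReal.ofReal_ne_top]
  refine lintegral_mono fun ξ => ?_
  have e2 : 𝓕 c ξ = 𝓕 h ξ * 𝓕 g ξ := by
    rw [hc, SchwartzMap.fourier_convolution]; rfl
  rw [e2, enorm_mul, ENNReal.mul_rpow_of_nonneg _ _ zero_le_two, mul_comm]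
  refine mul_le_mul_left ?_ _
  rw [ENNReal.ofReal_pow hA0, ENNReal.rpow_ofNat, ← ofReal_norm]
  gcongr
  exact hA ξ

lemma N2_sub_le {f g : En n → ℂ} (hf : NiceFun f) (hg : NiceFun g) :
    N2 (fun x => f x - g x) ≤ N2 f + N2 g := by
  have h1 := hf.memLp (p := 2) (by norm_num)
  have h2 := hg.memLp (p := 2) (by norm_num)
  rw [N2, N2, N2, ← ENNReal.toReal_add h1.2.ne h2.2.ne]
  exact ENNReal.toReal_mono (ENNReal.add_lt_top.2 ⟨h1.2, h2.2⟩).ne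
    (eLpNorm_sub_le h1.1 h2.1 (by norm_num))

lemma N2_kOp_multiplier_le {A : ℝ} (g : SchwartzMap (En n) ℂ) (hA : ∀ ξ, ‖𝓕 g ξ‖ ≤ A)
    (hk : NiceKer fun x y => g (x - y)) {f : En n → ℂ} (hf : NiceFun f) :
    N2 (kOp (fun x y => g (x - y)) f) ≤ A * N2 f := by
  have hA0 : 0 ≤ A := (norm_nonneg _).trans (hA 0)
  obtain ⟨D, -, hD1, hD2⟩ := hk.bdd
  refine le_of_forall_pos_le_add fun ε hε => ?_
  set δ := ε / (A + D + 1) with hδ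
  have hδ0 : 0 < δ := by positivity
  obtain ⟨h, h1, h2, h3⟩ := MemLp.exist_eLpNorm_sub_le (by norm_num) (by norm_num)
    (hf.memLp (p := 2) (by norm_num)) hδ0
  set h' := h1.toSchwartzMap h2 with hh'
  have hn := SchwartzMap.niceFun h'
  have hd : NiceFun fun x => f x - h' x := hf.sub hn
  have hdN : N2 (fun x => f x - h' x) ≤ δ := by
    refine ENNReal.toReal_le_of_le_ofReal hδ0.le ?_
    exact h3
  have hle : N2 h' ≤ N2 f + δ := by
    have := N2_sub_le hf hd
    simp only [sub_sub_cancel] at this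
    linarith
  have e : kOp (fun x y => g (x - y)) f = fun x => kOp (fun x y => g (x - y)) h' x +
      kOp (fun x y => g (x - y)) (fun x => f x - h' x) x := by
    funext x
    rw [kOp_sub_right hk hf hn]
    ring
  have hs : N2 (kOp (fun x y => g (x - y)) fun x => f x - h' x) ≤ D * N2 fun x => f x - h' x :=
    N2_kOp_le_schur hk (a := (D : ℝ)) (b := (D : ℝ)) (c := (D : ℝ)) D.coe_nonneg D.coe_nonneg
      (le_of_eq (by ring))
      (by simpa using hD1) (by simpa using hD2) hd
  rw [e]
  calc _ ≤ A * N2 h' + D * N2 fun x => f x - h' x :=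
        (N2_add_le (hk.niceFun_kOp hn) (hk.niceFun_kOp hd)).trans
          (add_le_add (N2_kOp_schwartz_le g hA h') hs)
    _ ≤ A * (N2 f + δ) + D * δ := by gcongr
    _ ≤ A * N2 f + ε := by
        have : (A + D + 1) * δ = ε := by rw [hδ]; field_simp
        nlinarith

lemma Prof.N2_cKer_le_of_fourier {φ : En n → ℂ} {b G A : ℝ} (h : Prof φ b G)
    (hφ : ContDiff ℝ (⊤ : ℕ∞) φ) (hA : ∀ ξ, ‖𝓕 φ ξ‖ ≤ A) (s : ℤ) {f : En n → ℂ}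
    (hf : NiceFun f) : N2 (kOp (cKer φ s) f) ≤ A * N2 f := by
  set c : ℝ := (2 : ℝ) ^ s with hc
  have hc0 : 0 < c := by positivity
  set g : En n → ℂ := fun t => ((c ^ n : ℝ) : ℂ) * φ (c • t) with hg
  have g1 : ContDiff ℝ (⊤ : ℕ∞) g := contDiff_const.mul (hφ.comp (contDiff_const_smul c))
  have g2 : HasCompactSupport g := by
    refine HasCompactSupport.intro (isCompact_closedBall 0 c⁻¹) fun t ht => ?_
    rw [hg]
    simp only
    rw [h.supp, mul_zero]
    rw [norm_smul, Real.norm_of_nonneg hc0.le]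
    simp only [mem_closedBall, dist_zero_right, not_le] at ht
    rwa [inv_lt_iff_one_lt_mul₀' hc0] at ht
  have hF : ∀ ξ, ‖𝓕 (g2.toSchwartzMap g1) ξ‖ ≤ A := fun ξ => by
    have e : 𝓕 (g2.toSchwartzMap g1) ξ = 𝓕 φ (c⁻¹ • ξ) := by
      rw [SchwartzMap.fourier_coe, Real.fourier_eq', Real.fourier_eq']
      have := Measure.integral_comp_smul (volume : Measure (En n))
        (fun v => Complex.exp (↑(-2 * Real.pi * inner ℝ v (c⁻¹ • ξ)) * Complex.I) • φ v) c
      rw [finrank_euclideanSpace_fin, abs_of_pos (by positivity)] at this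
      rw [← one_smul ℝ (∫ v, _ • φ v), ← mul_inv_cancel₀ (pow_pos hc0 n).ne', mul_smul,
        ← this, ← integral_smul]
      refine integral_congr_ae (Eventually.of_forall fun v => ?_)
      change Complex.exp (↑(-2 * Real.pi * inner ℝ v ξ) * Complex.I) • g v = _
      simp only [hg, inner_smul_left, inner_smul_right, smul_eq_mul, Complex.real_smul]
      rw [conj_trivial, inv_mul_cancel_left₀ hc0.ne']
      ring
    rw [e]; exact hA _
  have e : cKer φ s = fun x y => g2.toSchwartzMap g1 (x - y) := rfl
  have hk := h.niceKer s
  rw [e] at hk ⊢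
  exact N2_kOp_multiplier_le _ hF hk hf

end FourierMultiplier

section Polar

open FourierTransform

variable {n : ℕ}

lemma integral_eq_integral_sphere_prod (hn : 1 ≤ n) (f : En n → ℂ) :
    ∫ x, f x = ∫ z : sphere (0 : En n) 1 × Ioi (0 : ℝ), f ((z.2 : ℝ) • (z.1 : En n))
      ∂((volume : Measure (En n)).toSphere.prod (Measure.volumeIoiPow (n - 1))) := by
  haveI : Nonempty (Fin n) := ⟨⟨0, hn⟩⟩
  have h := (volume : Measure (En n)).measurePreserving_homeomorphUnitSphereProd.integral_comp
    (Homeomorph.measurableEmbedding _) fun z : sphere (0 : En n) 1 × Ioi (0 : ℝ) =>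
      f ((z.2 : ℝ) • (z.1 : En n))
  rw [finrank_euclideanSpace_fin] at h
  have h0 := integral_subtype_comap (μ := (volume : Measure (En n)))
    (measurableSet_singleton (0 : En n)).compl f
  rw [restrict_compl_singleton] at h0
  rw [← h, ← h0]
  refine integral_congr_ae (Eventually.of_forall fun x => ?_)
  have hx : ‖(x : En n)‖ ≠ 0 := norm_ne_zero_iff.2 (Set.mem_compl_singleton_iff.1 x.2)
  simp [smul_smul, hx]

lemma integral_volumeIoiPow (m : ℕ) (f : ℝ → ℂ) :
    ∫ r : Ioi (0 : ℝ), f r ∂Measure.volumeIoiPow m = ∫ r in Ioi (0 : ℝ), r ^ m • f r := by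
  simp only [Measure.volumeIoiPow, ENNReal.ofReal]
  rw [integral_withDensity_eq_integral_smul (by fun_prop),
    integral_subtype_comap measurableSet_Ioi fun a => Real.toNNReal (a ^ m) • f a]
  refine setIntegral_congr_fun measurableSet_Ioi fun r hr => ?_
  rw [NNReal.smul_def, Real.coe_toNNReal _ (pow_nonneg (le_of_lt hr) _)]

/-- A radial function times a homogeneous function of mean zero has mean zero. -/
lemma integral_radial_mul_eq_zero (hn : 1 ≤ n) {Ω : En n → ℝ}
    (hΩhom : ∀ c : ℝ, 0 < c → ∀ x : En n, Ω (c • x) = Ω x)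
    (hΩmean : ∫ x : sphere (0 : En n) 1, Ω x ∂((volume : Measure (En n)).toSphere) = 0)
    (a : ℝ → ℂ) : ∫ x, (Ω x : ℂ) * a ‖x‖ = 0 := by
  rw [integral_eq_integral_sphere_prod hn]
  have h : ∀ z : sphere (0 : En n) 1 × Ioi (0 : ℝ),
      (Ω ((z.2 : ℝ) • (z.1 : En n)) : ℂ) * a ‖(z.2 : ℝ) • (z.1 : En n)‖ =
        (Ω (z.1 : En n) : ℂ) * a z.2 := fun z => by
    rw [hΩhom _ z.2.2, norm_smul, Real.norm_of_nonneg z.2.2.le, norm_eq_of_mem_sphere, mul_one]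
  simp only [h]
  rw [integral_prod_mul (fun θ : sphere (0 : En n) 1 => (Ω (θ : En n) : ℂ))
    fun r : Ioi (0 : ℝ) => a r, integral_complex_ofReal, hΩmean]
  simp

/-- Bounding an integral by its radial parts. -/
lemma norm_integral_le_of_radial (hn : 1 ≤ n) {f : En n → ℂ} {C : ℝ} (hC : 0 ≤ C)
    (h : ∀ θ : En n, ‖θ‖ = 1 → ‖∫ r in Ioi (0 : ℝ), r ^ (n - 1) • f (r • θ)‖ ≤ C) :
    ‖∫ x, f x‖ ≤ C * (volume : Measure (En n)).toSphere.real univ := by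
  rw [integral_eq_integral_sphere_prod hn]
  by_cases hi : Integrable (fun z : sphere (0 : En n) 1 × Ioi (0 : ℝ) =>
      f ((z.2 : ℝ) • (z.1 : En n)))
      ((volume : Measure (En n)).toSphere.prod (Measure.volumeIoiPow (n - 1)))
  · rw [integral_prod _ hi]
    refine norm_integral_le_of_norm_le_const (Eventually.of_forall fun θ => ?_)
    rw [integral_volumeIoiPow (n - 1) fun r => f (r • (θ : En n))]
    exact h θ (norm_eq_of_mem_sphere θ)
  · rw [integral_undef hi, norm_zero]
    positivity

end Polar

section Profiles

open FourierTransform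

variable {n : ℕ}

/-- A smooth cutoff equal to `1` on `[0, 1/2]` and vanishing on `[1, ∞)`. -/
def cutoff (r : ℝ) : ℝ := Real.smoothTransition ((4 - 4 * r ^ 2) / 3)

/-- The dyadic partition of unity generated by `cutoff`, supported in `[1/4, 1]`. -/
def annulus (r : ℝ) : ℝ := cutoff r - cutoff (2 * r)

/-- The singular kernel localized to an annulus. -/
def baseProf (Ω : En n → ℝ) (x : En n) : ℂ := ((czKernel n Ω x * annulus ‖x‖ : ℝ) : ℂ)

/-- The localized singular kernel modulated by `exp (i Λ |x| ^ α)`. -/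
def modProf (α Λ : ℝ) (Ω : En n → ℝ) (x : En n) : ℂ :=
  Complex.exp (Complex.I * (Λ : ℂ) * ((‖x‖ ^ α : ℝ) : ℂ)) * baseProf Ω x

lemma cutoff_eq_one {r : ℝ} (h0 : 0 ≤ r) (h : r ≤ 1 / 2) : cutoff r = 1 :=
  Real.smoothTransition.one_of_one_le (by rw [le_div_iff₀ (by norm_num)]; nlinarith)

lemma cutoff_eq_zero {r : ℝ} (h : 1 ≤ r) : cutoff r = 0 :=
  Real.smoothTransition.zero_of_nonpos (div_nonpos_of_nonpos_of_nonneg (by nlinarith) (by norm_num))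

lemma cutoff_nonneg (r : ℝ) : 0 ≤ cutoff r := Real.smoothTransition.nonneg _

lemma cutoff_le_one (r : ℝ) : cutoff r ≤ 1 := Real.smoothTransition.le_one _

lemma contDiff_cutoff : ContDiff ℝ (⊤ : ℕ∞) cutoff :=
  Real.smoothTransition.contDiff.comp (by fun_prop)

lemma contDiff_annulus : ContDiff ℝ (⊤ : ℕ∞) annulus :=
  contDiff_cutoff.sub (contDiff_cutoff.comp (by fun_prop))

lemma annulus_eq_zero_of_le {r : ℝ} (h0 : 0 ≤ r) (h : r ≤ 1 / 4) : annulus r = 0 := by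
  rw [annulus, cutoff_eq_one h0 (by linarith), cutoff_eq_one (by linarith) (by linarith), sub_self]

lemma annulus_eq_zero_of_ge {r : ℝ} (h : 1 ≤ r) : annulus r = 0 := by
  rw [annulus, cutoff_eq_zero h, cutoff_eq_zero (by linarith), sub_self]

lemma baseProf_eq_zero {Ω : En n → ℝ} {x : En n} (h : ‖x‖ ≤ 1 / 4 ∨ 1 ≤ ‖x‖) :
    baseProf Ω x = 0 := by
  have : annulus ‖x‖ = 0 := h.elim (annulus_eq_zero_of_le (norm_nonneg x)) annulus_eq_zero_of_ge
  rw [baseProf, this, mul_zero, Complex.ofReal_zero]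

lemma modProf_zero (α : ℝ) (Ω : En n → ℝ) : modProf α 0 Ω = baseProf Ω := by
  funext x; simp [modProf]

lemma contDiff_modProf (α Λ : ℝ) {Ω : En n → ℝ}
    (hΩ : ContDiffOn ℝ (⊤ : ℕ∞) Ω {x : En n | x ≠ 0}) :
    ContDiff ℝ (⊤ : ℕ∞) (modProf α Λ Ω) := by
  rw [contDiff_iff_contDiffAt]
  intro x
  by_cases hx : x = 0
  · subst hx
    refine (contDiffAt_const (c := (0 : ℂ))).congr_of_eventuallyEq ?_
    filter_upwards [Metric.ball_mem_nhds (0 : En n) (by norm_num : (0 : ℝ) < 1 / 4)] with y hy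
    rw [modProf, baseProf_eq_zero (Or.inl (by simpa using (mem_ball_zero_iff.1 hy).le)), mul_zero]
  · have h1 : ContDiffAt ℝ (⊤ : ℕ∞) Ω x := hΩ.contDiffAt (isOpen_ne.mem_nhds hx)
    have h2 : ContDiffAt ℝ (⊤ : ℕ∞) (fun y : En n => ‖y‖) x := contDiffAt_norm ℝ hx
    have hx' : ‖x‖ ≠ 0 := norm_ne_zero_iff.2 hx
    have h3 : ContDiffAt ℝ (⊤ : ℕ∞) (fun y : En n => ‖y‖ ^ α) x := h2.rpow_const_of_ne hx'
    have h4 : ContDiffAt ℝ (⊤ : ℕ∞) (fun y : En n => czKernel n Ω y * annulus ‖y‖) x :=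
      (h1.div (h2.pow n) (pow_ne_zero _ hx')).mul (contDiff_annulus.contDiffAt.comp x h2)
    have h5 : ∀ {g : En n → ℝ}, ContDiffAt ℝ (⊤ : ℕ∞) g x →
        ContDiffAt ℝ (⊤ : ℕ∞) (fun y => (g y : ℂ)) x := fun hg =>
      Complex.ofRealCLM.contDiff.contDiffAt.comp x hg
    exact (contDiffAt_const.mul (h5 h3)).cexp.mul (h5 h4)

lemma exists_bound_of_homogeneous (hn : 1 ≤ n) {Ω : En n → ℝ}
    (hΩ : ContDiffOn ℝ (⊤ : ℕ∞) Ω {x : En n | x ≠ 0})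
    (hΩhom : ∀ c : ℝ, 0 < c → ∀ x : En n, Ω (c • x) = Ω x) :
    ∃ C, 0 ≤ C ∧ ∀ x, x ≠ 0 → |Ω x| ≤ C := by
  have hc : ContinuousOn Ω (sphere 0 1) := hΩ.continuousOn.mono fun x hx h0 => by
    simp [h0] at hx
  obtain ⟨C, hC⟩ := (isCompact_sphere (0 : En n) 1).exists_bound_of_continuousOn hc
  refine ⟨|C|, abs_nonneg _, fun x hx => ?_⟩
  have hx' : 0 < ‖x‖ := norm_pos_iff.2 hx
  have := hC (‖x‖⁻¹ • x) (by simp [norm_smul, hx'.ne'])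
  rw [hΩhom _ (by positivity)] at this
  exact this.trans (le_abs_self C)

lemma integral_modProf (hn : 1 ≤ n) {Ω : En n → ℝ}
    (hΩhom : ∀ c : ℝ, 0 < c → ∀ x : En n, Ω (c • x) = Ω x)
    (hΩmean : ∫ x : sphere (0 : En n) 1, Ω x ∂((volume : Measure (En n)).toSphere) = 0)
    (α Λ : ℝ) : ∫ x, modProf α Λ Ω x = 0 := by
  rw [← integral_radial_mul_eq_zero hn hΩhom hΩmean fun r =>
    Complex.exp (Complex.I * (Λ : ℂ) * ((r ^ α : ℝ) : ℂ)) * ((annulus r / r ^ n : ℝ) : ℂ)]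
  refine integral_congr_ae (Eventually.of_forall fun x => ?_)
  simp only [modProf, baseProf, czKernel]
  push_cast
  ring

lemma modProf_hasCompactSupport (α Λ : ℝ) (Ω : En n → ℝ) : HasCompactSupport (modProf α Λ Ω) :=
  HasCompactSupport.intro (isCompact_closedBall 0 1) fun x hx => by
    rw [modProf, baseProf_eq_zero (Or.inr ?_), mul_zero]
    simp only [mem_closedBall, dist_zero_right, not_le] at hx
    exact hx.le

lemma exists_baseProf_bounds {Ω : En n → ℝ} (hΩ : ContDiffOn ℝ (⊤ : ℕ∞) Ω {x : En n | x ≠ 0}) :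
    ∃ B, 0 ≤ B ∧ (∀ x, ‖baseProf Ω x‖ ≤ B) ∧
      ∀ x y, ‖baseProf Ω x - baseProf Ω y‖ ≤ B * ‖x - y‖ := by
  have h1 := contDiff_modProf 0 0 hΩ
  have h2 := modProf_hasCompactSupport 0 0 Ω
  rw [modProf_zero] at h1 h2
  obtain ⟨L, hL⟩ := h1.lipschitzWith_of_hasCompactSupport h2 (by simp)
  obtain ⟨C, hC⟩ := h1.continuous.bounded_above_of_compact_support h2
  refine ⟨max C L, le_max_of_le_right L.2, fun x => (hC x).trans (le_max_left _ _), fun x y => ?_⟩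
  exact (hL.norm_sub_le x y).trans (by gcongr; exact le_max_right _ _)

/-- The function `|x| ^ α`, truncated to the annulus `1/4 ≤ |x| ≤ 1`, is Lipschitz. -/
lemma exists_clamped_rpow (α : ℝ) (hα : 0 < α) :
    ∃ (g : En n → ℝ) (L : ℝ), 0 ≤ L ∧ (∀ x, 1 / 4 < ‖x‖ → ‖x‖ < 1 → g x = ‖x‖ ^ α) ∧
      (∀ x, |g x| ≤ 1) ∧ ∀ x y, |g x - g y| ≤ L * ‖x - y‖ := by
  have hs : ContDiffOn ℝ 1 (fun r : ℝ => r ^ α) (Icc (1 / 4) 1) := fun r hr =>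
    (Real.contDiffAt_rpow_const_of_ne (by linarith [hr.1] : r ≠ 0)).contDiffWithinAt
  obtain ⟨L, hL⟩ := hs.exists_lipschitzOnWith one_ne_zero (convex_Icc _ _) isCompact_Icc
  set c : ℝ → ℝ := fun r => max (1 / 4) (min r 1) with hc
  have hcm : ∀ r, c r ∈ Icc (1 / 4 : ℝ) 1 := fun r =>
    ⟨le_max_left _ _, max_le (by norm_num) (min_le_right _ _)⟩
  have hcl : ∀ r s, |c r - c s| ≤ |r - s| := fun r s => by
    have h1 := abs_max_sub_max_le_abs (min r 1) (min s 1) (1 / 4 : ℝ)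
    have h2 := abs_min_sub_min_le_max r 1 s (1 : ℝ)
    simp only [hc]
    rw [max_comm (1 / 4), max_comm (1 / 4)]
    refine h1.trans (h2.trans ?_)
    simp
  refine ⟨fun x => c ‖x‖ ^ α, L, L.2, fun x h1 h2 => ?_, fun x => ?_, fun x y => ?_⟩
  · simp only [hc]
    rw [min_eq_left h2.le, max_eq_right h1.le]
  · have h0 : 0 ≤ c ‖x‖ := le_trans (by norm_num) (hcm ‖x‖).1
    rw [abs_of_nonneg (Real.rpow_nonneg h0 _)]
    exact Real.rpow_le_one h0 (hcm _).2 hα.le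
  · have := hL.norm_sub_le (hcm ‖x‖) (hcm ‖y‖)
    rw [Real.norm_eq_abs, Real.norm_eq_abs] at this
    refine this.trans ?_
    gcongr
    exact (hcl _ _).trans (abs_norm_sub_norm_le x y)

lemma norm_exp_I_sub_exp_I_le (a b : ℝ) :
    ‖Complex.exp (Complex.I * a) - Complex.exp (Complex.I * b)‖ ≤ |a - b| := by
  have h : Complex.exp (Complex.I * a) - Complex.exp (Complex.I * b) =
      Complex.exp (Complex.I * b) * (Complex.exp (Complex.I * ((a - b : ℝ) : ℂ)) - 1) := by
    rw [mul_sub, mul_one, ← Complex.exp_add]; push_cast; ring_nf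
  rw [h, norm_mul, mul_comm Complex.I (b : ℂ), Complex.norm_exp_ofReal_mul_I, one_mul]
  exact Real.norm_exp_I_mul_ofReal_sub_one_le

end Profiles

section ProfileFamily

open FourierTransform

variable {n : ℕ}

lemma exists_fourier_modProf_bound (hn : 1 ≤ n) {α : ℝ} (hα : 0 < α) (hα1 : α ≠ 1)
    {Ω : En n → ℝ} (hΩ : ContDiffOn ℝ (⊤ : ℕ∞) Ω {x : En n | x ≠ 0})
    (hΩhom : ∀ c : ℝ, 0 < c → ∀ x : En n, Ω (c • x) = Ω x) :
    ∃ A, 0 ≤ A ∧ ∀ Λ, 0 < Λ → ∀ ξ, ‖𝓕 (modProf α Λ Ω) ξ‖ ≤ A * Λ ^ (-(1 / 2) : ℝ) := by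
  obtain ⟨D, hD0, hD⟩ := exists_bound_of_homogeneous hn hΩ hΩhom
  set w : ℝ → ℝ := fun r => annulus r / r with hw
  set w₁ : ℝ → ℝ := fun r => (deriv annulus r * r - annulus r * 1) / r ^ 2 with hw₁
  have hd : Differentiable ℝ annulus := contDiff_annulus.differentiable (by simp)
  have hdw : ∀ r, 0 < r → HasDerivAt w (w₁ r) r := fun r hr =>
    ((hd r).hasDerivAt.div (hasDerivAt_id r) hr.ne')
  have hne : ∀ r ∈ Icc (1 / 4 : ℝ) 1, r ≠ 0 := fun r hr => by linarith [hr.1]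
  have cw : ContinuousOn w (Icc (1 / 4) 1) :=
    contDiff_annulus.continuous.continuousOn.div continuousOn_id hne
  have cw₁ : ContinuousOn w₁ (Icc (1 / 4) 1) := by
    have h1 : Continuous (deriv annulus) := contDiff_annulus.continuous_deriv (by simp)
    exact (((h1.mul continuous_id).sub
      (contDiff_annulus.continuous.mul continuous_const)).continuousOn).div
      (continuous_pow 2).continuousOn fun r hr => pow_ne_zero 2 (hne r hr)
  obtain ⟨B, hB⟩ := isCompact_Icc.exists_bound_of_continuousOn cw
  obtain ⟨B', hB'⟩ := isCompact_Icc.exists_bound_of_continuousOn cw₁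
  have hB0 : 0 ≤ B := (norm_nonneg _).trans (hB 1 (by norm_num))
  have hB'0 : 0 ≤ B' := (norm_nonneg _).trans (hB' 1 (by norm_num))
  have ck : ContinuousOn (fun r : ℝ => r ^ (α - 2)) (Icc (1 / 4) 1) := fun r hr =>
    (Real.continuousAt_rpow_const _ _ (Or.inl (hne r hr))).continuousWithinAt
  obtain ⟨r₀, hr₀, hmin⟩ := isCompact_Icc.exists_isMinOn ⟨1, by norm_num⟩ ck
  set κ : ℝ := r₀ ^ (α - 2) with hκ
  have hκ0 : 0 < κ := Real.rpow_pos_of_pos (by linarith [hr₀.1]) _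
  set σ : ℝ := ((SignType.sign (α - 1) : SignType) : ℝ) with hσ
  have hσabs : |σ| = 1 := by
    rcases lt_or_gt_of_ne (sub_ne_zero.2 hα1) with h | h
    · simp [hσ, sign_neg h]
    · simp [hσ, sign_pos h]
  have hσm : σ * (α - 1) = |α - 1| := sign_mul_self _
  have hα' : 0 < |α - 1| := abs_pos.2 (sub_ne_zero.2 hα1)
  set m₀ := α * |α - 1| * κ with hm₀
  have hm₀0 : 0 < m₀ := by positivity
  set E := B + B' * (1 - 1 / 4) + B * (1 / m₀ + 1) * Real.pi with hE
  have hE0 : 0 ≤ E := by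
    have := Real.pi_pos
    have : 0 ≤ B' * (1 - 1 / 4) := mul_nonneg hB'0 (by norm_num)
    positivity
  refine ⟨D * E * (volume : Measure (En n)).toSphere.real univ, by positivity, fun Λ hΛ ξ => ?_⟩
  have hsq : Λ ^ (-(1 / 2) : ℝ) = (√Λ)⁻¹ := by
    rw [Real.rpow_neg hΛ.le, Real.sqrt_eq_rpow]
  rw [Real.fourier_eq', hsq]
  have hrad := norm_integral_le_of_radial hn (C := D * (E / √Λ))
    (f := fun v => Complex.exp (↑(-2 * Real.pi * inner ℝ v ξ) * Complex.I) • modProf α Λ Ω v)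
    (by positivity) fun θ hθ => ?_
  · refine hrad.trans (le_of_eq ?_)
    field_simp
  set c : ℝ := 2 * Real.pi * inner ℝ θ ξ with hc
  set φ : ℝ → ℝ := fun r => Λ * r ^ α - c * r with hφ
  set φ₁ : ℝ → ℝ := fun r => Λ * (α * r ^ (α - 1)) - c with hφ₁
  set φ₂ : ℝ → ℝ := fun r => Λ * (α * ((α - 1) * r ^ (α - 1 - 1))) with hφ₂
  have hdφ : ∀ r, 0 < r → HasDerivAt φ (φ₁ r) r := fun r hr => by
    have := ((Real.hasDerivAt_rpow_const (p := α) (Or.inl hr.ne')).const_mul Λ).sub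
      ((hasDerivAt_id r).const_mul c)
    rw [mul_one] at this
    exact this
  have hdφ₁ : ∀ r, 0 < r → HasDerivAt φ₁ (φ₂ r) r := fun r hr =>
    (((Real.hasDerivAt_rpow_const (p := α - 1) (Or.inl hr.ne')).const_mul α).const_mul Λ).sub_const c
  have hvdc := norm_integral_exp_mul_le (a := 1 / 4) (b := 1) (m := Λ * m₀) (μ := √Λ) (σ := σ)
    (by norm_num) (by norm_num) (by positivity) (Real.sqrt_pos.2 hΛ) hσabs hdφ hdφ₁ hdw
    (fun r hr => by
      have h1 : κ ≤ r ^ (α - 2) := hmin hr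
      have h2 : σ * φ₂ r = Λ * (α * |α - 1| * r ^ (α - 2)) := by
        simp only [hφ₂]
        rw [← hσm, show α - 1 - 1 = α - 2 by ring]
        ring
      rw [h2]
      simp only [hm₀]
      gcongr) hB hB'
  have hfin : (B + B' * (1 - 1 / 4) + B * (√Λ ^ 2 / (Λ * m₀) + 1) * Real.pi) / √Λ = E / √Λ := by
    rw [Real.sq_sqrt hΛ.le, hE]
    congr 5
    field_simp
  rw [hfin] at hvdc
  have hθ0 : θ ≠ 0 := fun h => by simp [h] at hθ
  have hval : ∀ r : ℝ, 0 < r → r ^ (n - 1) • (Complex.exp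
      (↑(-2 * Real.pi * inner ℝ (r • θ) ξ) * Complex.I) • modProf α Λ Ω (r • θ)) =
      (Ω θ : ℂ) * (Complex.exp (Complex.I * φ r) * w r) := fun r hr => by
    have hr' : (r : ℂ) ≠ 0 := Complex.ofReal_ne_zero.2 hr.ne'
    obtain ⟨k, rfl⟩ : ∃ k, n = k + 1 := ⟨n - 1, by omega⟩
    simp only [modProf, baseProf, czKernel, hΩhom r hr, norm_smul, Real.norm_of_nonneg hr.le, hθ,
      mul_one, inner_smul_left, conj_trivial, hw, smul_eq_mul, Complex.real_smul,
      Nat.add_sub_cancel]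
    have e1 : Complex.exp (Complex.I * φ r) =
        Complex.exp (↑(-2 * Real.pi * (r * inner ℝ θ ξ)) * Complex.I) *
          Complex.exp (Complex.I * Λ * ((r ^ α : ℝ) : ℂ)) := by
      rw [← Complex.exp_add]
      congr 1
      simp only [hφ, hc]
      push_cast
      ring
    rw [e1]
    push_cast
    field_simp
    ring
  rw [setIntegral_congr_fun measurableSet_Ioi hval, integral_const_mul, norm_mul,
    Complex.norm_real]
  refine mul_le_mul (hD θ hθ0) ?_ (norm_nonneg _) hD0
  rw [intervalIntegral.integral_of_le (by norm_num)] at hvdc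
  rwa [setIntegral_eq_of_subset_of_forall_sdiff_eq_zero measurableSet_Ioi
    (fun r (hr : r ∈ Ioc (1 / 4 : ℝ) 1) => lt_trans (by norm_num) hr.1)]
  intro r hr
  have : annulus r = 0 := by
    have h0 : (0 : ℝ) < r := hr.1
    by_cases h : r ≤ 1 / 4
    · exact annulus_eq_zero_of_le h0.le h
    · refine annulus_eq_zero_of_ge ?_
      by_contra h'
      exact hr.2 ⟨not_le.1 h, (not_le.1 h').le⟩
  simp [hw, this]

theorem exists_profFam (hn : 1 ≤ n) {α : ℝ} (hα : 0 < α) (hα1 : α ≠ 1)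
    {Ω : En n → ℝ} (hΩ : ContDiffOn ℝ (⊤ : ℕ∞) Ω {x : En n | x ≠ 0})
    (hΩhom : ∀ c : ℝ, 0 < c → ∀ x : En n, Ω (c • x) = Ω x)
    (hΩmean : ∫ x : sphere (0 : En n) 1, Ω x ∂((volume : Measure (En n)).toSphere) = 0) :
    ∃ K, ProfFam (baseProf Ω) (fun j : ℤ => modProf α ((2 : ℝ) ^ ((j : ℝ) * α)) Ω)
      ((2 : ℝ) ^ α) K := by
  obtain ⟨A, hA0, hA⟩ := exists_fourier_modProf_bound hn hα hα1 hΩ hΩhom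
  obtain ⟨B, hB0, hB, hBl⟩ := exists_baseProf_bounds hΩ
  obtain ⟨g, L, hL0, hgeq, hg1, hgl⟩ := exists_clamped_rpow (n := n) α hα
  have hmod : ∀ Λ x, modProf α Λ Ω x = Complex.exp (Complex.I * ((Λ * g x : ℝ) : ℂ)) *
      baseProf Ω x := fun Λ x => by
    by_cases h : ‖x‖ ≤ 1 / 4 ∨ 1 ≤ ‖x‖
    · simp [modProf, baseProf_eq_zero h]
    · push Not at h
      rw [modProf, hgeq x h.1 h.2]
      push_cast
      ring_nf
  have hmeas : ∀ Λ, Measurable (modProf α Λ Ω) := fun Λ =>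
    (contDiff_modProf α Λ hΩ).continuous.measurable
  have hsupp : ∀ Λ t, 1 < ‖t‖ → modProf α Λ Ω t = 0 := fun Λ t ht => by
    rw [modProf, baseProf_eq_zero (Or.inr ht.le), mul_zero]
  have hmean := integral_modProf hn hΩhom hΩmean α
  have hintg : ∀ Λ, Integrable (modProf α Λ Ω) := fun Λ =>
    (contDiff_modProf α Λ hΩ).continuous.integrable_of_hasCompactSupport
      (modProf_hasCompactSupport α Λ Ω)
  have hexp : ∀ r : ℝ, ‖Complex.exp (Complex.I * r)‖ = 1 := fun r => by
    rw [mul_comm]; exact Complex.norm_exp_ofReal_mul_I _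
  have hel : ∀ Λ, 0 ≤ Λ → ∀ x y, ‖Complex.exp (Complex.I * ((Λ * g x : ℝ) : ℂ)) -
      Complex.exp (Complex.I * ((Λ * g y : ℝ) : ℂ))‖ ≤ Λ * (L * ‖x - y‖) := fun Λ hΛ x y => by
    refine (norm_exp_I_sub_exp_I_le _ _).trans ?_
    rw [← mul_sub, abs_mul, abs_of_nonneg hΛ]
    gcongr
    exact hgl x y
  have hprof : ∀ Λ, 0 ≤ Λ → Prof (modProf α Λ Ω) B (Λ * L * B + B) := fun Λ hΛ =>
    { meas := hmeas Λ
      supp := hsupp Λ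
      bdd := fun t => by rw [hmod, norm_mul, hexp, one_mul]; exact hB t
      lip := fun t t' => by
        rw [hmod, hmod]
        have e : ∀ a b c d : ℂ, a * c - b * d = (a - b) * c + b * (c - d) := fun a b c d => by ring
        rw [e]
        refine (norm_add_le _ _).trans ?_
        rw [norm_mul, norm_mul, hexp, one_mul, add_mul]
        refine add_le_add ?_ (hBl t t')
        refine (mul_le_mul (hel Λ hΛ t t') (hB t) (norm_nonneg _) (by positivity)).trans
          (le_of_eq (by ring))
      mean := hmean Λ }
  have hflat : ∀ Λ, 0 ≤ Λ → Prof (fun t => modProf α Λ Ω t - baseProf Ω t) (Λ * B)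
      (Λ * L * B + Λ * B) := fun Λ hΛ =>
    have hone : ∀ t, ‖Complex.exp (Complex.I * ((Λ * g t : ℝ) : ℂ)) - 1‖ ≤ Λ := fun t => by
      refine (Real.norm_exp_I_mul_ofReal_sub_one_le).trans ?_
      rw [norm_mul, Real.norm_of_nonneg hΛ]
      exact mul_le_of_le_one_right hΛ (hg1 t)
    { meas := by
        have := hmeas 0
        rw [modProf_zero] at this
        exact (hmeas Λ).sub this
      supp := fun t ht => by rw [hsupp Λ t ht, baseProf_eq_zero (Or.inr ht.le), sub_self]
      bdd := fun t => by
        rw [hmod, ← sub_one_mul, norm_mul]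
        exact mul_le_mul (hone t) (hB t) (norm_nonneg _) hΛ
      lip := fun t t' => by
        rw [hmod, hmod]
        have e : ∀ a b c d : ℂ, a * c - c - (b * d - d) = (a - b) * c + (b - 1) * (c - d) :=
          fun a b c d => by ring
        rw [e]
        refine (norm_add_le _ _).trans ?_
        rw [norm_mul, norm_mul, add_mul]
        refine add_le_add ((mul_le_mul (hel Λ hΛ t t') (hB t) (norm_nonneg _)
          (by positivity)).trans (le_of_eq (by ring))) ?_
        rw [mul_assoc]
        exact mul_le_mul (hone t') (hBl t t') (norm_nonneg _) hΛ
      mean := by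
        have h0 := hmean 0
        have i0 := hintg 0
        rw [modProf_zero] at h0 i0
        rw [integral_sub (hintg Λ) i0, hmean, h0, sub_zero] }
  have hmono : ∀ {φ : En n → ℂ} {b b' G G' : ℝ}, Prof φ b G → b ≤ b' → G ≤ G' → Prof φ b' G' :=
    fun h hb hG => ⟨h.meas, h.supp, fun t => (h.bdd t).trans hb, fun t t' => (h.lip t t').trans
      (mul_le_mul_of_nonneg_right hG (norm_nonneg _)), h.mean⟩
  have hβ : 1 < (2 : ℝ) ^ α := Real.one_lt_rpow one_lt_two hα
  have hpow : ∀ j : ℕ, (2 : ℝ) ^ (((j : ℤ) : ℝ) * α) = ((2 : ℝ) ^ α) ^ j := fun j => by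
    rw [mul_comm, Real.rpow_mul zero_le_two, Int.cast_natCast, Real.rpow_natCast]
  have hpow' : ∀ j : ℕ, (2 : ℝ) ^ (((-(j : ℤ) : ℤ) : ℝ) * α) = (((2 : ℝ) ^ α) ^ j)⁻¹ := fun j => by
    rw [← hpow, ← Real.rpow_neg zero_le_two]
    push_cast
    ring_nf
  set K := 1 + A + B + L * B with hK
  have hLB : 0 ≤ L * B := by positivity
  refine ⟨K, hβ, by linarith, ?_, fun j => ?_, fun j => ?_, fun j s f hf => ?_⟩
  · have := hprof 0 le_rfl
    rw [modProf_zero] at this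
    exact hmono this (by linarith) (by linarith)
  · rw [hpow]
    have h1 : 1 ≤ ((2 : ℝ) ^ α) ^ j := one_le_pow₀ hβ.le
    refine hmono (hprof _ (by positivity)) (by linarith) ?_
    nlinarith
  · rw [hpow']
    have h1 : 0 < (((2 : ℝ) ^ α) ^ j)⁻¹ := by positivity
    refine hmono (hflat _ h1.le) ?_ ?_ <;> nlinarith
  · rw [hpow]
    have h1 : 0 < ((2 : ℝ) ^ α) ^ j := by positivity
    refine ((hprof _ h1.le).N2_cKer_le_of_fourier (contDiff_modProf α _ hΩ)
      (hA _ h1) s hf).trans ?_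
    have : 0 ≤ (((2 : ℝ) ^ α) ^ j) ^ (-(1 / 2) : ℝ) := by positivity
    refine mul_le_mul_of_nonneg_right (mul_le_mul_of_nonneg_right ?_ this) (N2_nonneg _)
    linarith

end ProfileFamily

section PrincipalValue

variable {n : ℕ}

lemma SchwartzMap.exists_norm_sub_le (f : SchwartzMap (En n) ℂ) :
    ∃ C, 0 ≤ C ∧ ∀ x y, ‖f x - f y‖ ≤ C * ‖x - y‖ := by
  refine ⟨SchwartzMap.seminorm ℝ 0 0 (SchwartzMap.fderivCLM ℝ (En n) ℂ f), apply_nonneg _ _,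
    fun x y => ?_⟩
  refine Convex.norm_image_sub_le_of_norm_fderiv_le (𝕜 := ℝ) (s := univ) (fun z _ => ?_)
    (fun z _ => ?_) convex_univ (mem_univ y) (mem_univ x)
  · exact f.differentiableAt
  · exact SchwartzMap.norm_le_seminorm ℝ (SchwartzMap.fderivCLM ℝ (En n) ℂ f) z

lemma integrableOn_norm_div_pow (hn : 1 ≤ n) :
    IntegrableOn (fun x : En n => ‖x‖ / ‖x‖ ^ n) (ball 0 2) := by
  haveI : Nonempty (Fin n) := ⟨⟨0, hn⟩⟩
  have h := integrableOn_fun_norm_addHaar (volume : Measure (En n)) (f := fun r : ℝ => r / r ^ n)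
    (r := 2)
  refine h.2 ?_
  rw [finrank_euclideanSpace_fin]
  refine (integrableOn_congr_fun (g := fun _ => (1 : ℝ)) (fun r hr => ?_) measurableSet_Ioo).2 ?_
  · have hr0 : r ≠ 0 := hr.1.ne'
    obtain ⟨k, rfl⟩ : ∃ k, n = k + 1 := ⟨n - 1, by omega⟩
    simp only [Nat.add_sub_cancel, smul_eq_mul]
    field_simp
    ring
  · exact integrableOn_const (by simp)

lemma abs_czKernel_le {Ω : En n → ℝ} {D : ℝ} (hD : ∀ x, x ≠ 0 → |Ω x| ≤ D) {t : En n}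
    (ht : t ≠ 0) : ‖(czKernel n Ω t : ℂ)‖ ≤ D / ‖t‖ ^ n := by
  rw [Complex.norm_real, czKernel, Real.norm_eq_abs, abs_div,
    abs_of_nonneg (pow_nonneg (norm_nonneg t) n)]
  exact div_le_div_of_nonneg_right (hD t ht) (by positivity)

/-- Radial truncations of the modulated singular integral all converge to the same limit. -/
lemma exists_tendsto_truncations (hn : 1 ≤ n) (α u : ℝ)
    {Ω : En n → ℝ} (hΩ : ContDiffOn ℝ (⊤ : ℕ∞) Ω {x : En n | x ≠ 0})
    (hΩhom : ∀ c : ℝ, 0 < c → ∀ x : En n, Ω (c • x) = Ω x)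
    (hΩmean : ∫ x : sphere (0 : En n) 1, Ω x ∂((volume : Measure (En n)).toSphere) = 0)
    (f : SchwartzMap (En n) ℂ) (x : En n) :
    ∃ I : ℂ, ∀ {ι : Type} (l : Filter ι) [l.IsCountablyGenerated] (χ : ι → ℝ → ℝ),
      (∀ i, Measurable (χ i)) → (∀ i r, |χ i r| ≤ 1) →
      (∀ᶠ i in l, ∃ δ > 0, ∀ r < δ, χ i r = 0) → (∀ r > 0, Tendsto (fun i => χ i r) l (𝓝 1)) →
      Tendsto (fun i => ∫ t, f (x - t) * Complex.exp (Complex.I * (u : ℂ) *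
        ((‖t‖ ^ α : ℝ) : ℂ)) * (czKernel n Ω t : ℂ) * (χ i ‖t‖ : ℂ)) l (𝓝 I) := by
  haveI : Nonempty (Fin n) := ⟨⟨0, hn⟩⟩
  obtain ⟨D, hD0, hD⟩ := exists_bound_of_homogeneous hn hΩ hΩhom
  obtain ⟨C, hC0, hC⟩ := f.exists_norm_sub_le
  set E : ℝ → ℂ := fun r => Complex.exp (Complex.I * (u : ℂ) * ((r ^ α : ℝ) : ℂ)) with hE
  have hE1 : ∀ r, ‖E r‖ = 1 := fun r => by
    have : Complex.I * (u : ℂ) * ((r ^ α : ℝ) : ℂ) = ((u * r ^ α : ℝ) : ℂ) * Complex.I := by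
      push_cast; ring
    rw [hE]
    simp only [this]
    exact Complex.norm_exp_ofReal_mul_I _
  have mE : Measurable E := by
    have : Measurable fun r : ℝ => r ^ α := measurable_id.pow_const α
    fun_prop
  have mE' : Measurable fun t : En n => E ‖t‖ := mE.comp measurable_norm
  have mK : AEStronglyMeasurable (fun t : En n => (czKernel n Ω t : ℂ)) volume := by
    have h1 : ContinuousOn (fun t : En n => (czKernel n Ω t : ℂ)) ({0}ᶜ : Set (En n)) := by
      refine Complex.continuous_ofReal.comp_continuousOn (hΩ.continuousOn.div
        (continuous_norm.pow n).continuousOn fun t ht => ?_)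
      exact pow_ne_zero _ (norm_ne_zero_iff.2 ht)
    have h2 := h1.aestronglyMeasurable (μ := volume) (measurableSet_singleton (0 : En n)).compl
    rwa [restrict_compl_singleton] at h2
  set c : En n → ℂ := (closedBall (0 : En n) 1).indicator fun _ => f x with hc
  have mc : Measurable c := measurable_const.indicator measurableSet_closedBall
  set G : En n → ℂ := fun t => (f (x - t) - c t) * E ‖t‖ * (czKernel n Ω t : ℂ) with hG
  have mG : AEStronglyMeasurable G volume :=
    ((((f.continuous.measurable.comp (measurable_const.sub measurable_id)).sub mc).mul
      mE').aestronglyMeasurable).mul mK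
  have hne : ∀ᵐ t : En n, t ≠ 0 := by simp [ae_iff]
  have iG : Integrable G := by
    have i1 : Integrable fun t : En n => C * D * (ball (0 : En n) 2).indicator
        (fun t => ‖t‖ / ‖t‖ ^ n) t :=
      ((integrable_indicator_iff measurableSet_ball).2 (integrableOn_norm_div_pow hn)).const_mul _
    have i2 : Integrable fun t : En n => D * ‖f (x - t)‖ :=
      ((f.integrable.comp_sub_left x).norm).const_mul D
    refine (i1.add i2).mono' mG ?_
    filter_upwards [hne] with t ht
    have ht' : 0 < ‖t‖ := norm_pos_iff.2 ht
    have hK := abs_czKernel_le hD ht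
    simp only [hG, Pi.add_apply, norm_mul, hE1, mul_one]
    by_cases h1 : ‖t‖ ≤ 1
    · have e1 : c t = f x := indicator_of_mem (by simpa using h1) _
      have e2 : (ball (0 : En n) 2).indicator (fun t => ‖t‖ / ‖t‖ ^ n) t = ‖t‖ / ‖t‖ ^ n :=
        indicator_of_mem (by simp; linarith) _
      have h3 : ‖f (x - t) - f x‖ ≤ C * ‖t‖ := by simpa using hC (x - t) x
      rw [e1, e2]
      have h4 := mul_le_mul h3 hK (norm_nonneg _) (by positivity)
      have h5 : C * ‖t‖ * (D / ‖t‖ ^ n) = C * D * (‖t‖ / ‖t‖ ^ n) := by ring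
      have h6 : 0 ≤ D * ‖f (x - t)‖ := by positivity
      linarith
    · have e1 : c t = 0 := indicator_of_notMem (by simpa using h1) _
      have h3 : 0 ≤ C * D * (ball (0 : En n) 2).indicator (fun t => ‖t‖ / ‖t‖ ^ n) t :=
        mul_nonneg (by positivity) (indicator_nonneg (fun t _ => by positivity) t)
      have h4 : D / ‖t‖ ^ n ≤ D := div_le_self hD0 (one_le_pow₀ (not_le.1 h1).le)
      rw [e1, sub_zero, mul_comm D]
      have h5 := mul_le_mul_of_nonneg_left (hK.trans h4) (norm_nonneg (f (x - t)))
      linarith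
  refine ⟨∫ t, G t, fun {ι} l _ χ hm hb hz ht => ?_⟩
  have mχ : ∀ i, Measurable fun t : En n => (χ i ‖t‖ : ℂ) := fun i =>
    Complex.measurable_ofReal.comp ((hm i).comp measurable_norm)
  have hχ : ∀ i (t : En n), ‖(χ i ‖t‖ : ℂ)‖ ≤ 1 := fun i t => by
    rw [Complex.norm_real]; exact hb i _
  have hlim : Tendsto (fun i => ∫ t, G t * (χ i ‖t‖ : ℂ)) l (𝓝 (∫ t, G t)) := by
    refine tendsto_integral_filter_of_dominated_convergence (fun t => ‖G t‖)
      (Eventually.of_forall fun i => mG.mul (mχ i).aestronglyMeasurable)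
      (Eventually.of_forall fun i => Eventually.of_forall fun t => ?_) iG.norm ?_
    · rw [norm_mul]
      exact mul_le_of_le_one_right (norm_nonneg _) (hχ i t)
    · filter_upwards [hne] with t ht0
      have h1 := ht ‖t‖ (norm_pos_iff.2 ht0)
      have h2 := ((Complex.continuous_ofReal.tendsto 1).comp h1).const_mul (G t)
      simpa using h2
  refine hlim.congr' ?_
  filter_upwards [hz] with i hi
  obtain ⟨δ, hδ, hδ0⟩ := hi
  set R : En n → ℂ := fun t => c t * E ‖t‖ * (czKernel n Ω t : ℂ) * (χ i ‖t‖ : ℂ) with hR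
  have iGχ : Integrable fun t => G t * (χ i ‖t‖ : ℂ) :=
    iG.mul_bdd (c := 1) (mχ i).aestronglyMeasurable (Eventually.of_forall (hχ i))
  have iR : Integrable R := by
    have i1 : Integrable ((closedBall (0 : En n) 1).indicator fun _ => ‖f x‖ * (D / δ ^ n)) :=
      (integrable_indicator_iff measurableSet_closedBall).2
        (integrableOn_const (measure_closedBall_lt_top).ne)
    refine i1.mono' (((mc.mul mE').aestronglyMeasurable.mul mK).mul
      (mχ i).aestronglyMeasurable) ?_
    filter_upwards [hne] with t ht0
    by_cases h1 : t ∈ closedBall (0 : En n) 1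
    · have e1 : c t = f x := indicator_of_mem h1 _
      rw [indicator_of_mem h1]
      simp only [hR, norm_mul, hE1, mul_one, e1]
      by_cases h2 : ‖t‖ < δ
      · rw [hδ0 _ h2]
        simp only [Complex.ofReal_zero, norm_zero, mul_zero]
        positivity
      · have h3 := abs_czKernel_le hD ht0
        have h4 : D / ‖t‖ ^ n ≤ D / δ ^ n := by
          have := not_lt.1 h2
          gcongr
        have h5 := mul_le_mul_of_nonneg_left (h3.trans h4) (norm_nonneg (f x))
        exact (mul_le_of_le_one_right (by positivity) (hχ i t)).trans h5
    · have e1 : c t = 0 := indicator_of_notMem h1 _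
      rw [indicator_of_notMem h1]
      simp [hR, e1]
  have hR0 : ∫ t, R t = 0 := by
    have h := integral_radial_mul_eq_zero hn hΩhom hΩmean fun r =>
      (Iic (1 : ℝ)).indicator (fun _ => f x) r * E r * (χ i r : ℂ) * ((r ^ n : ℝ) : ℂ)⁻¹
    rw [← h]
    refine integral_congr_ae (Eventually.of_forall fun t => ?_)
    have e1 : c t = (Iic (1 : ℝ)).indicator (fun _ => f x) ‖t‖ := by
      simp only [hc, indicator, mem_closedBall, dist_zero_right, mem_Iic]
    simp only [hR, e1, czKernel]
    push_cast
    ring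
  have : ∀ t, f (x - t) * Complex.exp (Complex.I * (u : ℂ) * ((‖t‖ ^ α : ℝ) : ℂ)) *
      (czKernel n Ω t : ℂ) * (χ i ‖t‖ : ℂ) = G t * (χ i ‖t‖ : ℂ) + R t := fun t => by
    simp only [hG, hR, hE]; ring
  simp only [this]
  rw [integral_add iGχ iR, hR0, add_zero]

lemma sum_annulus (N : ℕ) (r : ℝ) : ∑ l ∈ Finset.Icc (-(N : ℤ)) N, annulus ((2 : ℝ) ^ l * r) =
    cutoff ((2 : ℝ) ^ (-(N : ℤ)) * r) - cutoff ((2 : ℝ) ^ ((N : ℤ) + 1) * r) := by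
  induction N with
  | zero => simp [annulus]
  | succ N ih =>
    have e : Finset.Icc (-((N + 1 : ℕ) : ℤ)) ((N + 1 : ℕ) : ℤ) =
        insert (-((N : ℤ) + 1)) (insert ((N : ℤ) + 1) (Finset.Icc (-(N : ℤ)) N)) := by
      ext z
      simp only [Finset.mem_Icc, Finset.mem_insert]
      push_cast
      omega
    rw [e, Finset.sum_insert (by simp; omega), Finset.sum_insert (by simp), ih]
    simp only [annulus, ← mul_assoc]
    have h2 : ∀ k : ℤ, (2 : ℝ) * 2 ^ k = 2 ^ (k + 1) := fun k => by
      rw [zpow_add_one₀ two_ne_zero, mul_comm]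
    rw [h2, h2]
    push_cast
    rw [show -((N : ℤ) + 1) + 1 = -N by ring]
    ring

lemma cKer_modProf (α : ℝ) {Ω : En n → ℝ}
    (hΩhom : ∀ c : ℝ, 0 < c → ∀ x : En n, Ω (c • x) = Ω x) (k l : ℤ) (x y : En n) :
    cKer (modProf α ((2 : ℝ) ^ (((k - l : ℤ) : ℝ) * α)) Ω) l x y =
      Complex.exp (Complex.I * (((2 : ℝ) ^ ((k : ℝ) * α) : ℝ) : ℂ) *
        ((‖x - y‖ ^ α : ℝ) : ℂ)) * (czKernel n Ω (x - y) : ℂ) *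
        (annulus ((2 : ℝ) ^ l * ‖x - y‖) : ℂ) := by
  have h2 : (0 : ℝ) < 2 ^ l := by positivity
  simp only [cKer, modProf, baseProf, czKernel, hΩhom _ h2, norm_smul, Real.norm_of_nonneg h2.le]
  have e : (2 : ℝ) ^ (((k - l : ℤ) : ℝ) * α) * ((2 : ℝ) ^ l * ‖x - y‖) ^ α =
      (2 : ℝ) ^ ((k : ℝ) * α) * ‖x - y‖ ^ α := by
    rw [Real.mul_rpow h2.le (norm_nonneg _), ← mul_assoc, ← Real.rpow_intCast,
      ← Real.rpow_mul zero_le_two, ← Real.rpow_add zero_lt_two]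
    push_cast
    ring_nf
  rw [mul_assoc Complex.I, mul_assoc Complex.I, ← Complex.ofReal_mul, ← Complex.ofReal_mul, e,
    mul_pow]
  have h3 : ((2 : ℂ) ^ l) ^ n ≠ 0 := pow_ne_zero _ (zpow_ne_zero _ two_ne_zero)
  push_cast
  by_cases h4 : ((‖x - y‖ : ℝ) : ℂ) ^ n = 0
  · simp [h4]
  · field_simp

/-- The dyadic truncations converge to the principal value. -/
theorem tendsto_sum_kOp_pvH (hn : 1 ≤ n) {α : ℝ}
    {Ω : En n → ℝ} (hΩ : ContDiffOn ℝ (⊤ : ℕ∞) Ω {x : En n | x ≠ 0})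
    (hΩhom : ∀ c : ℝ, 0 < c → ∀ x : En n, Ω (c • x) = Ω x)
    (hΩmean : ∫ x : sphere (0 : En n) 1, Ω x ∂((volume : Measure (En n)).toSphere) = 0)
    (hM : ∀ (j s : ℤ), NiceKer (cKer (modProf α ((2 : ℝ) ^ ((j : ℝ) * α)) Ω) s))
    (f : SchwartzMap (En n) ℂ) (k : ℤ) (x : En n) :
    Tendsto (fun N : ℕ => ∑ l ∈ Finset.Icc (-(N : ℤ)) N,
      kOp (cKer (modProf α ((2 : ℝ) ^ (((k - l : ℤ) : ℝ) * α)) Ω) l) f x) atTop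
      (𝓝 (pvH n α Ω f ((2 : ℝ) ^ ((k : ℝ) * α)) x)) := by
  obtain ⟨I, hI⟩ := exists_tendsto_truncations hn α ((2 : ℝ) ^ ((k : ℝ) * α)) hΩ hΩhom hΩmean f x
  have h1 := hI (𝓝[>] (0 : ℝ)) (fun ε => (Ioi ε).indicator fun _ => 1)
    (fun ε => measurable_const.indicator measurableSet_Ioi)
    (fun ε r => by
      by_cases h : r ∈ Ioi ε
      · simp [indicator_of_mem h]
      · simp [indicator_of_notMem h])
    (by
      filter_upwards [self_mem_nhdsWithin] with ε hε
      exact ⟨ε, hε, fun r hr => indicator_of_notMem (by simpa using hr.le) _⟩)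
    (fun r hr => by
      refine tendsto_const_nhds.congr' ?_
      filter_upwards [Ioo_mem_nhdsGT hr] with ε hε
      rw [indicator_of_mem (show r ∈ Ioi ε from hε.2)])
  have hpv : pvH n α Ω f ((2 : ℝ) ^ ((k : ℝ) * α)) x = I := by
    refine Tendsto.limUnder_eq (h1.congr fun ε => ?_)
    rw [← integral_indicator (measurableSet_lt measurable_const measurable_norm)]
    refine integral_congr_ae (Eventually.of_forall fun t => ?_)
    by_cases h : ε < ‖t‖
    · simp [indicator, h]
    · simp [indicator, h]
  rw [hpv]
  have hz : ∀ r : ℝ, Tendsto (fun N : ℕ => (2 : ℝ) ^ (-(N : ℤ)) * r) atTop (𝓝 0) := fun r => by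
    have := (tendsto_pow_atTop_nhds_zero_of_lt_one (r := (1 / 2 : ℝ)) (by norm_num)
      (by norm_num)).mul_const r
    simpa using this
  have hi : ∀ r : ℝ, 0 < r → Tendsto (fun N : ℕ => (2 : ℝ) ^ ((N : ℤ) + 1) * r) atTop atTop :=
    fun r hr => by
    have := ((tendsto_pow_atTop_atTop_of_one_lt one_lt_two).comp
      (tendsto_add_atTop_nat 1)).atTop_mul_const hr
    exact this
  have h2 := hI atTop (fun (N : ℕ) r => (Ioi (0 : ℝ)).indicator (fun r =>
      cutoff ((2 : ℝ) ^ (-(N : ℤ)) * r) - cutoff ((2 : ℝ) ^ ((N : ℤ) + 1) * r)) r)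
    (fun N => Measurable.indicator ((contDiff_cutoff.continuous.measurable.comp
      (measurable_const.mul measurable_id)).sub (contDiff_cutoff.continuous.measurable.comp
      (measurable_const.mul measurable_id))) measurableSet_Ioi)
    (fun N r => by
      by_cases h : r ∈ Ioi (0 : ℝ)
      · rw [indicator_of_mem h, abs_le]
        have a1 := cutoff_nonneg ((2 : ℝ) ^ (-(N : ℤ)) * r)
        have a2 := cutoff_nonneg ((2 : ℝ) ^ ((N : ℤ) + 1) * r)
        have a3 := cutoff_le_one ((2 : ℝ) ^ (-(N : ℤ)) * r)
        have a4 := cutoff_le_one ((2 : ℝ) ^ ((N : ℤ) + 1) * r)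
        constructor <;> linarith
      · rw [indicator_of_notMem h]
        simp)
    (Eventually.of_forall fun N => by
      refine ⟨(2 : ℝ) ^ (-((N : ℤ) + 2)), by positivity, fun r hr => ?_⟩
      by_cases h : r ∈ Ioi (0 : ℝ)
      · rw [indicator_of_mem h]
        have h0 : (0 : ℝ) < r := h
        have b : ∀ m : ℤ, m ≤ N + 1 → cutoff ((2 : ℝ) ^ m * r) = 1 := fun m hm => by
          refine cutoff_eq_one (by positivity) ?_
          calc (2 : ℝ) ^ m * r ≤ 2 ^ ((N : ℤ) + 1) * 2 ^ (-((N : ℤ) + 2)) :=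
                mul_le_mul (zpow_le_zpow_right₀ one_le_two hm) hr.le h0.le (by positivity)
            _ = 2 ^ (-1 : ℤ) := by
                rw [← zpow_add₀ two_ne_zero]; congr 1; ring
            _ = 1 / 2 := by norm_num
        rw [b _ (by omega), b _ le_rfl, sub_self]
      · exact indicator_of_notMem h _)
    (fun r hr => by
      refine tendsto_const_nhds.congr' ?_
      filter_upwards [(hz r).eventually_le_const (by norm_num : (0 : ℝ) < 1 / 2),
        (hi r hr).eventually_ge_atTop 1] with N hN1 hN2
      rw [indicator_of_mem (by exact hr), cutoff_eq_one (by positivity) hN1, cutoff_eq_zero hN2,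
        sub_zero])
  refine h2.congr fun N => ?_
  have hf := SchwartzMap.niceFun f
  simp only [kOp]
  rw [← integral_finsetSum _ fun l _ => (hM (k - l) l).integrable_mul hf x]
  rw [← integral_sub_left_eq_self _ volume x]
  refine integral_congr_ae (Eventually.of_forall fun y => ?_)
  simp only [sub_sub_cancel, cKer_modProf α hΩhom]
  have e : (Ioi (0 : ℝ)).indicator (fun r => cutoff ((2 : ℝ) ^ (-(N : ℤ)) * r) -
      cutoff ((2 : ℝ) ^ ((N : ℤ) + 1) * r)) ‖x - y‖ =
      ∑ l ∈ Finset.Icc (-(N : ℤ)) N, annulus ((2 : ℝ) ^ l * ‖x - y‖) := by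
    rw [sum_annulus]
    rcases (norm_nonneg (x - y)).eq_or_lt with h | h
    · rw [← h, indicator_of_notMem (by simp)]
      simp
    · rw [indicator_of_mem (by exact h)]
  rw [e, ← Finset.sum_mul, ← Finset.mul_sum]
  push_cast
  ring

end PrincipalValue

section Assembly

variable {n : ℕ}

lemma le_of_forall_count_le {ι : Type*} [LinearOrder ι] {lam : ℝ} {J : Set ι} {a : ι → ℂ}
    {B : ℝ≥0∞} (h : ∀ (N : ℕ) (s t : Fin N → ι), (∀ i, s i ∈ J) → (∀ i, t i ∈ J) →
      (∀ i, s i < t i) → (∀ i j, i < j → t i < s j) → (∀ i, lam < ‖a (t i) - a (s i)‖) →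
      ENNReal.ofReal lam * (N : ℝ≥0∞) ^ ((1 : ℝ) / 2) ≤ B) (hlam : 0 < lam) :
    ENNReal.ofReal lam * jumpCount lam J a ^ ((1 : ℝ) / 2) ≤ B := by
  have hl0 : ENNReal.ofReal lam ≠ 0 := by simpa using hlam
  have key : jumpCount lam J a ≤ (B / ENNReal.ofReal lam) ^ (2 : ℝ) := by
    refine iSup_le fun N => iSup_le fun s => iSup_le fun t => iSup_le fun h1 => iSup_le fun h2 =>
      iSup_le fun h3 => iSup_le fun h4 => iSup_le fun h5 => ?_
    have h6 : (N : ℝ≥0∞) ^ ((1 : ℝ) / 2) ≤ B / ENNReal.ofReal lam := by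
      rw [ENNReal.le_div_iff_mul_le (Or.inl hl0) (Or.inl ENNReal.ofReal_ne_top), mul_comm]
      exact h N s t h1 h2 h3 h4 h5
    calc (N : ℝ≥0∞) = ((N : ℝ≥0∞) ^ ((1 : ℝ) / 2)) ^ (2 : ℝ) := by
          rw [← ENNReal.rpow_mul]; norm_num
      _ ≤ _ := ENNReal.rpow_le_rpow h6 (by norm_num)
  calc ENNReal.ofReal lam * jumpCount lam J a ^ ((1 : ℝ) / 2)
      ≤ ENNReal.ofReal lam * ((B / ENNReal.ofReal lam) ^ (2 : ℝ)) ^ ((1 : ℝ) / 2) := by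
        gcongr
    _ = B := by
        rw [← ENNReal.rpow_mul]
        norm_num
        exact ENNReal.mul_div_cancel hl0 ENNReal.ofReal_ne_top

/-- Lower semicontinuity of jump counts along exhausting windows of indices. -/
lemma ofReal_mul_jumpCount_le_liminf {lam : ℝ} (hlam : 0 < lam) {a : ℤ → ℂ} {b : ℕ → ℤ → ℂ}
    (hb : ∀ k, Tendsto (fun N => b N k) atTop (𝓝 (a k))) {F : ℕ → ℝ≥0∞}
    (hF : ∀ N : ℕ, ENNReal.ofReal lam *
      jumpCount lam (Set.Icc (-(N : ℤ)) N) (b N) ^ ((1 : ℝ) / 2) ≤ F N) :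
    ENNReal.ofReal lam * jumpCount lam univ a ^ ((1 : ℝ) / 2) ≤ liminf F atTop := by
  refine le_of_forall_count_le (fun m s t _ _ hst hts hj => ?_) hlam
  refine le_liminf_of_le (by isBoundedDefault) ?_
  have e1 : ∀ k : ℤ, ∀ᶠ N : ℕ in atTop, k ∈ Set.Icc (-(N : ℤ)) N := fun k => by
    filter_upwards [eventually_ge_atTop k.natAbs] with N hN
    constructor <;> omega
  have e2 : ∀ i, ∀ᶠ N : ℕ in atTop, lam < ‖b N (t i) - b N (s i)‖ := fun i =>
    (((hb (t i)).sub (hb (s i))).norm).eventually_const_lt (hj i)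
  filter_upwards [eventually_all.2 fun i => e1 (s i), eventually_all.2 fun i => e1 (t i),
    eventually_all.2 e2] with N h1 h2 h3
  refine le_trans ?_ (hF N)
  gcongr
  exact le_iSup_of_le m <| le_iSup_of_le s <| le_iSup_of_le t <| le_iSup_of_le h1 <|
    le_iSup_of_le h2 <| le_iSup_of_le hst <| le_iSup_of_le hts <| le_iSup_of_le h3 le_rfl

lemma ProfFam.niceKer {W : En n → ℂ} {M : ℤ → En n → ℂ} {β K : ℝ} (h : ProfFam W M β K)
    (j s : ℤ) : NiceKer (cKer (M j) s) := by
  obtain ⟨m, rfl | rfl⟩ := j.eq_nat_or_neg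
  · exact (h.osc m).niceKer s
  · exact h.niceKer_neg m s

end Assembly

theorem statement8 (n : ℕ) (hn : 1 ≤ n) (α : ℝ) (hα : 0 < α) (hα1 : α ≠ 1)
    (Ω : En n → ℝ) (hΩsmooth : ContDiffOn ℝ (⊤ : ℕ∞) Ω {x : En n | x ≠ 0})
    (hΩhom : ∀ c : ℝ, 0 < c → ∀ x : En n, Ω (c • x) = Ω x)
    (hΩmean : ∫ x : sphere (0 : En n) 1, Ω x ∂((volume : Measure (En n)).toSphere) = 0)
    (p : ℝ) (hp1 : 1 < p) :
    ∃ C : ℝ≥0, ∀ f : SchwartzMap (En n) ℂ, ∀ lam : ℝ, 0 < lam →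
      (∫⁻ x : En n,
          (ENNReal.ofReal lam *
            (jumpCount lam Set.univ
                fun k : ℤ => pvH n α Ω f ((2 : ℝ) ^ ((k : ℝ) * α)) x) ^ ((1 : ℝ) / 2)) ^
            p) ^ (1 / p) ≤
        C * eLpNorm (fun x => f x) (ENNReal.ofReal p) volume := by
  have hp0 : 0 < p := zero_lt_one.trans hp1
  obtain ⟨K, hK⟩ := exists_profFam hn hα hα1 hΩsmooth hΩhom hΩmean
  obtain ⟨C, hC0, hC⟩ := hK.exists_jump_bound hn hp1
  refine ⟨C.toNNReal, fun f lam hlam => ?_⟩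
  choose F hFm hF hFp using fun N => hC N f lam f.niceFun hlam
  have hnorm : eLpNorm (fun x => f x) (ENNReal.ofReal p) volume = lpn p fun x => ‖f x‖ₑ := by
    rw [eLpNorm_eq_lintegral_rpow_enorm_toReal (by simpa using hp0) ENNReal.ofReal_ne_top,
      ENNReal.toReal_ofReal hp0.le, lpn]
  rw [hnorm]
  change _ ≤ ENNReal.ofReal C * _
  set B := ENNReal.ofReal C * lpn p fun x => ‖f x‖ₑ with hB
  have hpow : ∀ N, ∫⁻ x, F N x ^ p ≤ B ^ p := fun N => by
    have := ENNReal.rpow_le_rpow (hFp N) hp0.le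
    rwa [lpn, ← ENNReal.rpow_mul, one_div_mul_cancel hp0.ne', ENNReal.rpow_one] at this
  have hmain : ∫⁻ x, (ENNReal.ofReal lam * (jumpCount lam Set.univ
      fun k : ℤ => pvH n α Ω f ((2 : ℝ) ^ ((k : ℝ) * α)) x) ^ ((1 : ℝ) / 2)) ^ p ≤ B ^ p := by
    calc _ ≤ ∫⁻ x, liminf (fun N => F N x ^ p) atTop := by
          refine lintegral_mono fun x => ?_
          have h1 := ofReal_mul_jumpCount_le_liminf hlam
            (fun k => tendsto_sum_kOp_pvH hn hΩsmooth hΩhom hΩmean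
              (fun j s => hK.niceKer j s) f k x) (F := fun N => F N x) fun N => hF N x
          have h2 := ENNReal.rpow_le_rpow h1 hp0.le
          refine h2.trans (le_of_eq ?_)
          exact (ENNReal.monotone_rpow_of_nonneg hp0.le).map_liminf_of_continuousAt _
            ENNReal.continuous_rpow_const.continuousAt
      _ ≤ liminf (fun N => ∫⁻ x, F N x ^ p) atTop :=
          lintegral_liminf_le fun N => (hFm N).pow_const p
      _ ≤ B ^ p := by
          refine liminf_le_of_le (by isBoundedDefault) fun b hb => ?_
          obtain ⟨N, hN⟩ := hb.exists
          exact hN.trans (hpow N)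
  calc _ ≤ (B ^ p) ^ (1 / p) := ENNReal.rpow_le_rpow hmain (by positivity)
    _ = B := by rw [← ENNReal.rpow_mul, mul_one_div_cancel hp0.ne', ENNReal.rpow_one]

end
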